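/- arXiv:math/0703148 — 3 statements merged into one kernel-verified Lean document; each statement's English description precedes it below -/
import Mathlib

section
/- Let (R,m) be a Noetherian local complete ring, I an ideal of R, h ∈ ℕ, and x = x_1,…,x_h ∈ I an R-regular sequence. Then the R-module D(H^h_{xR}(D(H^h_I(R)))) is isomorphic to the ideal J_{x,I} := {r ∈ R : for every l ∈ ℕ there exists s ∈ ℕ with r·I^s ⊆ (x_1^l,…,x_h^l)R} of R. -/
open CategoryTheory

/-- The ideal `J_{x,I} = {r ∈ R | ∀ l ∃ s, r·Iˢ ⊆ (x₁ˡ,…,x_hˡ)R}`. -/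
def Jideal {R : Type} [CommRing R] (I : Ideal R) {h : ℕ} (x : Fin h → R) : Ideal R where
  carrier := {r : R | ∀ l : ℕ, ∃ s : ℕ, ∀ a ∈ I ^ s,
    r * a ∈ Ideal.span (Set.range fun i => x i ^ l)}
  zero_mem' := fun l => ⟨0, fun a _ => by simp [Ideal.zero_mem]⟩
  add_mem' := by
    intro r r' hr hr' l
    obtain ⟨s, hs⟩ := hr l
    obtain ⟨s', hs'⟩ := hr' l
    refine ⟨max s s', fun a ha => ?_⟩
    have h1 : a ∈ I ^ s := Ideal.pow_le_pow_right (le_max_left s s') ha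
    have h2 : a ∈ I ^ s' := Ideal.pow_le_pow_right (le_max_right s s') ha
    simpa [add_mul] using Ideal.add_mem _ (hs a h1) (hs' a h2)
  smul_mem' := by
    intro c r hr l
    obtain ⟨s, hs⟩ := hr l
    exact ⟨s, fun a ha => by
      simpa [smul_eq_mul, mul_assoc] using Ideal.mul_mem_left _ c (hs a ha)⟩

namespace S12

section Matlis

variable {R : Type} [CommRing R] {E : Type} [AddCommGroup E] [Module R E]

/-- Extension of maps along maps, using injectivity of `E`. -/
lemma inj_ext [Module.Injective R E] {P M : Type} [AddCommGroup P] [Module R P]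
    [AddCommGroup M] [Module R M] (g : P →ₗ[R] M) (f : P →ₗ[R] E)
    (hk : ∀ p, g p = 0 → f p = 0) : ∃ u : M →ₗ[R] E, ∀ p, u (g p) = f p := by
  obtain ⟨u, hu⟩ := Module.Injective.out (Q := E) (X := P ⧸ LinearMap.ker g) (Y := M)
    ((LinearMap.ker g).liftQ g le_rfl)
    (by
      rw [← LinearMap.ker_eq_bot, Submodule.ker_liftQ_eq_bot]
      exact le_rfl)
    ((LinearMap.ker g).liftQ f (fun p hp => hk p hp))
  exact ⟨u, fun p => hu (Submodule.Quotient.mk p)⟩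

variable [IsLocalRing R]
  (e : IsLocalRing.ResidueField R →ₗ[R] E) (he : Function.Injective e)
  (hess : ∀ N : Submodule R E, N ≠ ⊥ → N ⊓ LinearMap.range e ≠ ⊥)

/-- The map `R → k → E`. -/
noncomputable def eR : R →ₗ[R] E := e ∘ₗ (Algebra.linearMap R (IsLocalRing.ResidueField R))

include he in
lemma eR_eq_zero (r : R) : eR e r = 0 ↔ r ∈ IsLocalRing.maximalIdeal R := by
  rw [eR, LinearMap.comp_apply, map_eq_zero_iff _ he]
  exact IsLocalRing.residue_eq_zero_iff r

lemma range_e (z : E) (hz : z ∈ LinearMap.range e) : ∃ r : R, z = r • eR e 1 := by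
  obtain ⟨b, rfl⟩ := hz
  obtain ⟨r, rfl⟩ := IsLocalRing.residue_surjective b
  refine ⟨r, ?_⟩
  rw [← map_smul]
  simp [eR]

include hess in
lemma socle (z : E) (hz : ∀ t ∈ IsLocalRing.maximalIdeal R, t • z = 0) :
    ∃ r : R, z = r • eR e 1 := by
  by_cases hz0 : z = 0
  · exact ⟨0, by simp [hz0]⟩
  apply range_e
  have h1 := hess (Submodule.span R {z}) (by simpa using hz0)
  obtain ⟨y, hy, hy0⟩ := Submodule.exists_mem_ne_zero_of_ne_bot h1
  obtain ⟨hy1, hy2⟩ := hy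
  obtain ⟨a, rfl⟩ := Submodule.mem_span_singleton.1 hy1
  have ha : IsUnit a := by
    by_contra hna
    exact hy0 (hz a ((IsLocalRing.mem_maximalIdeal a).2 hna))
  obtain ⟨a, rfl⟩ := ha
  have := Submodule.smul_mem _ (↑a⁻¹ : R) hy2
  simpa [smul_smul] using this

include he in
lemma cogen [Module.Injective R E] {M : Type} [AddCommGroup M] [Module R M] (m : M) (hm : m ≠ 0) :
    ∃ u : M →ₗ[R] E, u m ≠ 0 := by
  obtain ⟨u, hu⟩ := inj_ext (LinearMap.toSpanSingleton R M m) (eR e) (by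
    intro p hp
    rw [eR_eq_zero e he, IsLocalRing.mem_maximalIdeal]
    intro hpu
    obtain ⟨p, rfl⟩ := hpu
    apply hm
    have : (↑p⁻¹ : R) • ((p : R) • m) = 0 := by
      rw [LinearMap.toSpanSingleton_apply] at hp
      rw [hp, smul_zero]
    simpa [smul_smul] using this)
  refine ⟨u, ?_⟩
  have := hu 1
  rw [LinearMap.toSpanSingleton_apply, one_smul] at this
  rw [this, Ne, eR_eq_zero e he]
  exact (Ideal.ne_top_iff_one _).1 (IsLocalRing.maximalIdeal.isMaximal R).ne_top

include he in
lemma cogen_sub [Module.Injective R E] {M : Type} [AddCommGroup M] [Module R M]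
    (N : Submodule R M) (m : M) (hm : ∀ u : M →ₗ[R] E, (∀ n ∈ N, u n = 0) → u m = 0) :
    m ∈ N := by
  by_contra hmN
  obtain ⟨u, hu⟩ := cogen e he (N.mkQ m) (by simpa using hmN)
  exact hu (hm (u ∘ₗ N.mkQ) (fun n hn => by
    have : N.mkQ n = 0 := by simpa using hn
    rw [LinearMap.comp_apply, this, map_zero]))

include hess in
lemma torsionE [IsNoetherianRing R] (z : E) :
    ∃ n : ℕ, ∀ t ∈ IsLocalRing.maximalIdeal R ^ n, t • z = 0 := by
  set m := IsLocalRing.maximalIdeal R with hm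
  let N := Submodule.span R {z}
  have : Module.Finite R N := Module.Finite.span_singleton R z
  let S : Submodule R N := (LinearMap.range e).comap N.subtype
  obtain ⟨k, hk⟩ := Ideal.exists_pow_inf_eq_pow_smul m S
  have h1 := hk (k + 1) (by omega)
  have h2 : m ^ (k + 1) • (⊤ : Submodule R N) ⊓ S = ⊥ := by
    rw [h1, eq_bot_iff, show k + 1 - k = 1 by omega, pow_one]
    refine (Submodule.smul_mono le_rfl inf_le_right).trans ?_
    rw [Submodule.smul_le]
    intro r hr s hs
    rw [Submodule.mem_bot]
    ext
    obtain ⟨b, hb⟩ := hs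
    have : ((r • s : N) : E) = e (r • b) := by
      rw [map_smul, hb]; rfl
    rw [this]
    have : r • b = 0 := by
      rw [Algebra.smul_def]
      have : algebraMap R (IsLocalRing.ResidueField R) r = 0 :=
        (IsLocalRing.residue_eq_zero_iff r).2 hr
      rw [this, zero_mul]
    rw [this]; simp
  have h3 : (m ^ (k + 1) • (⊤ : Submodule R N)).map N.subtype = ⊥ := by
    by_contra hne
    apply hess _ hne
    rw [eq_bot_iff]
    rintro y ⟨⟨w, hw, rfl⟩, hy⟩
    have : w ∈ m ^ (k + 1) • (⊤ : Submodule R N) ⊓ S := ⟨hw, hy⟩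
    rw [h2, Submodule.mem_bot] at this
    simp [this]
  refine ⟨k + 1, fun t ht => ?_⟩
  have : t • z ∈ (m ^ (k + 1) • (⊤ : Submodule R N)).map N.subtype :=
    ⟨t • ⟨z, Submodule.mem_span_singleton_self z⟩, Submodule.smul_mem_smul ht trivial, rfl⟩
  rw [h3] at this
  exact this

/-- relative biduality -/
def RelBD (E : Type) [AddCommGroup E] [Module R E] {M : Type} [AddCommGroup M] [Module R M]
    (N : Submodule R M) : Prop :=
  ∀ φ : (M →ₗ[R] E) →ₗ[R] E, (∀ u : M →ₗ[R] E, (∀ n ∈ N, u n = 0) → φ u = 0) →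
    ∃ n ∈ N, ∀ u, φ u = u n

include he hess in
lemma relBD_step [Module.Injective R E] {M : Type} [AddCommGroup M] [Module R M]
    (N : Submodule R M) (hN : RelBD E N) (q : M) (hqN : q ∉ N)
    (hq : ∀ t ∈ IsLocalRing.maximalIdeal R, t • q ∈ N) :
    RelBD E (N ⊔ Submodule.span R {q}) := by
  intro φ hφ
  obtain ⟨u0', hu0⟩ := inj_ext (LinearMap.toSpanSingleton R (M ⧸ N) (N.mkQ q)) (eR e) (by
    intro p hp
    rw [eR_eq_zero e he, IsLocalRing.mem_maximalIdeal]
    intro hpu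
    obtain ⟨p, rfl⟩ := hpu
    rw [LinearMap.toSpanSingleton_apply, ← map_smul, Submodule.mkQ_apply,
      Submodule.Quotient.mk_eq_zero] at hp
    apply hqN
    have := N.smul_mem (↑p⁻¹ : R) hp
    simpa [smul_smul] using this)
  let u0 : M →ₗ[R] E := u0' ∘ₗ N.mkQ
  have hu0N : ∀ n ∈ N, u0 n = 0 := fun n hn => by
    have : N.mkQ n = 0 := by simpa using hn
    simp only [u0]
    rw [LinearMap.comp_apply, this, map_zero]
  have hu0q : u0 q = eR e 1 := by
    have := hu0 1
    rwa [LinearMap.toSpanSingleton_apply, one_smul] at this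
  have hkill : ∀ u : M →ₗ[R] E, (∀ n ∈ N, u n = 0) → u q = 0 → φ u = 0 := by
    intro u hu huq
    apply hφ
    intro n hn
    have : N ⊔ Submodule.span R {q} ≤ LinearMap.ker u := by
      rw [sup_le_iff]
      refine ⟨fun n hn => hu n hn, ?_⟩
      rw [Submodule.span_singleton_le_iff_mem]
      exact huq
    exact this hn
  have hmE : ∀ t ∈ IsLocalRing.maximalIdeal R, t • eR e (1 : R) = 0 := by
    intro t ht
    rw [← map_smul, eR_eq_zero e he]
    simpa using ht
  obtain ⟨c, hc⟩ := socle e hess (φ u0) (by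
    intro t ht
    rw [← map_smul]
    apply hkill
    · intro n hn; simp [hu0N n hn]
    · simp [hu0q, hmE t ht])
  have hV : ∀ u : M →ₗ[R] E, (∀ n ∈ N, u n = 0) → φ u = c • u q := by
    intro u hu
    obtain ⟨a, ha⟩ := socle e hess (u q) (by
      intro t ht
      rw [← map_smul]
      exact hu _ (hq t ht))
    have h1 : φ (u - a • u0) = 0 := by
      apply hkill
      · intro n hn; simp [hu0N n hn, hu n hn]
      · simp [hu0q, ha]
    rw [map_sub, map_smul, sub_eq_zero] at h1
    rw [h1, hc, ha, smul_comm]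
  obtain ⟨n, hn, hn'⟩ := hN (φ - c • LinearMap.applyₗ q) (by
    intro u hu
    simp [hV u hu])
  refine ⟨n + c • q, Submodule.add_mem_sup hn
    (Submodule.smul_mem _ _ (Submodule.mem_span_singleton_self q)), fun u => ?_⟩
  have := hn' u
  simp only [LinearMap.sub_apply, LinearMap.smul_apply, LinearMap.applyₗ_apply_apply] at this
  rw [map_add, map_smul, ← this]
  abel

include he hess in
lemma bd_of_pow [IsNoetherianRing R] [Module.Injective R E] {M : Type} [AddCommGroup M]
    [Module R M] [Module.Finite R M] (n : ℕ)
    (hn : ∀ t ∈ IsLocalRing.maximalIdeal R ^ n, ∀ z : M, t • z = 0)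
    (φ : (M →ₗ[R] E) →ₗ[R] E) : ∃ z : M, ∀ u, φ u = u z := by
  have hne : {N : Submodule R M | RelBD E N}.Nonempty := ⟨⊥, by
    intro φ hφ
    refine ⟨0, by simp, fun u => ?_⟩
    rw [map_zero]
    exact hφ u (by simp)⟩
  obtain ⟨N, hN, hmax⟩ := set_has_maximal_iff_noetherian.2 (inferInstance : IsNoetherian R M) _ hne
  have htop : N = ⊤ := by
    by_contra hNt
    obtain ⟨z, hz⟩ : ∃ z, z ∉ N := by
      by_contra hcon
      push Not at hcon
      exact hNt (eq_top_iff.2 fun z _ => hcon z)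
    classical
    have hex : ∃ k, ∀ t ∈ IsLocalRing.maximalIdeal R ^ k, t • z ∈ N :=
      ⟨n, fun t ht => by rw [hn t ht]; exact N.zero_mem⟩
    have hk := Nat.find_spec hex
    have hk' := fun j => Nat.find_min (H := hex) (m := j)
    generalize Nat.find hex = k at hk hk'
    rcases k with _ | k
    · apply hz
      simpa using hk 1 (by simp)
    · have := hk' k (by omega)
      push Not at this
      obtain ⟨t, ht, htN⟩ := this
      refine hmax _ (relBD_step e he hess N hN (t • z) htN ?_) ?_
      · intro s hs
        rw [smul_smul]
        apply hk
        rw [pow_succ']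
        exact Ideal.mul_mem_mul hs ht
      · refine lt_of_le_of_ne le_sup_left fun heq => htN ?_
        rw [heq]
        exact (le_sup_right : _ ≤ N ⊔ _) (Submodule.mem_span_singleton_self _)
  subst htop
  obtain ⟨z, -, hz⟩ := hN φ (by
    intro u hu
    have : u = 0 := LinearMap.ext fun n => hu n trivial
    rw [this, map_zero])
  exact ⟨z, hz⟩

lemma precomplete_of_finite (I : Ideal R) [IsAdicComplete I R] {M : Type} [AddCommGroup M]
    [Module R M] [Module.Finite R M] : IsPrecomplete I M := by
  rw [← AdicCompletion.of_surjective_iff]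
  intro y
  obtain ⟨x, rfl⟩ := AdicCompletion.ofTensorProduct_surjective_of_finite I M y
  induction x using TensorProduct.induction_on with
  | zero => exact ⟨0, by simp⟩
  | tmul r z =>
    obtain ⟨r, rfl⟩ := AdicCompletion.of_surjective I R r
    refine ⟨r • z, ?_⟩
    rw [AdicCompletion.ofTensorProduct_tmul, map_smul]
    ext n
    change _ = (Ideal.Quotient.mk _ r) • (Submodule.Quotient.mk z : M ⧸ (I ^ n • ⊤ : Submodule R M))
    rfl
  | add a b ha hb =>
    obtain ⟨a', ha'⟩ := ha
    obtain ⟨b', hb'⟩ := hb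
    exact ⟨a' + b', by rw [map_add, map_add, ha', hb']⟩

include he hess in
/-- Matlis biduality for finite modules over a complete local ring. -/
lemma matlis [IsNoetherianRing R] [IsAdicComplete (IsLocalRing.maximalIdeal R) R]
    [Module.Injective R E] {M : Type} [AddCommGroup M]
    [Module R M] [Module.Finite R M]
    (φ : (M →ₗ[R] E) →ₗ[R] E) : ∃ z : M, ∀ u, φ u = u z := by
  set m := IsLocalRing.maximalIdeal R with hm
  have h1 : ∀ n : ℕ, ∃ z : M, ∀ u : M →ₗ[R] E,
      (∀ y ∈ (m ^ n • ⊤ : Submodule R M), u y = 0) → φ u = u z := by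
    intro n
    set N : Submodule R M := m ^ n • ⊤ with hN
    obtain ⟨z, hz⟩ := bd_of_pow e he hess (M := M ⧸ N) n (by
      intro t ht z
      obtain ⟨z, rfl⟩ := N.mkQ_surjective z
      rw [← map_smul, Submodule.mkQ_apply, Submodule.Quotient.mk_eq_zero]
      exact Submodule.smul_mem_smul ht trivial) (φ ∘ₗ LinearMap.lcomp R E N.mkQ)
    obtain ⟨z, rfl⟩ := N.mkQ_surjective z
    refine ⟨z, fun u hu => ?_⟩
    have hu' : N ≤ LinearMap.ker u := fun y hy => hu y hy
    have := hz (N.liftQ u hu')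
    rw [LinearMap.comp_apply, LinearMap.lcomp_apply'] at this
    have h2 : N.liftQ u hu' ∘ₗ N.mkQ = u := N.liftQ_mkQ u hu'
    rw [h2] at this
    rw [this]
    rfl
  choose z hz using h1
  have : IsPrecomplete m M := precomplete_of_finite m
  have hmono : ∀ {a b : ℕ}, a ≤ b → (m ^ b • ⊤ : Submodule R M) ≤ m ^ a • ⊤ := fun h =>
    Submodule.smul_mono_left (Ideal.pow_le_pow_right h)
  obtain ⟨L, hL⟩ := IsPrecomplete.prec (I := m) (M := M) inferInstance (f := z) (by
    intro a b hab
    rw [SModEq.sub_mem]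
    apply cogen_sub e he
    intro u hu
    rw [map_sub, ← hz a u hu, ← hz b u (fun y hy => hu y (hmono hab hy)), sub_self])
  refine ⟨L, fun u => ?_⟩
  have hu : ∃ n, ∀ y ∈ (m ^ n • ⊤ : Submodule R M), u y = 0 := by
    obtain ⟨S, hS⟩ := Module.Finite.fg_top (R := R) (M := M)
    choose k hk using fun y : M => torsionE e hess (u y)
    refine ⟨S.sup k, fun y hy => ?_⟩
    have : (m ^ (S.sup k) • ⊤ : Submodule R M) ≤ LinearMap.ker u := by
      rw [Submodule.smul_le]
      intro r hr w _
      have hw : w ∈ Submodule.span R (S : Set M) := by rw [hS]; trivial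
      rw [LinearMap.mem_ker, map_smul]
      induction hw using Submodule.span_induction with
      | mem x hx => exact hk x r (Ideal.pow_le_pow_right (Finset.le_sup hx) hr)
      | zero => simp
      | add x y _ _ hx hy => rw [map_add, smul_add, hx trivial, hy trivial, add_zero]
      | smul a x _ hx => rw [map_smul, smul_comm, hx trivial, smul_zero]
    exact this hy
  obtain ⟨n, hn⟩ := hu
  rw [hz n u hn]
  have := hL n
  rw [SModEq.sub_mem] at this
  have := hn _ this
  rwa [map_sub, sub_eq_zero] at this

end Matlis


section OldNew
open CategoryTheory Limits Opposite
universe u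
variable {R : Type} [CommRing R]

section
variable (K : ChainComplex (ModuleCat.{0} R)ᵒᵖ ℕ) (n : ℕ)

noncomputable def iZ : (K.opcycles n).unop →ₗ[R] (K.X n).unop := (K.pOpcycles n).unop.hom
noncomputable def pZ : (K.opcycles n).unop →ₗ[R] (K.homology n).unop := (K.homologyι n).unop.hom

lemma iZ_inj : Function.Injective (iZ K n) :=
  (ModuleCat.mono_iff_injective (K.pOpcycles n).unop).1 inferInstance

lemma pZ_surj : Function.Surjective (pZ K n) :=
  (ModuleCat.epi_iff_surjective (K.homologyι n).unop).1 inferInstance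

lemma iZ_d (z) : (K.d (n+1) n).unop.hom (iZ K n z) = 0 := by
  have : (K.pOpcycles n).unop ≫ (K.d (n+1) n).unop = 0 := by
    rw [← unop_comp, K.d_pOpcycles]; rfl
  exact congrArg (fun t => t.hom z) this

lemma iZ_ex (f) (hf : (K.d (n+1) n).unop.hom f = 0) : ∃ z, iZ K n z = f := by
  let S : ShortComplex (ModuleCat.{0} R)ᵒᵖ :=
    ShortComplex.mk (K.d (n+1) n) (K.pOpcycles n) (K.d_pOpcycles _ _)
  have hS : S.Exact := S.exact_of_g_is_cokernel (K.opcyclesIsCokernel (n+1) n (by simp))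
  exact (ShortComplex.moduleCat_exact_iff _).1 hS.unop f hf

lemma pZ_ker_succ (z : (K.opcycles (n+1)).unop) :
    pZ K (n+1) z = 0 ↔ ∃ g : (K.X n).unop, (K.d (n+1) n).unop.hom g = iZ K (n+1) z := by
  let S : ShortComplex (ModuleCat.{0} R)ᵒᵖ :=
    ShortComplex.mk (K.homologyι (n+1)) (K.fromOpcycles (n+1) n) (K.homologyι_comp_fromOpcycles _ _)
  have hS : S.Exact := S.exact_of_f_is_kernel (K.homologyIsKernel (n+1) n (by simp))
  have h1 : (K.fromOpcycles (n+1) n).unop ≫ (K.pOpcycles (n+1)).unop = (K.d (n+1) n).unop := by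
    rw [← unop_comp, K.p_fromOpcycles]
  have h1' : ∀ g, iZ K (n+1) ((K.fromOpcycles (n+1) n).unop.hom g) = (K.d (n+1) n).unop.hom g :=
    fun g => congrArg (fun t => t.hom g) h1
  have h2 : (K.fromOpcycles (n+1) n).unop ≫ (K.homologyι (n+1)).unop = 0 := by
    rw [← unop_comp, K.homologyι_comp_fromOpcycles]; rfl
  constructor
  · intro h
    obtain ⟨g, hg⟩ := (ShortComplex.moduleCat_exact_iff _).1 hS.unop z h
    exact ⟨g, (h1' g).symm.trans (congrArg (iZ K (n+1)) hg)⟩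
  · rintro ⟨g, hg⟩
    rw [← h1'] at hg
    rw [← iZ_inj K _ hg]
    exact congrArg (fun t => t.hom g) h2

lemma pZ_ker_zero (z : (K.opcycles 0).unop) (h : pZ K 0 z = 0) : z = 0 := by
  have : Mono (K.homologyι 0).unop := inferInstance
  exact (ModuleCat.mono_iff_injective (K.homologyι 0).unop).1 this (h.trans (map_zero _).symm)

end

section
variable {K L : ChainComplex (ModuleCat.{0} R)ᵒᵖ ℕ} (φ : K ⟶ L) (n : ℕ)
lemma iZ_nat (z) : iZ K n ((HomologicalComplex.opcyclesMap φ n).unop.hom z)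
    = (φ.f n).unop.hom (iZ L n z) := by
  have : (HomologicalComplex.opcyclesMap φ n).unop ≫ (K.pOpcycles n).unop =
    (L.pOpcycles n).unop ≫ (φ.f n).unop := by
    rw [← unop_comp, ← unop_comp, HomologicalComplex.p_opcyclesMap]
  exact congrArg (fun t => t.hom z) this
lemma pZ_nat (z) : pZ K n ((HomologicalComplex.opcyclesMap φ n).unop.hom z)
    = (HomologicalComplex.homologyMap φ n).unop.hom (pZ L n z) := by
  have : (HomologicalComplex.opcyclesMap φ n).unop ≫ (K.homologyι n).unop =
    (L.homologyι n).unop ≫ (HomologicalComplex.homologyMap φ n).unop := by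
    rw [← unop_comp, ← unop_comp, HomologicalComplex.homologyι_naturality]
  exact congrArg (fun t => t.hom z) this
end


abbrev CC (R : Type) [CommRing R] := ModuleCat.{0} R
variable {X Y : CC R} (P : ProjectiveResolution X)

noncomputable abbrev FY (Y : CC R) : CC R ⥤ (CC R)ᵒᵖ := ((linearYoneda R (CC R)).obj Y).rightOp

noncomputable abbrev KP (Y : CC R) : ChainComplex (CC R)ᵒᵖ ℕ :=
  ((FY Y).mapHomologicalComplex _).obj P.complex

/-- cocycle attached to z -/
noncomputable def coc (n : ℕ) : ((KP P Y).opcycles n).unop →ₗ[R] (P.complex.X n ⟶ Y) :=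
  iZ (KP P Y) n

lemma coc_d (n : ℕ) (z) : P.complex.d (n+1) n ≫ coc (Y := Y) P n z = 0 := 
  iZ_d (KP P Y) n z

lemma coc_inj (n : ℕ) : Function.Injective (coc (Y := Y) P n) := iZ_inj _ _

lemma coc_ex (n : ℕ) (f : P.complex.X n ⟶ Y) (hf : P.complex.d (n+1) n ≫ f = 0) :
    ∃ z, coc (Y := Y) P n z = f := iZ_ex (KP P Y) n f hf

lemma extMk_congr (n : ℕ) (f g : P.complex.X n ⟶ Y) (hf hg) (h : f = g) :
   P.extMk f (n+1) rfl hf = P.extMk g (n+1) rfl hg := by subst h; rfl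

noncomputable def qZ (n : ℕ) : ((KP P Y).opcycles n).unop →ₗ[R] Abelian.Ext X Y n where
  toFun z := P.extMk (coc P n z) (n+1) rfl (coc_d P n z)
  map_add' a b := by
    rw [P.add_extMk]
    exact extMk_congr _ _ _ _ _ _ (map_add _ _ _)
  map_smul' r a := by
    rw [RingHom.id_apply, Abelian.Ext.smul_eq_comp_mk₀, P.extMk_comp_mk₀]
    refine extMk_congr _ _ _ _ _ _ ?_
    rw [map_smul, Linear.comp_smul, Category.comp_id]

lemma qZ_surj (n : ℕ) : Function.Surjective (qZ (Y := Y) P n) := by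
  intro α
  obtain ⟨f, hf, h⟩ := P.extMk_surjective α (n+1) rfl
  obtain ⟨z, hz⟩ := coc_ex P n f hf
  exact ⟨z, (extMk_congr P n _ _ (coc_d P n z) hf hz).trans h⟩

lemma extMk_zero_inj (f : P.complex.X 0 ⟶ Y) (hf : P.complex.d 1 0 ≫ f = 0)
    (h : P.extMk f 1 rfl hf = 0) : f = 0 := by
  simp only [← P.extEquivCohomologyClass.apply_eq_iff_eq,
    ProjectiveResolution.extEquivCohomologyClass_extMk, 
    ProjectiveResolution.extEquivCohomologyClass_zero,
    CochainComplex.HomComplex.CohomologyClass.mk_eq_zero_iff] at h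
  rw [CochainComplex.HomComplex.Cocycle.toSingleMk_mem_coboundaries_iff _ _ _ _ _ (1) (by lia)] at h
  obtain ⟨g, hg⟩ := h
  have : g = 0 := (CochainComplex.isZero_of_isStrictlyLE P.cochainComplex 0 1 (by simp)).eq_of_src _ _
  rw [this, comp_zero] at hg
  rw [← cancel_epi (P.cochainComplexXIso (-(0:ℕ)) 0 rfl).hom, comp_zero]
  exact hg.symm

lemma qZ_ker (n : ℕ) (z) : qZ (Y := Y) P n z = 0 ↔ pZ (KP P Y) n z = 0 := by
  cases n with
  | zero =>
    constructor
    · intro h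
      have := extMk_zero_inj P _ (coc_d P 0 z) h
      rw [coc_inj P 0 (this.trans (map_zero _).symm), map_zero]
    · intro h
      rw [pZ_ker_zero _ _ h, map_zero]
  | succ n =>
    rw [pZ_ker_succ]
    exact P.extMk_eq_zero_iff _ _ rfl (coc_d P (n+1) z) n rfl

noncomputable def equivOfSurj {A B C : Type} [AddCommGroup A] [AddCommGroup B] [AddCommGroup C]
    [Module R A] [Module R B] [Module R C] (p : A →ₗ[R] B) (q : A →ₗ[R] C)
    (hp : Function.Surjective p) (hq : Function.Surjective q) (h : ∀ a, q a = 0 ↔ p a = 0) :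
    B ≃ₗ[R] C :=
  (p.quotKerEquivOfSurjective hp).symm.trans
   ((Submodule.quotEquivOfEq _ _ (by ext a; exact (h a).symm)).trans (q.quotKerEquivOfSurjective hq))

lemma equivOfSurj_apply {A B C : Type} [AddCommGroup A] [AddCommGroup B] [AddCommGroup C]
    [Module R A] [Module R B] [Module R C] (p : A →ₗ[R] B) (q : A →ₗ[R] C)
    (hp : Function.Surjective p) (hq : Function.Surjective q) (h : ∀ a, q a = 0 ↔ p a = 0) (a : A) :
    equivOfSurj p q hp hq h (p a) = q a := by
  unfold equivOfSurj
  have : (p.quotKerEquivOfSurjective hp).symm (p a) = Submodule.Quotient.mk a := by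
    rw [LinearEquiv.symm_apply_eq]; rfl
  rw [LinearEquiv.trans_apply, this]; rfl

/-- old Ext -/
noncomputable abbrev oExt (n : ℕ) (X Y : CC R) : Type := (((_root_.Ext R (CC R) n).obj (op X)).obj Y)

noncomputable def oIso (n : ℕ) : ((KP P Y).homology n).unop ≃ₗ[R] oExt n X Y :=
  ((P.isoLeftDerivedObj (FY Y) n).unop).toLinearEquiv

noncomputable def theta (n : ℕ) (X Y : CC R) : oExt n X Y ≃ₗ[R] Abelian.Ext X Y n :=
  (oIso (projectiveResolution X) n).symm.trans
    (equivOfSurj (pZ _ n) (qZ (projectiveResolution X) n) (pZ_surj _ _) (qZ_surj _ _) (qZ_ker _ n))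

lemma theta_apply (n : ℕ) (X Y : CC R) (z) :
    theta n X Y (oIso (projectiveResolution X) n (pZ _ n z)) = qZ (projectiveResolution X) n z := by
  unfold theta
  rw [LinearEquiv.trans_apply, LinearEquiv.symm_apply_apply, equivOfSurj_apply]

noncomputable def oMap (n : ℕ) {X X' : CC R} (Y : CC R) (f : X ⟶ X') : oExt n X' Y →ₗ[R] oExt n X Y :=
  (((_root_.Ext R (CC R) n).map f.op).app Y).hom

lemma theta_nat (n : ℕ) {X X' Y : CC R} (f : X ⟶ X') (a : oExt n X' Y) :
    theta n X Y (oMap n Y f a) = (Abelian.Ext.mk₀ f).comp (theta n X' Y a) (zero_add n) := by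
  obtain ⟨b, rfl⟩ := (oIso (projectiveResolution X') n).surjective a
  obtain ⟨z, rfl⟩ := pZ_surj _ _ b
  let φ : ProjectiveResolution.Hom (projectiveResolution X) (projectiveResolution X') f := ⟨ProjectiveResolution.lift f (projectiveResolution X) (projectiveResolution X'), by
    have := ProjectiveResolution.lift_commutes_zero f (projectiveResolution X) (projectiveResolution X')
    exact this⟩
  rw [theta_apply]
  have h1 := ProjectiveResolution.isoLeftDerivedObj_hom_naturality f (projectiveResolution X) (projectiveResolution X') φ.hom 
    (ProjectiveResolution.lift_commutes_zero f (projectiveResolution X) (projectiveResolution X')) (FY Y) n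
  have h2 := congrArg (fun t => t.unop.hom (pZ _ n z)) h1
  have h3 : oMap n Y f (oIso (projectiveResolution X') n (pZ _ n z)) = oIso (projectiveResolution X) n ((HomologicalComplex.homologyMap
    (((FY Y).mapHomologicalComplex _).map φ.hom) n).unop.hom (pZ _ n z)) := h2
  rw [h3, ← pZ_nat, theta_apply]
  refine Eq.trans ?_ (ProjectiveResolution.mk₀_comp_extMk _ _ rfl (coc_d _ n z) φ).symm
  refine extMk_congr _ _ _ _ (coc_d _ n _) _ ?_
  exact iZ_nat (((FY Y).mapHomologicalComplex _).map φ.hom) n z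

end OldNew

section LC
open CategoryTheory Limits Opposite
variable {R : Type} [CommRing R]

abbrev Qm (J : Ideal R) : CC R := ModuleCat.of R (R ⧸ J)
def pr {J J' : Ideal R} (h : J ≤ J') : Qm J ⟶ Qm J' :=
  ModuleCat.ofHom (Submodule.mapQ _ _ LinearMap.id h)

noncomputable abbrev LH (J : Ideal R) (i : ℕ) (Y : CC R) : CC R := (localCohomology J i).obj Y

noncomputable abbrev LD (J : Ideal R) (i : ℕ) :=
  localCohomology.diagram (localCohomology.idealPowersDiagram J) i

noncomputable def lcocone (J : Ideal R) (i : ℕ) (Y : CC R) :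
    Cocone (LD J i ⋙ (evaluation _ _).obj Y) :=
  ((evaluation _ _).obj Y).mapCocone (colimit.cocone (LD J i))

noncomputable def lcolim (J : Ideal R) (i : ℕ) (Y : CC R) : IsColimit (lcocone J i Y) :=
  isColimitOfPreserves ((evaluation _ _).obj Y) (colimit.isColimit (LD J i))

noncomputable def iota0 (J : Ideal R) (i : ℕ) (Y : CC R) (t : ℕ) :
    oExt i (Qm (J^t)) Y →ₗ[R] LH J i Y :=
  ((lcocone J i Y).ι.app (op (op t))).hom

noncomputable def iota (J : Ideal R) (i : ℕ) (Y : CC R) (t : ℕ) :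
    Abelian.Ext (Qm (J^t)) Y i →ₗ[R] LH J i Y :=
  iota0 J i Y t ∘ₗ (theta i _ Y).symm.toLinearMap

lemma iota_theta (J : Ideal R) (i : ℕ) (Y : CC R) (t : ℕ) (c) :
    iota J i Y t (theta i _ Y c) = iota0 J i Y t c := by
  simp [iota]

lemma iota_surj (J : Ideal R) (i : ℕ) (Y : CC R) (a : LH J i Y) :
    ∃ t c, iota J i Y t c = a := by
  obtain ⟨j, y, hy⟩ := Concrete.isColimit_exists_rep _ (lcolim J i Y) a
  exact ⟨j.unop.unop, theta i _ Y y, (iota_theta J i Y _ y).trans hy⟩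

lemma diag_map (J : Ideal R) (i : ℕ) (Y : CC R) {t t' : ℕ} (h : t ≤ t')
   (f : op (op t) ⟶ op (op t')) (c : oExt i (Qm (J^t)) Y) :
   ((LD J i ⋙ (evaluation _ _).obj Y).map f).hom c = oMap i Y (pr (Ideal.pow_le_pow_right h)) c := rfl

lemma iota_compat (J : Ideal R) (i : ℕ) (Y : CC R) {t t' : ℕ} (h : t ≤ t')
    (c : Abelian.Ext (Qm (J^t)) Y i) :
    iota J i Y t' ((Abelian.Ext.mk₀ (pr (Ideal.pow_le_pow_right h))).comp c (zero_add i)) =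
      iota J i Y t c := by
  obtain ⟨c, rfl⟩ := (theta i _ Y).surjective c
  rw [← theta_nat]
  unfold iota
  simp only [LinearMap.comp_apply, LinearEquiv.coe_coe, LinearEquiv.symm_apply_apply]
  rw [← diag_map J i Y h (homOfLE h).op.op]
  have := (lcocone J i Y).w (homOfLE h).op.op
  exact congrArg (fun t => t.hom c) this

lemma iota_zero (J : Ideal R) (i : ℕ) (Y : CC R) (t : ℕ)
    (c : Abelian.Ext (Qm (J^t)) Y i) (hc : iota J i Y t c = 0) :
    ∃ t', ∃ h : t ≤ t', 
      (Abelian.Ext.mk₀ (pr (Ideal.pow_le_pow_right h))).comp c (zero_add i) = 0 := by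
  obtain ⟨c, rfl⟩ := (theta i _ Y).surjective c
  unfold iota at hc
  simp only [LinearMap.comp_apply, LinearEquiv.coe_coe, LinearEquiv.symm_apply_apply] at hc
  obtain ⟨j, f, g, hfg⟩ := Concrete.isColimit_exists_of_rep_eq _ (lcolim J i Y)
     (i := op (op t)) (j := op (op t)) c (0 : oExt i (Qm (J^t)) Y) (hc.trans (map_zero (iota0 J i Y t)).symm)
  have h : t ≤ j.unop.unop := leOfHom f.unop.unop
  refine ⟨j.unop.unop, h, ?_⟩
  rw [← theta_nat, ← diag_map J i Y h f]
  have h2 : ((LD J i ⋙ (evaluation _ _).obj Y).map f).hom c = 0 := by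
    refine hfg.trans (map_zero ((LD J i ⋙ (evaluation _ _).obj Y).map g).hom)
  rw [h2]; exact map_zero _

end LC

section Kos
open CategoryTheory Limits Opposite Abelian
variable {R : Type} [CommRing R]

def mq (a b : Ideal R) (c : R) (h : ∀ r ∈ a, c * r ∈ b) : Qm a ⟶ Qm b :=
  ModuleCat.ofHom (Submodule.mapQ a b (LinearMap.lsmul R R c) h)

lemma mq_mk (a b : Ideal R) (c : R) (h : ∀ r ∈ a, c * r ∈ b) (r : R) :
    (mq a b c h).hom (Ideal.Quotient.mk a r) = Ideal.Quotient.mk b (c * r) := rfl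

lemma pr_eq {a b : Ideal R} (h : a ≤ b) : pr h = mq a b 1 (fun r hr => by simpa using h hr) := by
  unfold pr mq
  congr 2
  ext; simp

lemma hom_ext_Q {a : Ideal R} {M : CC R} {f g : Qm a ⟶ M}
    (h : f.hom (Ideal.Quotient.mk a 1) = g.hom (Ideal.Quotient.mk a 1)) : f = g := by
  ext1
  apply Submodule.linearMap_qext
  apply LinearMap.ext_ring
  exact h

lemma mq_comp (a b d : Ideal R) (c c' : R) (h h') (h'' : ∀ r ∈ a, (c * c') * r ∈ d) :
    mq a b c h ≫ mq b d c' h' = mq a d (c * c') h'' := by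
  apply hom_ext_Q
  rw [ModuleCat.hom_comp, LinearMap.comp_apply, mq_mk, mq_mk, mq_mk]
  congr 1; ring

lemma mq_self (a : Ideal R) (c : R) (h : ∀ r ∈ a, c * r ∈ a) : mq a a c h = c • 𝟙 (Qm a) := by
  apply hom_ext_Q
  rw [mq_mk, ModuleCat.hom_smul, LinearMap.smul_apply]
  simp [Algebra.smul_def]

def SQ (a : Ideal R) (y : R) : ShortComplex (CC R) :=
  ShortComplex.mk (mq a a y (fun r hr => a.mul_mem_left _ hr))
    (mq a (a ⊔ Ideal.span {y}) 1 (fun r hr => by simpa using (le_sup_left : a ≤ a ⊔ Ideal.span {y}) hr)) (by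
      apply hom_ext_Q
      rw [ModuleCat.hom_comp, LinearMap.comp_apply, mq_mk, mq_mk]
      refine Ideal.Quotient.eq_zero_iff_mem.2 ?_
      simpa using (le_sup_right : _ ≤ a ⊔ Ideal.span {y}) (Ideal.mem_span_singleton_self y))

lemma SQ_exact (a : Ideal R) (y : R) (hy : ∀ r, y * r ∈ a → r ∈ a) : (SQ a y).ShortExact := by
  refine ModuleCat.shortComplex_shortExact _ ?_ ?_ ?_
  · intro q
    obtain ⟨r, rfl⟩ := Ideal.Quotient.mk_surjective q
    constructor
    · intro h
      have h' : Ideal.Quotient.mk (a ⊔ Ideal.span {y}) (1 * r) = 0 := h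
      rw [Ideal.Quotient.eq_zero_iff_mem, one_mul, Submodule.mem_sup] at h'
      obtain ⟨s, hs, t, ht, rfl⟩ := h'
      obtain ⟨u, rfl⟩ := Ideal.mem_span_singleton'.1 ht
      refine ⟨Ideal.Quotient.mk a u, ?_⟩
      refine (mq_mk a a y _ u).trans ?_
      rw [Ideal.Quotient.eq]
      have : y * u - (s + u * y) = -s := by ring
      rw [this]; exact a.neg_mem hs
    · rintro ⟨q', hq'⟩
      rw [← hq']
      exact congrArg (fun t => t.hom q') (SQ a y).zero
  · refine (injective_iff_map_eq_zero (SQ a y).f.hom).2 ?_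
    intro q hq
    obtain ⟨r, rfl⟩ := Ideal.Quotient.mk_surjective q
    have h' : Ideal.Quotient.mk a (y * r) = 0 := hq
    rw [Ideal.Quotient.eq_zero_iff_mem] at h'
    exact Ideal.Quotient.eq_zero_iff_mem.2 (hy r h')
  · intro q
    obtain ⟨r, rfl⟩ := Ideal.Quotient.mk_surjective q
    exact ⟨Ideal.Quotient.mk a r, (mq_mk a _ 1 _ r).trans (by rw [one_mul])⟩

noncomputable def del (a : Ideal R) (y : R) (hy : ∀ r, y * r ∈ a → r ∈ a) :
    Ext (Qm (a ⊔ Ideal.span {y})) (Qm a) 1 := (SQ_exact a y hy).extClass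

lemma smul_mk0 (a : Ideal R) (y : R) : (Ext.mk₀ (SQ a y).f) = y • (Ext.mk₀ (𝟙 (Qm a))) := by
  rw [← Ext.mk₀_smul]
  exact congrArg Ext.mk₀ (mq_self a y (fun r hr => a.mul_mem_left _ hr))

lemma SQ_f_comp (a : Ideal R) (y : R) (W : CC R) (j) (c : Ext (Qm a) W j) :
    (Ext.mk₀ (SQ a y).f).comp c (zero_add j) = y • c := by
  have h1 : (y • (Ext.mk₀ (𝟙 (Qm a)))).comp c (zero_add j) = y • c := by
    rw [Ext.smul_comp, Ext.mk₀_id_comp]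
  exact (congrArg (fun t : Ext (Qm a) (Qm a) 0 => t.comp c (zero_add j)) (smul_mk0 a y)).trans h1

lemma comp_SQ_f (a : Ideal R) (y : R) (M : CC R) (j) (c : Ext M (Qm a) j) :
    c.comp (Ext.mk₀ (SQ a y).f) (add_zero j) = y • c := by
  have h1 : c.comp (y • (Ext.mk₀ (𝟙 (Qm a)))) (add_zero j) = y • c := by
    rw [Ext.comp_smul, Ext.comp_mk₀_id]
  exact (congrArg (fun t : Ext (Qm a) (Qm a) 0 => c.comp t (add_zero j)) (smul_mk0 a y)).trans h1

section
variable (a : Ideal R) (y : R) (hy : ∀ r, y * r ∈ a → r ∈ a)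

lemma contra3 (W : CC R) {n₀ n₁ : ℕ} (hn : 1 + n₀ = n₁) (h0 : ∀ c : Ext (Qm a) W n₁, c = 0)
    (c : Ext (Qm (a ⊔ Ideal.span {y})) W n₁) : ∃ c' : Ext (Qm a) W n₀, (del a y hy).comp c' hn = c :=
  Ext.contravariant_sequence_exact₃ (SQ_exact a y hy) W c (h0 _) hn

lemma contra1 (W : CC R) {n₀ n₁ : ℕ} (hn : 1 + n₀ = n₁)
    (c : Ext (Qm a) W n₀) (hc : (del a y hy).comp c hn = 0) :
    ∃ c' : Ext (Qm a) W n₀, y • c' = c := by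
  obtain ⟨c', hc'⟩ := Ext.contravariant_sequence_exact₁ (SQ_exact a y hy) W c hn hc
  exact ⟨c', (SQ_f_comp a y W _ c').symm.trans hc'⟩

lemma contra0 (W : CC R) {n₀ n₁ : ℕ} (hn : 1 + n₀ = n₁)
    (c : Ext (Qm a) W n₀) : (del a y hy).comp (y • c) hn = 0 := by
  have h1 := (SQ_exact a y hy).extClass_comp_assoc c (h := hn)
  exact (congrArg (fun t : Ext (Qm a) W n₀ => (del a y hy).comp t hn) (SQ_f_comp a y W n₀ c)).symm.trans h1

lemma cov1 (M : CC R) {n₀ n₁ : ℕ} (hn : n₀ + 1 = n₁) (c : Ext M (Qm a) n₁) (hc : y • c = 0) :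
    ∃ c' : Ext M (Qm (a ⊔ Ideal.span {y})) n₀, c'.comp (del a y hy) hn = c :=
  Ext.covariant_sequence_exact₁ M (SQ_exact a y hy) c ((comp_SQ_f a y M _ c).trans hc) hn

lemma cov3 (M : CC R) {n₀ n₁ : ℕ} (hn : n₀ + 1 = n₁) (h0 : ∀ c : Ext M (Qm a) n₀, c = 0)
    (c : Ext M (Qm (a ⊔ Ideal.span {y})) n₀) (hc : c.comp (del a y hy) hn = 0) : c = 0 := by
  obtain ⟨c', hc'⟩ := Ext.covariant_sequence_exact₃ M (SQ_exact a y hy) c hn hc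
  rw [← hc', show c' = 0 from h0 c']
  exact Ext.zero_comp ..

include hy in
lemma cov0 (M : CC R) (c : Ext M (Qm a) 0) (hc : y • c = 0) : c = 0 := by
  have := (SQ_exact a y hy).mono_f
  refine Ext.postcomp_mk₀_injective_of_mono M (SQ a y).f (a₁ := c) (a₂ := 0) ?_
  rw [map_zero]
  exact (comp_SQ_f a y M _ c).trans hc

end

def AI (y : ℕ → R) : ℕ → Ideal R
  | 0 => ⊥
  | j + 1 => AI y j ⊔ Ideal.span {y j}

def Reg (y : ℕ → R) : Prop := ∀ j r, y j * r ∈ AI y j → r ∈ AI y j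

abbrev RR (R : Type) [CommRing R] : CC R := ModuleCat.of R R

def iso0 (R : Type) [CommRing R] : Qm (⊥ : Ideal R) ≅ RR R :=
  (Submodule.quotEquivOfEqBot (⊥ : Ideal R) rfl).toModuleIso

def iso0' (y : ℕ → R) : Qm (AI y 0) ≅ RR R := iso0 R

noncomputable def delA (y : ℕ → R) (hy : Reg y) (j : ℕ) : Ext (Qm (AI y (j+1))) (Qm (AI y j)) 1 :=
  del (AI y j) (y j) (hy j)

noncomputable def eps (y : ℕ → R) (hy : Reg y) : (j : ℕ) → Ext (Qm (AI y j)) (RR R) j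
  | 0 => Ext.mk₀ (iso0' y).hom
  | j + 1 => (delA y hy j).comp (eps y hy j) (add_comm 1 j)

lemma eps_succ (y : ℕ → R) (hy : Reg y) (j : ℕ) : eps y hy (j+1) = 
  (delA y hy j).comp (eps y hy j) (add_comm 1 j) := rfl

def toW (W : CC R) (w : W) : RR R ⟶ W := ModuleCat.ofHom (LinearMap.toSpanSingleton R W w)

lemma toW_surj {W : CC R} (f : RR R ⟶ W) : ∃ w, f = toW W w := 
  ⟨f.hom (1:R), by ext1; apply LinearMap.ext_ring; simp [toW]⟩

/-- w ↦ ε_j · w -/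
noncomputable def ew (y : ℕ → R) (hy : Reg y) (W : CC R) (j : ℕ) : W →ₗ[R] Ext (Qm (AI y j)) W j where
  toFun w := (eps y hy j).comp (Ext.mk₀ (toW W w)) (add_zero j)
  map_add' a b := by
    have : toW W (a + b) = toW W a + toW W b := by
      ext1; apply LinearMap.ext_ring; simp [toW]
    rw [this, Ext.mk₀_add, Ext.comp_add]
  map_smul' r a := by
    have : toW W (r • a) = r • toW W a := by
      ext1; apply LinearMap.ext_ring; simp [toW]
    rw [this, Ext.mk₀_smul, Ext.comp_smul]; rfl

lemma ew_succ (y : ℕ → R) (hy : Reg y) (W : CC R) (j : ℕ) (w : W) : ew y hy W (j+1) w = 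
    (delA y hy j).comp (ew y hy W j w) (add_comm 1 j) := by
  change (eps y hy (j+1)).comp (Ext.mk₀ (toW W w)) (add_zero _) = _
  rw [eps_succ]
  exact Ext.comp_assoc_of_third_deg_zero ..

section
variable (y : ℕ → R) (hy : Reg y) (j : ℕ)

lemma contra3A (W : CC R) {n₀ n₁ : ℕ} (hn : 1 + n₀ = n₁) (h0 : ∀ c : Ext (Qm (AI y j)) W n₁, c = 0)
    (c : Ext (Qm (AI y (j+1))) W n₁) : ∃ c' : Ext (Qm (AI y j)) W n₀, (delA y hy j).comp c' hn = c :=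
  contra3 _ _ (hy j) W hn h0 c

lemma contra1A (W : CC R) {n₀ n₁ : ℕ} (hn : 1 + n₀ = n₁)
    (c : Ext (Qm (AI y j)) W n₀) (hc : (delA y hy j).comp c hn = 0) :
    ∃ c' : Ext (Qm (AI y j)) W n₀, y j • c' = c := contra1 _ _ (hy j) W hn c hc

lemma contra0A (W : CC R) {n₀ n₁ : ℕ} (hn : 1 + n₀ = n₁)
    (c : Ext (Qm (AI y j)) W n₀) : (delA y hy j).comp (y j • c) hn = 0 := contra0 _ _ (hy j) W hn c

lemma cov1A (M : CC R) {n₀ n₁ : ℕ} (hn : n₀ + 1 = n₁) (c : Ext M (Qm (AI y j)) n₁) (hc : y j • c = 0) :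
    ∃ c' : Ext M (Qm (AI y (j+1))) n₀, c'.comp (delA y hy j) hn = c := cov1 _ _ (hy j) M hn c hc

lemma cov3A (M : CC R) {n₀ n₁ : ℕ} (hn : n₀ + 1 = n₁) (h0 : ∀ c : Ext M (Qm (AI y j)) n₀, c = 0)
    (c : Ext M (Qm (AI y (j+1))) n₀) (hc : c.comp (delA y hy j) hn = 0) : c = 0 :=
  cov3 _ _ (hy j) M hn h0 c hc

end

lemma lemma1 (y : ℕ → R) (hy : Reg y) (W : CC R) (j : ℕ) :
    (∀ i, j < i → ∀ c : Ext (Qm (AI y j)) W i, c = 0) ∧ Function.Surjective (ew y hy W j) ∧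
    ∀ w, ew y hy W j w = 0 ↔ w ∈ AI y j • (⊤ : Submodule R W) := by
  induction j with
  | zero =>
    have : Projective (RR R) := inferInstance
    have : Projective (Qm (AI y 0)) := Projective.of_iso (iso0' y).symm ‹_›
    refine ⟨fun i hi c => ?_, ?_, ?_⟩
    · obtain ⟨k, rfl⟩ := Nat.exists_eq_succ_of_ne_zero hi.ne'
      exact Ext.eq_zero_of_projective c
    · intro c
      obtain ⟨f, rfl⟩ := (Ext.mk₀_bijective _ _).2 c
      obtain ⟨w, hw⟩ := toW_surj ((iso0' y).inv ≫ f)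
      refine ⟨w, ?_⟩
      change (Ext.mk₀ (iso0' y).hom).comp (Ext.mk₀ (toW W w)) (add_zero 0) = _
      rw [Ext.mk₀_comp_mk₀, ← hw, Iso.hom_inv_id_assoc]
    · intro w
      change (Ext.mk₀ (iso0' y).hom).comp (Ext.mk₀ (toW W w)) (add_zero 0) = _ ↔ w ∈ (⊥ : Ideal R) • _
      rw [Ext.mk₀_comp_mk₀, Ext.mk₀_eq_zero_iff, Submodule.bot_smul, Submodule.mem_bot]
      constructor
      · intro h
        have h2 : toW W w = 0 := by
          rw [← cancel_epi (iso0' y).hom, h, comp_zero]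
        have := congrArg (fun t => t.hom (1:R)) h2
        simpa [toW] using this
      · rintro rfl
        have : toW W 0 = 0 := by ext1; apply LinearMap.ext_ring; simp [toW]
        rw [this, comp_zero]
  | succ j ih =>
    obtain ⟨i1, i2, i3⟩ := ih
    refine ⟨fun i hi c => ?_, ?_, ?_⟩
    · obtain ⟨k, rfl⟩ := Nat.exists_eq_add_of_lt hi
      obtain ⟨c', rfl⟩ := contra3A y hy j W (n₀ := j + k + 1) (by omega) 
        (i1 _ (by omega)) c
      rw [i1 _ (by omega) c', Ext.comp_zero]
    · intro c
      obtain ⟨c', rfl⟩ := contra3A y hy j W (n₀ := j) (add_comm _ _) 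
        (i1 _ (by omega)) c
      obtain ⟨w, rfl⟩ := i2 c'
      exact ⟨w, ew_succ y hy W j w⟩
    · intro w
      have key : ∀ w', ew y hy W (j+1) (y j • w') = 0 := by
        intro w'
        rw [ew_succ, map_smul, contra0A]
      have e1 : AI y (j+1) • (⊤ : Submodule R W) = AI y j • ⊤ ⊔ Ideal.span {y j} • ⊤ :=
        Submodule.sup_smul _ _ _
      rw [e1, Submodule.mem_sup]
      constructor
      · intro h
        rw [ew_succ] at h
        obtain ⟨c, hc'⟩ := contra1A _ _ _ _ _ _ h
        obtain ⟨w', rfl⟩ := i2 c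
        rw [← map_smul, ← sub_eq_zero, ← map_sub, i3] at hc'
        refine ⟨w - y j • w', ?_, y j • w', ?_, by abel⟩
        · rw [← neg_sub]; exact neg_mem hc'
        · exact Submodule.smul_mem_smul (Ideal.mem_span_singleton_self _) trivial
      · rintro ⟨u, hu, v, hv, rfl⟩
        rw [Submodule.ideal_span_singleton_smul] at hv
        obtain ⟨w', -, rfl⟩ := hv
        rw [map_add, ew_succ, (i3 u).2 hu, Ext.comp_zero, zero_add]
        exact key w'

lemma smul_ext_zero {M N : CC R} {r : R} (hM : ∀ m : M, r • m = 0) {i : ℕ} (c : Ext M N i) :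
    r • c = 0 := by
  have h1 : r • 𝟙 M = 0 := by ext m; exact hM m
  have h2 : (r • Ext.mk₀ (𝟙 M)).comp c (zero_add i) = 0 := by
    rw [← Ext.mk₀_smul, h1, Ext.mk₀_zero, Ext.zero_comp]
  rw [Ext.smul_comp, Ext.mk₀_id_comp] at h2
  exact h2

section
variable (y : ℕ → R) (hy : Reg y) (h : ℕ) {M : CC R} (hM : ∀ j < h, ∀ m : M, y j • m = 0)
include hy hM

lemma ext_van (i : ℕ) : ∀ j, i + j < h → ∀ c : Ext M (Qm (AI y j)) i, c = 0 := by
  induction i with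
  | zero => 
    intro j hj c
    exact cov0 _ _ (hy j) M c (smul_ext_zero (hM j (by omega)) c)
  | succ i ih =>
    intro j hj c
    obtain ⟨c', rfl⟩ := cov1A y hy j M rfl c (smul_ext_zero (hM j (by omega)) c)
    rw [ih (j+1) (by omega) c', Ext.zero_comp]

lemma lemma2_aux (j : ℕ) : ∀ i, (hij : i + j = h) → Function.Bijective
    (fun c : Ext M (Qm (AI y j)) i => c.comp (eps y hy j) hij) := by
  induction j with
  | zero =>
    intro i hi
    obtain rfl : i = h := hi
    refine Function.bijective_iff_has_inverse.2
      ⟨fun c => c.comp (Ext.mk₀ (iso0' y).inv) (add_zero i), ?_, ?_⟩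
    · intro c
      change (c.comp (Ext.mk₀ (iso0' y).hom) _).comp _ _ = c
      rw [Ext.comp_assoc_of_third_deg_zero, Ext.mk₀_comp_mk₀, Iso.hom_inv_id, Ext.comp_mk₀_id]
    · intro c
      change (c.comp _ _).comp (Ext.mk₀ (iso0' y).hom) _ = c
      rw [Ext.comp_assoc_of_third_deg_zero, Ext.mk₀_comp_mk₀, Iso.inv_hom_id, Ext.comp_mk₀_id]
  | succ j ih =>
    intro i hij
    have hh := ih (i+1) (by omega)
    have heq : ∀ c : Ext M (Qm (AI y (j+1))) i, c.comp (eps y hy (j+1)) hij =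
        (c.comp (delA y hy j) rfl).comp (eps y hy j) (by omega) := by
      intro c
      rw [eps_succ]
      exact (Ext.comp_assoc _ _ _ _ _ (by omega)).symm
    constructor
    · intro c c' hc
      rw [← sub_eq_zero]
      apply cov3A y hy j M rfl (ext_van y hy h hM i j (by omega))
      simp only [heq] at hc
      have := hh.1 hc
      rw [sub_eq_add_neg, Ext.add_comp, Ext.neg_comp]; exact (sub_eq_add_neg _ _).symm.trans (sub_eq_zero.2 this)
    · intro c
      obtain ⟨c1, rfl⟩ := hh.2 c
      obtain ⟨c', rfl⟩ := cov1A y hy j M rfl c1 (smul_ext_zero (hM j (by omega)) c1)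
      exact ⟨c', heq c'⟩

lemma lemma2 : Function.Bijective
    (fun f : M ⟶ Qm (AI y h) => (Ext.mk₀ f).comp (eps y hy h) (zero_add h)) :=
  (lemma2_aux y hy h hM h 0 (zero_add h)).comp (Ext.mk₀_bijective _ _)

end

lemma AI_mul (y z : ℕ → R) (j : ℕ) : ∀ r ∈ AI y j, (∏ i ∈ Finset.range j, z i) * r ∈ AI (fun i => z i * y i) j := by
  induction j with
  | zero => intro r hr; have : r = 0 := hr; subst this; simp
  | succ j ih =>
    intro r hr
    obtain ⟨u, hu, v, hv, rfl⟩ := Submodule.mem_sup.1 hr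
    obtain ⟨t, rfl⟩ := Ideal.mem_span_singleton'.1 hv
    rw [Finset.prod_range_succ, mul_add]
    refine Ideal.add_mem _ ?_ ?_
    · refine (le_sup_left : AI (fun i => z i * y i) j ≤ AI (fun i => z i * y i) (j+1)) ?_
      rw [mul_right_comm]
      exact Ideal.mul_mem_right _ _ (ih u hu)
    · refine (le_sup_right : Ideal.span {z j * y j} ≤ AI (fun i => z i * y i) (j+1)) ?_
      exact Ideal.mem_span_singleton'.2 ⟨(∏ i ∈ Finset.range j, z i) * t, by ring⟩

lemma eps_compat (y z y' : ℕ → R) (hyz : y' = fun i => z i * y i) (hy : Reg y) (hy' : Reg y') (j : ℕ)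
    (hm : ∀ r ∈ AI y j, (∏ i ∈ Finset.range j, z i) * r ∈ AI y' j) :
    (Ext.mk₀ (mq _ _ (∏ i ∈ Finset.range j, z i) hm)).comp (eps y' hy' j) (zero_add j) = eps y hy j := by
  induction j with
  | zero =>
    change (Ext.mk₀ _).comp (Ext.mk₀ (iso0' y').hom) _ = Ext.mk₀ (iso0' y).hom
    rw [Ext.mk₀_comp_mk₀]
    congr 1
    apply hom_ext_Q
    rw [ModuleCat.hom_comp, LinearMap.comp_apply]
    congr 1
    refine (mq_mk _ _ _ _ _).trans ?_
    rw [Finset.prod_range_zero, one_mul]; rfl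
  | succ j ih =>
    have hm' : ∀ r ∈ AI y j, (∏ i ∈ Finset.range j, z i) * r ∈ AI y' j := by
      subst hyz; exact AI_mul y z j
    have hm'' : ∀ r ∈ AI y j, (z j * ∏ i ∈ Finset.range j, z i) * r ∈ AI y' j := by
      intro r hr
      rw [mul_assoc]; exact Ideal.mul_mem_left _ _ (hm' r hr)
    rw [eps_succ, eps_succ, ← ih hm']
    let φ : SQ (AI y j) (y j) ⟶ SQ (AI y' j) (y' j) :=
      { τ₁ := mq _ _ _ hm'
        τ₂ := mq _ _ _ hm''
        τ₃ := mq _ _ _ hm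
        comm₁₂ := by
          apply hom_ext_Q
          change Ideal.Quotient.mk (AI y' j) _ = Ideal.Quotient.mk (AI y' j) _
          simp only [LinearMap.lsmul_apply, smul_eq_mul]
          congr 1; subst hyz; ring
        comm₂₃ := by
          apply hom_ext_Q
          change Ideal.Quotient.mk (AI y' (j+1)) _ = Ideal.Quotient.mk (AI y' (j+1)) _
          simp only [LinearMap.lsmul_apply, smul_eq_mul]
          congr 1; rw [Finset.prod_range_succ]; ring }
    have := ShortComplex.ShortExact.extClass_naturality (SQ_exact _ _ (hy j)) (SQ_exact _ _ (hy' j)) φ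
    have h2 : (Ext.mk₀ (mq _ _ _ hm)).comp (delA y' hy' j) (zero_add 1) = 
      (delA y hy j).comp (Ext.mk₀ (mq _ _ _ hm')) (add_zero 1) := this.symm
    have h3 := congrArg (fun t => t.comp (eps y' hy' j) (add_comm 1 j)) h2
    rw [Ext.comp_assoc _ _ _ _ (add_comm 1 j) (by omega),
      Ext.comp_assoc _ _ _ _ (zero_add j) (by omega)] at h3
    exact h3

end Kos

section Regpow
open RingTheory.Sequence
variable {R : Type} [CommRing R]

lemma wr_rot [IsNoetherianRing R] [IsLocalRing R] (n : ℕ) (hn : n ≠ 0) (l1 : List R) : ∀ l2 : List R,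
    (∀ r ∈ l1 ++ l2, r ∈ IsLocalRing.maximalIdeal R) →
    IsWeaklyRegular R (l1 ++ l2) → IsWeaklyRegular R (l2 ++ l1.map (· ^ n)) := by
  induction l1 with
  | nil => intro l2 _ h; simpa using h
  | cons a l1 ih =>
    intro l2 hm h
    have h1 : IsWeaklyRegular R ((l1 ++ l2) ++ [a]) := by
      refine IsLocalRing.isWeaklyRegular_of_perm_of_subset_maximalIdeal h ?_ hm
      rw [List.cons_append]
      exact (List.perm_append_singleton a (l1 ++ l2)).symm
    rw [isWeaklyRegular_append_iff, isWeaklyRegular_singleton_iff] at h1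
    have h2 : IsWeaklyRegular R ((l1 ++ l2) ++ [a ^ n]) := by
      rw [isWeaklyRegular_append_iff, isWeaklyRegular_singleton_iff]
      exact ⟨h1.1, h1.2.pow n⟩
    rw [List.append_assoc] at h2
    have := ih (l2 ++ [a ^ n]) (by
      intro r hr
      simp only [List.mem_append, List.mem_singleton] at hr
      rcases hr with hr | hr | rfl
      · exact hm r (by simp [hr])
      · exact hm r (by simp [hr])
      · exact Ideal.pow_mem_of_mem _ (hm a (by simp)) n (Nat.pos_of_ne_zero hn)) h2
    simpa using this

def px {h : ℕ} (x : Fin h → R) (n : ℕ) : ℕ → R := fun j => if hj : j < h then x ⟨j, hj⟩ ^ n else 1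

lemma AI_eq_ofList (y : ℕ → R) (j : ℕ) : AI y j = Ideal.ofList ((List.range j).map y) := by
  induction j with
  | zero => simp [AI]
  | succ j ih =>
    rw [List.range_succ, List.map_append, Ideal.ofList_append, List.map_singleton,
      Ideal.ofList_singleton, ← ih]; rfl

lemma ofFn_px {h : ℕ} (x : Fin h → R) (n : ℕ) :
    List.ofFn (fun i => x i ^ n) = (List.range h).map (px x n) := by
  apply List.ext_getElem
  · simp
  · intro i h1 h2
    simp at h1
    simp [px, h1]

lemma AI_px {h : ℕ} (x : Fin h → R) (n : ℕ) :
    AI (px x n) h = Ideal.span (Set.range fun i => x i ^ n) := by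
  rw [AI_eq_ofList, ← ofFn_px, Ideal.ofList]
  congr 1
  ext r
  simp [List.mem_ofFn]

lemma AI_px_gt {h : ℕ} (x : Fin h → R) (n : ℕ) (k : ℕ) (hk : h < k) :
    AI (px x n) k = ⊤ := by
  obtain ⟨k, rfl⟩ := Nat.exists_eq_add_of_lt hk
  rw [Ideal.eq_top_iff_one]
  refine (le_sup_right : _ ≤ AI (px x n) (h+k) ⊔ Ideal.span {px x n (h+k)}) ?_
  have : px x n (h+k) = 1 := by simp [px]
  rw [this]
  exact Ideal.mem_span_singleton_self 1

lemma mem_max [IsNoetherianRing R] [IsLocalRing R] {h : ℕ} (x : Fin h → R)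
    (hreg : IsRegular R (List.ofFn x)) (i : Fin h) : x i ∈ IsLocalRing.maximalIdeal R := by
  refine IsLocalRing.le_maximalIdeal (J := Ideal.ofList (List.ofFn x)) ?_ (Ideal.subset_span ?_)
  · intro h
    apply hreg.top_ne_smul
    rw [h, Submodule.top_smul]
  · simp [List.mem_ofFn]

lemma Reg_px [IsNoetherianRing R] [IsLocalRing R] {h : ℕ} (x : Fin h → R)
    (hreg : IsRegular R (List.ofFn x)) (n : ℕ) : Reg (px x n) := by
  intro j r hr
  by_cases hj : j < h
  swap
  · have : px x n j = 1 := by simp [px, hj]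
    simpa [this] using hr
  by_cases hn : n = 0
  · have : px x n j = 1 := by simp [px, hn]
    simpa [this] using hr
  have h1 := wr_rot n hn (List.ofFn x) [] (by
    intro r hr
    rw [List.append_nil, List.mem_ofFn] at hr
    obtain ⟨i, rfl⟩ := hr
    exact mem_max x hreg i) (by simpa using hreg.toIsWeaklyRegular)
  have h2 : [] ++ (List.ofFn x).map (· ^ n) = (List.range h).map (px x n) := by
    rw [← ofFn_px, List.nil_append, List.map_ofFn]; rfl
  rw [h2] at h1
  have h3 := h1.regular_mod_prev j (by simpa using hj)
  rw [← List.map_take, List.take_range, min_eq_left hj.le, ← AI_eq_ofList] at h3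
  have h4 := (isSMulRegular_quotient_iff_mem_of_smul_mem _ _).1 h3 r
  simpa using h4 (by simpa using hr)

end Regpow

section Astruct
open CategoryTheory Limits Opposite Abelian
variable {R : Type} [CommRing R]

lemma mq_surj {a b : Ideal R} (f : Qm a ⟶ Qm b) : ∃ r, ∃ h : ∀ s ∈ a, r * s ∈ b, f = mq a b r h := by
  obtain ⟨r, hr⟩ := Ideal.Quotient.mk_surjective (f.hom (Ideal.Quotient.mk a 1))
  have key : ∀ s, f.hom (Ideal.Quotient.mk a s) = Ideal.Quotient.mk b (r * s) := by
    intro s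
    have : Ideal.Quotient.mk a s = s • Ideal.Quotient.mk a 1 := by
      rw [Algebra.smul_def, map_one, mul_one]; rfl
    rw [this]
    refine (map_smul f.hom s _).trans ?_
    rw [← hr, Algebra.smul_def, mul_comm r, map_mul]; rfl
  refine ⟨r, fun s hs => ?_, ?_⟩
  · rw [← Ideal.Quotient.eq_zero_iff_mem, ← key, Ideal.Quotient.eq_zero_iff_mem.2 hs]
    exact map_zero f.hom
  · apply hom_ext_Q
    rw [key, mq_mk]

lemma mq_congr {a b : Ideal R} {c c' : R} (h h') (hc : c - c' ∈ b) : mq a b c h = mq a b c' h' := by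
  apply hom_ext_Q
  rw [mq_mk, mq_mk, mul_one, mul_one]
  exact Ideal.Quotient.eq.2 hc

lemma mem_of_mq {a b : Ideal R} {c c' : R} {h h'} (hc : mq a b c h = mq a b c' h') : c - c' ∈ b := by
  have := congrArg (fun t => t.hom (Ideal.Quotient.mk a 1)) hc
  have h1 : Ideal.Quotient.mk b (c * 1) = Ideal.Quotient.mk b (c' * 1) := this
  rw [mul_one, mul_one] at h1
  exact Ideal.Quotient.eq.1 h1

lemma mq_zero {a b : Ideal R} {c : R} (h) (hc : c ∈ b) : mq a b c h = 0 := by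
  apply hom_ext_Q
  rw [mq_mk, mul_one]
  exact Ideal.Quotient.eq_zero_iff_mem.2 hc

lemma mem_of_mq_zero {a b : Ideal R} {c : R} {h} (hc : mq a b c h = 0) : c ∈ b := by
  have := congrArg (fun t => t.hom (Ideal.Quotient.mk a 1)) hc
  have h1 : Ideal.Quotient.mk b (c * 1) = 0 := this
  rw [mul_one] at h1
  exact Ideal.Quotient.eq_zero_iff_mem.1 h1

lemma mq_add {a b : Ideal R} {c c' : R} (h h') (h'') : mq a b (c + c') h'' = mq a b c h + mq a b c' h' := by
  apply hom_ext_Q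
  rw [mq_mk, ModuleCat.hom_add, LinearMap.add_apply, mq_mk, mq_mk, add_mul, map_add]

lemma mq_smul {a b : Ideal R} {c c' : R} (h) (h'') : mq a b (c * c') h'' = c • mq a b c' h := by
  apply hom_ext_Q
  rw [mq_mk, ModuleCat.hom_smul, LinearMap.smul_apply, mq_mk, Algebra.smul_def, mul_assoc, map_mul]; rfl

lemma kill_Q {a : Ideal R} {c : R} (hc : c ∈ a) (m : Qm a) : c • m = 0 := by
  obtain ⟨r, rfl⟩ := Ideal.Quotient.mk_surjective m
  have : c • Ideal.Quotient.mk a r = Ideal.Quotient.mk a (c * r) := by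
    rw [Algebra.smul_def, map_mul]; rfl
  exact this.trans (Ideal.Quotient.eq_zero_iff_mem.2 (a.mul_mem_right _ hc))

variable {h : ℕ} (x : Fin h → R)

abbrev aa (l : ℕ) : Ideal R := AI (px x l) h

lemma aa_eq (l : ℕ) : aa x l = Ideal.span (Set.range fun i => x i ^ l) := AI_px x l

noncomputable def PP (k : ℕ) : R := ∏ i ∈ Finset.range h, px x k i

lemma px_add (k l : ℕ) : px x (k + l) = fun i => px x k i * px x l i := by
  funext i
  unfold px
  split_ifs
  · rw [pow_add]
  · rw [one_mul]

lemma PP_mem {l n : ℕ} (hln : l ≤ n) : ∀ r ∈ aa x l, PP x (n - l) * r ∈ aa x n := by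
  intro r hr
  have := AI_mul (px x l) (px x (n-l)) h r hr
  rwa [← px_add, Nat.sub_add_cancel hln] at this

lemma px_mem (l n : ℕ) (hln : l ≤ n) (i : ℕ) (hi : i < h) : px x n i ∈ aa x l := by
  have : px x n i = x ⟨i, hi⟩ ^ l * x ⟨i, hi⟩ ^ (n - l) := by
    rw [← pow_add, Nat.add_sub_cancel' hln]; simp [px, hi]
  rw [this, aa_eq]
  exact Ideal.mul_mem_right _ _ (Ideal.subset_span ⟨_, rfl⟩)

variable (hR : ∀ l, Reg (px x l))

noncomputable def el (l : ℕ) : Ext (Qm (aa x l)) (RR R) h := eps (px x l) (hR l) h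

lemma el_compat {l n : ℕ} (hln : l ≤ n) (hm) :
    (Ext.mk₀ (mq (aa x l) (aa x n) (PP x (n - l)) hm)).comp (el x hR n) (zero_add h) = el x hR l :=
  eps_compat (px x l) (px x (n-l)) (px x n) (by rw [← px_add, Nat.sub_add_cancel hln]) _ _ h hm

lemma el_compat' {l n : ℕ} (hln : l ≤ n) {b : Ideal R} (r : R) (hr) (hm) :
    (Ext.mk₀ (mq b (aa x n) (r * PP x (n - l)) hm)).comp (el x hR n) (zero_add h) =
      (Ext.mk₀ (mq b (aa x l) r hr)).comp (el x hR l) (zero_add h) := by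
  rw [← el_compat x hR hln (PP_mem x hln), Ext.mk₀_comp_mk₀_assoc, mq_comp]

lemma mul_PP_mem {l n : ℕ} (hln : l ≤ n) {b : Ideal R} {r : R} (hr : ∀ s ∈ b, r * s ∈ aa x l) :
   ∀ s ∈ b, (r * PP x (n-l)) * s ∈ aa x n := by
  intro s hs
  have := PP_mem x hln _ (hr s hs)
  rwa [← mul_assoc, mul_comm (PP x _) r] at this

include hR in
lemma PP_inj {l n : ℕ} (hln : l ≤ n) (r : R) (hr : r * PP x (n - l) ∈ aa x n) : r ∈ aa x l := by
  have hr' : ∀ s ∈ aa x l, r * s ∈ aa x l := fun s hs => Ideal.mul_mem_left _ _ hs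
  have h1 := el_compat' x hR hln (b := aa x l) r hr' (mul_PP_mem x hln hr')
  rw [mq_zero _ hr, Ext.mk₀_zero, Ext.zero_comp] at h1
  have h2 := (lemma2 (px x l) (hR l) h (M := Qm (aa x l))
    (fun j hj m => kill_Q (px_mem x l l le_rfl j hj) m)).1
  have h3 : mq (aa x l) (aa x l) r hr' = 0 := by
    apply h2
    refine h1.symm.trans ?_
    simp only [Ext.mk₀_zero, Ext.zero_comp]
  exact mem_of_mq_zero h3

variable (I : Ideal R)

noncomputable def gval (l s : ℕ) (r : R) (hs : ∀ a ∈ I ^ s, r * a ∈ aa x l) : LH I h (RR R) :=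
  iota I h (RR R) s ((Ext.mk₀ (mq (I ^ s) (aa x l) r hs)).comp (el x hR l) (zero_add h))

lemma gval_mono (l s s' : ℕ) (hss : s ≤ s') (r : R) (hs) (hs') :
    gval x hR I l s r hs = gval x hR I l s' r hs' := by
  unfold gval
  rw [← iota_compat I h (RR R) hss, Ext.mk₀_comp_mk₀_assoc, pr_eq, mq_comp (h'' := by
    simpa using hs')]
  congr! 4
  rw [one_mul]

lemma gval_indep (l s s' : ℕ) (r : R) (hs) (hs') :
    gval x hR I l s r hs = gval x hR I l s' r hs' := by
  have h1 : ∀ a ∈ I ^ (max s s'), r * a ∈ aa x l :=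
    fun a ha => hs a (Ideal.pow_le_pow_right (le_max_left s s') ha)
  rw [gval_mono x hR I l s _ (le_max_left s s') r hs h1, gval_mono x hR I l s' _ (le_max_right s s') r hs' h1]

def GG (l : ℕ) : Submodule R R where
  carrier := {r | ∃ s, ∀ a ∈ I ^ s, r * a ∈ aa x l}
  zero_mem' := ⟨0, fun a _ => by simp⟩
  add_mem' := by
    rintro r r' ⟨s, hs⟩ ⟨s', hs'⟩
    refine ⟨max s s', fun a ha => ?_⟩
    rw [add_mul]
    exact Ideal.add_mem _ (hs a (Ideal.pow_le_pow_right (le_max_left s s') ha))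
      (hs' a (Ideal.pow_le_pow_right (le_max_right s s') ha))
  smul_mem' := by
    rintro c r ⟨s, hs⟩
    exact ⟨s, fun a ha => by
      rw [smul_eq_mul, mul_assoc]; exact Ideal.mul_mem_left _ c (hs a ha)⟩

noncomputable def gfun (l : ℕ) (r : GG x I l) : LH I h (RR R) :=
  gval x hR I l r.2.choose r.1 r.2.choose_spec

lemma gfun_eq (l : ℕ) (r : GG x I l) (s) (hs) : gfun x hR I l r = gval x hR I l s r.1 hs :=
  gval_indep ..

noncomputable def gg (l : ℕ) : GG x I l →ₗ[R] LH I h (RR R) where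
  toFun := gfun x hR I l
  map_add' r r' := by
    obtain ⟨s, hs⟩ := r.2
    obtain ⟨s', hs'⟩ := r'.2
    have h1 : ∀ a ∈ I ^ (max s s'), r.1 * a ∈ aa x l :=
      fun a ha => hs a (Ideal.pow_le_pow_right (le_max_left s s') ha)
    have h2 : ∀ a ∈ I ^ (max s s'), r'.1 * a ∈ aa x l :=
      fun a ha => hs' a (Ideal.pow_le_pow_right (le_max_right s s') ha)
    have h3 : ∀ a ∈ I ^ (max s s'), (r + r').1 * a ∈ aa x l := fun a ha => by
      change (r.1 + r'.1) * a ∈ _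
      rw [add_mul]; exact Ideal.add_mem _ (h1 a ha) (h2 a ha)
    rw [gfun_eq x hR I l r _ h1, gfun_eq x hR I l r' _ h2, gfun_eq x hR I l (r + r') _ h3]
    unfold gval
    rw [← map_add, ← Ext.add_comp, ← Ext.mk₀_add]
    congr! 3
    exact mq_add _ _ h3
  map_smul' c r := by
    obtain ⟨s, hs⟩ := r.2
    have h3 : ∀ a ∈ I ^ s, (c • r).1 * a ∈ aa x l := fun a ha => by
      change (c * r.1) * a ∈ _
      rw [mul_assoc]; exact Ideal.mul_mem_left _ _ (hs a ha)
    rw [gfun_eq x hR I l r _ hs, gfun_eq x hR I l (c • r) _ h3]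
    unfold gval
    rw [RingHom.id_apply, ← map_smul, ← Ext.smul_comp, ← Ext.mk₀_smul]
    congr! 3
    exact mq_smul _ h3

lemma gg_eq (l : ℕ) (r : GG x I l) (s) (hs) : gg x hR I l r = gval x hR I l s r.1 hs :=
  gval_indep ..

lemma mul_PP_GG {l n : ℕ} (hln : l ≤ n) (r : R) (hr : r ∈ GG x I l) : r * PP x (n - l) ∈ GG x I n := by
  obtain ⟨s, hs⟩ := hr
  exact ⟨s, mul_PP_mem x hln hs⟩

lemma gg_PP {l n : ℕ} (hln : l ≤ n) (r : R) (hr : r ∈ GG x I l) (hr') :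
    gg x hR I n ⟨r * PP x (n-l), hr'⟩ = gg x hR I l ⟨r, hr⟩ := by
  obtain ⟨s, hs⟩ := id hr
  rw [gg_eq x hR I l _ s hs, gg_eq x hR I n _ s (mul_PP_mem x hln hs)]
  unfold gval
  rw [el_compat' x hR hln]

lemma gg_ker (l : ℕ) (r : GG x I l) (hxI : ∀ i, x i ∈ I) : gg x hR I l r = 0 ↔ r.1 ∈ aa x l := by
  obtain ⟨s, hs⟩ := r.2
  rw [gg_eq x hR I l _ s hs]
  unfold gval
  constructor
  · intro h0
    obtain ⟨t, hst, ht⟩ := iota_zero _ _ _ _ _ h0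
    have hs' : ∀ a ∈ I ^ t, r.1 * a ∈ aa x l := fun a ha => hs a (Ideal.pow_le_pow_right hst ha)
    rw [Ext.mk₀_comp_mk₀_assoc, pr_eq, mq_comp (h'' := by simpa using hs'),
      mq_congr (h' := hs') (hc := by simp)] at ht
    have hln := le_max_right t l
    rw [← el_compat' x hR hln _ hs' (mul_PP_mem x hln hs')] at ht
    have h2 := (lemma2 (px x (max t l)) (hR _) h (M := Qm (I ^ t))
      (fun j hj m => kill_Q (by
        have : px x (max t l) j = x ⟨j, hj⟩ ^ (max t l) := by simp [px, hj]
        rw [this]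
        exact Ideal.pow_le_pow_right (le_max_left t l) (Ideal.pow_mem_pow (hxI _) _)) m)).1
    have h3 : mq (I ^ t) (aa x (max t l)) _ (mul_PP_mem x hln hs') = 0 := by
      apply h2
      refine ht.trans ?_
      simp only [Ext.mk₀_zero, Ext.zero_comp]
    exact PP_inj x hR hln _ (mem_of_mq_zero h3)
  · intro h0
    rw [mq_zero _ h0, Ext.mk₀_zero, Ext.zero_comp, map_zero]

lemma gg_surj (hxI : ∀ i, x i ∈ I) (l : ℕ) (a : LH I h (RR R)) :
    ∃ n, l ≤ n ∧ ∃ r, gg x hR I n r = a := by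
  obtain ⟨t, c, rfl⟩ := iota_surj _ _ _ a
  obtain ⟨f, hf⟩ := (lemma2 (px x t) (hR _) h (M := Qm (I ^ t))
      (fun j hj m => kill_Q (by
        have : px x t j = x ⟨j, hj⟩ ^ t := by simp [px, hj]
        rw [this]
        exact Ideal.pow_mem_pow (hxI _) _) m)).2 c
  obtain ⟨r, hr, rfl⟩ := mq_surj f
  refine ⟨max l t, le_max_left _ _, ⟨_, mul_PP_GG x I (le_max_right l t) r ⟨t, hr⟩⟩, ?_⟩
  rw [gg_PP x hR I (le_max_right l t) r ⟨t, hr⟩, gg_eq x hR I t _ t hr, ← hf]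
  rfl

lemma gg_kill (hxI : ∀ i, x i ∈ I) (l : ℕ) (r : GG x I l) (c : R) (hc : c ∈ aa x l) : c • gg x hR I l r = 0 := by
  rw [← map_smul, gg_ker x hR I l _ hxI]
  exact Ideal.mul_mem_right _ _ hc

lemma gg_range (hxI : ∀ i, x i ∈ I) (l : ℕ) (a : LH I h (RR R)) (ha : ∀ i, x i ^ l • a = 0) :
    ∃ r, gg x hR I l r = a := by
  obtain ⟨n, hln, r, rfl⟩ := gg_surj x hR I hxI l a
  have h1 : ∀ i, r.1 * x i ^ l ∈ aa x n := by
    intro i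
    have := ha i
    rw [← map_smul, gg_ker x hR I n _ hxI] at this
    rw [mul_comm]; exact this
  have h2 : ∀ s ∈ aa x l, r.1 * s ∈ aa x n := by
    intro s hs
    rw [aa_eq] at hs
    refine Submodule.span_induction (p := fun s _ => r.1 * s ∈ aa x n) ?_ ?_ ?_ ?_ hs
    · rintro _ ⟨i, rfl⟩; exact h1 i
    · simp
    · intro a b _ _ ha hb; rw [mul_add]; exact Ideal.add_mem _ ha hb
    · intro a b _ hb; rw [smul_eq_mul, mul_left_comm]; exact Ideal.mul_mem_left _ _ hb
  obtain ⟨f, hf⟩ := (lemma2 (px x l) (hR l) h (M := Qm (aa x l))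
    (fun j hj m => kill_Q (px_mem x l l le_rfl j hj) m)).2 
    ((Ext.mk₀ (mq (aa x l) (aa x n) r.1 h2)).comp (el x hR n) (zero_add h))
  obtain ⟨v, hv, rfl⟩ := mq_surj f
  have hf' : (Ext.mk₀ (mq (aa x l) (aa x l) v hv)).comp (el x hR l) (zero_add h) =
    (Ext.mk₀ (mq (aa x l) (aa x n) r.1 h2)).comp (el x hR n) (zero_add h) := hf
  rw [← el_compat' x hR hln _ hv (mul_PP_mem x hln hv)] at hf'
  have h3 := mem_of_mq ((lemma2 (px x n) (hR n) h (M := Qm (aa x l))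
    (fun j hj m => kill_Q (px_mem x l n hln j hj) m)).1 hf')
  obtain ⟨s, hs⟩ := r.2
  have hvG : v ∈ GG x I l := by
    refine ⟨s, fun b hb => PP_inj x hR hln _ ?_⟩
    have h4 := Ideal.add_mem _ (Ideal.mul_mem_right b _ h3) (hs b hb)
    have : (v * PP x (n-l) - r.1) * b + r.1 * b = v * b * PP x (n-l) := by ring
    rwa [this] at h4
  refine ⟨⟨v, hvG⟩, ?_⟩
  have hG := mul_PP_GG x I hln v hvG
  rw [← gg_PP x hR I hln v hvG hG, ← sub_eq_zero, ← map_sub, gg_ker x hR I n _ hxI]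
  exact h3

end Astruct

section Bstruct
open CategoryTheory Limits Opposite Abelian
variable {R : Type} [CommRing R] {h : ℕ} (x : Fin h → R) (hR : ∀ l, Reg (px x l)) (W : CC R)

abbrev xR : Ideal R := Ideal.span (Set.range x)

lemma aa_le_pow (l n : ℕ) (hln : l ≤ n) : aa x n ≤ xR x ^ l := by
  rw [aa_eq, Ideal.span_le]
  rintro _ ⟨i, rfl⟩
  exact Ideal.pow_le_pow_right hln (Ideal.pow_mem_pow (Ideal.subset_span (Set.mem_range_self i)) _)

lemma exists_pow_le (l : ℕ) : ∃ k, l ≤ k ∧ xR x ^ k ≤ aa x l := by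
  have h1 : xR x ≤ (aa x l).radical := by
    rw [xR, Ideal.span_le]
    rintro _ ⟨i, rfl⟩
    have h2 : x i ^ l ∈ aa x l := by
      rw [aa_eq]
      exact Ideal.subset_span (Set.mem_range_self i)
    exact Ideal.mem_radical_of_pow_mem (Ideal.le_radical h2)
  obtain ⟨k, hk⟩ := Ideal.exists_pow_le_of_le_radical_of_fg h1 (Submodule.fg_span (Set.finite_range x))
  exact ⟨max l k, le_max_left _ _, (Ideal.pow_le_pow_right (le_max_right l k)).trans hk⟩

noncomputable def kk (l : ℕ) : ℕ := (exists_pow_le x l).choose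
lemma le_kk (l : ℕ) : l ≤ kk x l := (exists_pow_le x l).choose_spec.1
lemma kk_le (l : ℕ) : xR x ^ kk x l ≤ aa x l := (exists_pow_le x l).choose_spec.2

noncomputable def ewl (l : ℕ) : W →ₗ[R] Ext (Qm (aa x l)) W h := ew (px x l) (hR l) W h

lemma ewl_def (l : ℕ) (w : W) : ewl x hR W l w = (el x hR l).comp (Ext.mk₀ (toW W w)) (add_zero h) := rfl

lemma ewl_surj (l : ℕ) : Function.Surjective (ewl x hR W l) := (lemma1 (px x l) (hR l) W h).2.1

lemma ewl_zero (l : ℕ) (w : W) : ewl x hR W l w = 0 ↔ w ∈ aa x l • (⊤ : Submodule R W) :=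
  (lemma1 (px x l) (hR l) W h).2.2 w

lemma ewl_compat {l n : ℕ} (hln : l ≤ n) (hm) (w : W) :
    (Ext.mk₀ (mq (aa x l) (aa x n) (PP x (n - l)) hm)).comp (ewl x hR W n w) (zero_add h)
      = ewl x hR W l w := by
  rw [ewl_def, ewl_def, ← el_compat x hR hln hm, Ext.comp_assoc_of_third_deg_zero]

lemma pr_comp {a b c : Ideal R} (h1 : a ≤ b) (h2 : b ≤ c) : pr h1 ≫ pr h2 = pr (h1.trans h2) := by
  rw [pr_eq, pr_eq, pr_eq, mq_comp (h'' := fun r hr => by simpa using (h1.trans h2) hr)]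
  exact mq_congr _ _ (by simp)

lemma pr_mq {a b c : Ideal R} (h1 : a ≤ b) (r : R) (h2) (h3) : pr h1 ≫ mq b c r h2 = mq a c r h3 := by
  rw [pr_eq, mq_comp (h'' := by simpa using h3)]
  exact mq_congr _ _ (by simp)

noncomputable def kval (l k : ℕ) (hk : xR x ^ k ≤ aa x l) (w : W) : LH (xR x) h W :=
  iota (xR x) h W k ((Ext.mk₀ (pr hk)).comp (ewl x hR W l w) (zero_add h))

lemma kval_mono (l k k' : ℕ) (hkk : k ≤ k') (hk) (hk') (w : W) : 
    kval x hR W l k hk w = kval x hR W l k' hk' w := by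
  unfold kval
  rw [← iota_compat (xR x) h W hkk, Ext.mk₀_comp_mk₀_assoc, pr_comp]

lemma kval_indep (l k k' : ℕ) (hk) (hk') (w : W) : 
    kval x hR W l k hk w = kval x hR W l k' hk' w := by
  have hm : xR x ^ (max k k') ≤ aa x l := (Ideal.pow_le_pow_right (le_max_left k k')).trans hk
  rw [kval_mono x hR W l k _ (le_max_left k k') hk hm, kval_mono x hR W l k' _ (le_max_right k k') hk' hm]

noncomputable def kap (l : ℕ) : W →ₗ[R] LH (xR x) h W where
  toFun w := kval x hR W l (kk x l) (kk_le x l) w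
  map_add' w w' := by unfold kval; rw [map_add, Ext.comp_add, map_add]
  map_smul' c w := by unfold kval; rw [map_smul, Ext.comp_smul, map_smul]; rfl

lemma kap_eq (l k : ℕ) (hk) (w : W) : kap x hR W l w = kval x hR W l k hk w := kval_indep ..

lemma kap_surj (b : LH (xR x) h W) : ∃ l w, kap x hR W l w = b := by
  obtain ⟨k, c, rfl⟩ := iota_surj _ _ _ b
  obtain ⟨w, hw⟩ := ewl_surj x hR W k ((Ext.mk₀ (pr (aa_le_pow x k k le_rfl))).comp c (zero_add h))
  refine ⟨k, w, ?_⟩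
  change kval _ _ _ _ _ _ _ = _
  unfold kval
  rw [hw, ← iota_compat (xR x) h W (le_kk x k), Ext.mk₀_comp_mk₀_assoc, pr_comp]

lemma kap_compat {l n : ℕ} (hln : l ≤ n) (w : W) : kap x hR W n (PP x (n-l) • w) = kap x hR W l w := by
  set k := max (kk x l) (kk x n)
  have h1 : xR x ^ k ≤ aa x l := (Ideal.pow_le_pow_right (le_max_left _ _)).trans (kk_le x l)
  have h2 : xR x ^ k ≤ aa x n := (Ideal.pow_le_pow_right (le_max_right _ _)).trans (kk_le x n)
  rw [kap_eq x hR W l k h1, kap_eq x hR W n k h2]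
  unfold kval
  have h3 : ∀ r ∈ xR x ^ k, PP x (n-l) * r ∈ aa x n := fun r hr => Ideal.mul_mem_left _ _ (h2 hr)
  rw [← ewl_compat x hR W hln (PP_mem x hln), Ext.mk₀_comp_mk₀_assoc, pr_mq (h3 := h3),
    map_smul, Ext.comp_smul, ← Ext.smul_comp, ← Ext.mk₀_smul]
  congr! 3
  rw [pr_eq, ← mq_smul _ (by simpa using h3)]
  exact mq_congr _ _ (by simp)

lemma kap_kill (l : ℕ) (w : W) (hw : w ∈ aa x l • (⊤ : Submodule R W)) : kap x hR W l w = 0 := by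
  change kval _ _ _ _ _ _ _ = _
  unfold kval
  rw [(ewl_zero x hR W l w).2 hw, Ext.comp_zero, map_zero]

lemma kap_zero (l : ℕ) (w : W) (hw : kap x hR W l w = 0) :
    ∃ n, l ≤ n ∧ PP x (n-l) • w ∈ aa x n • (⊤ : Submodule R W) := by
  change kval _ _ _ _ _ _ _ = _ at hw
  unfold kval at hw
  obtain ⟨t, ht, hc⟩ := iota_zero _ _ _ _ _ hw
  have hln := le_max_right t l
  refine ⟨max t l, hln, ?_⟩
  rw [← ewl_zero x hR, map_smul]
  have h1 : aa x (max t l) ≤ xR x ^ t := aa_le_pow x _ _ (le_max_left _ _)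
  have h2 := congrArg (fun c => (Ext.mk₀ (pr h1)).comp c (zero_add h)) hc
  have h3 : ∀ r ∈ aa x (max t l), PP x (max t l - l) * r ∈ aa x (max t l) :=
    fun r hr => Ideal.mul_mem_left _ _ hr
  simp only [Ext.mk₀_comp_mk₀_assoc, pr_comp, Ext.comp_zero] at h2
  rw [← ewl_compat x hR W hln (PP_mem x hln), Ext.mk₀_comp_mk₀_assoc, pr_mq (h3 := h3), mq_self, 
    Ext.mk₀_smul, Ext.smul_comp, Ext.mk₀_id_comp] at h2
  exact h2

end Bstruct

section Concl
variable {R : Type} [CommRing R]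

lemma aa_anti {h : ℕ} (x : Fin h → R) {l n : ℕ} (hln : l ≤ n) : aa x n ≤ aa x l := by
  rw [aa_eq, Ideal.span_le]
  rintro _ ⟨i, rfl⟩
  have := px_mem x l n hln i i.2
  simpa [px] using this

lemma aa_le_GG {h : ℕ} (x : Fin h → R) (I : Ideal R) (l : ℕ) : aa x l ≤ GG x I l :=
  fun _ hr => ⟨0, fun _ _ => Ideal.mul_mem_right _ _ hr⟩

lemma GG_anti {h : ℕ} (x : Fin h → R) (I : Ideal R) {l n : ℕ} (hln : l ≤ n) : GG x I n ≤ GG x I l := by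
  rintro r ⟨s, hs⟩
  exact ⟨s, fun a ha => aa_anti x hln (hs a ha)⟩

variable [IsNoetherianRing R] [IsLocalRing R] [IsAdicComplete (IsLocalRing.maximalIdeal R) R]
    {E : Type} [AddCommGroup E] [Module R E] [Module.Injective R E]

lemma vanish {h : ℕ} (x : Fin h → R) (l : ℕ) {A : Type} [AddCommGroup A] [Module R A] (w : A →ₗ[R] E)
    (hw : ∀ a, (∀ i, x i ^ l • a = 0) → w a = 0) : w ∈ aa x l • (⊤ : Submodule R (A →ₗ[R] E)) := by
  obtain ⟨u, hu⟩ := inj_ext (R := R) (LinearMap.pi (fun i : Fin h => x i ^ l • (LinearMap.id : A →ₗ[R] A))) w (by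
    intro a ha
    exact hw a (fun i => congrFun ha i))
  have : w = ∑ i : Fin h, x i ^ l • (u ∘ₗ LinearMap.single R (fun _ : Fin h => A) i) := by
    ext a
    rw [← hu a, LinearMap.sum_apply]
    set v := LinearMap.pi (fun i : Fin h => x i ^ l • (LinearMap.id : A →ₗ[R] A)) a with hv
    have hs : v = ∑ i, LinearMap.single R (fun _ : Fin h => A) i (v i) :=
      (Finset.univ_sum_single v).symm
    conv_lhs => rw [hs, map_sum]
    refine Finset.sum_congr rfl fun i _ => ?_
    have hvi : v i = x i ^ l • a := rfl
    rw [hvi, map_smul, map_smul]; rfl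
  rw [this]
  refine Submodule.sum_mem _ fun i _ => Submodule.smul_mem_smul ?_ trivial
  rw [aa_eq]
  exact Ideal.subset_span (Set.mem_range_self i)

lemma concl
    (e : IsLocalRing.ResidueField R →ₗ[R] E) (he : Function.Injective e)
    (hess : ∀ N : Submodule R E, N ≠ ⊥ → N ⊓ LinearMap.range e ≠ ⊥)
    (I : Ideal R) (h : ℕ) (x : Fin h → R) (hxm : ∀ i, x i ∈ IsLocalRing.maximalIdeal R)
    {A B : Type} [AddCommGroup A] [Module R A] [AddCommGroup B] [Module R B]
    (g : ∀ l, GG x I l →ₗ[R] A)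
    (g_PP : ∀ l n (hln : l ≤ n) r (hr : r ∈ GG x I l) hr', g n ⟨r * PP x (n-l), hr'⟩ = g l ⟨r, hr⟩)
    (g_ker : ∀ l r, g l r = 0 ↔ r.1 ∈ aa x l)
    (g_range : ∀ l a, (∀ i, x i ^ l • a = 0) → ∃ r, g l r = a)
    (κ : ∀ _ : ℕ, (A →ₗ[R] E) →ₗ[R] B)
    (κ_surj : ∀ b, ∃ l w, κ l w = b)
    (κ_compat : ∀ l n (_ : l ≤ n) w, κ n (PP x (n-l) • w) = κ l w)
    (κ_kill : ∀ l w, w ∈ aa x l • (⊤ : Submodule R (A →ₗ[R] E)) → κ l w = 0)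
    (κ_zero : ∀ l w, κ l w = 0 → ∃ n, l ≤ n ∧ PP x (n-l) • w ∈ aa x n • (⊤ : Submodule R (A →ₗ[R] E)))
    (J : Ideal R) (hJ : ∀ r, r ∈ J ↔ ∀ l, r ∈ GG x I l) : Nonempty ((B →ₗ[R] E) ≃ₗ[R] J) := by
  set m := IsLocalRing.maximalIdeal R with hm
  have aam : ∀ l, aa x l ≤ m ^ l := by
    intro l
    rw [aa_eq, Ideal.span_le]
    rintro _ ⟨i, rfl⟩
    exact Ideal.pow_mem_pow (hxm i) _
  -- compatibility
  have gsub : ∀ l (r r' : GG x I l), (∀ w : A →ₗ[R] E, w (g l r) = w (g l r')) ↔ r.1 - r'.1 ∈ aa x l := by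
    intro l r r'
    have h1 := g_ker l (r - r')
    rw [map_sub, sub_eq_zero] at h1
    refine Iff.trans ?_ h1
    constructor
    · intro h2
      by_contra h3
      obtain ⟨u, hu⟩ := cogen e he (g l r - g l r') (sub_ne_zero.2 h3)
      rw [map_sub, h2, sub_self] at hu
      exact hu rfl
    · intro h2 w; rw [h2]
  have gP : ∀ l n (hln : l ≤ n) r (hr : r ∈ GG x I n) (w : A →ₗ[R] E),
      (PP x (n-l) • w) (g n ⟨r, hr⟩) = w (g l ⟨r, GG_anti x I hln hr⟩) := by
    intro l n hln r hr w
    have h1 := mul_PP_GG x I hln r (GG_anti x I hln hr)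
    rw [← g_PP l n hln r _ h1, LinearMap.smul_apply, ← map_smul, ← map_smul]
    congr 2
    exact Subtype.ext (mul_comm _ _)
  let Φ : (B →ₗ[R] E) →ₗ[R] (ℕ → ((A →ₗ[R] E) →ₗ[R] E)) :=
    { toFun := fun β l => β ∘ₗ κ l
      map_add' := fun _ _ => rfl
      map_smul' := fun _ _ => rfl }
  let Ψ : J →ₗ[R] (ℕ → ((A →ₗ[R] E) →ₗ[R] E)) :=
    { toFun := fun r l => LinearMap.applyₗ (g l ⟨r.1, (hJ r.1).1 r.2 l⟩)
      map_add' := fun r r' => by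
        funext l
        rw [Pi.add_apply, ← map_add, ← map_add]; rfl
      map_smul' := fun c r => by
        funext l
        rw [RingHom.id_apply, Pi.smul_apply, ← map_smul, ← map_smul]; rfl }
  have hΦ : Function.Injective Φ := by
    intro β β' hb
    ext b
    obtain ⟨l, w, rfl⟩ := κ_surj b
    exact LinearMap.congr_fun (congrFun hb l) w
  have hΨ : Function.Injective Ψ := by
    intro r r' hr
    apply Subtype.ext
    rw [← sub_eq_zero]
    apply IsHausdorff.haus (I := m) (M := R) inferInstance
    intro n
    rw [SModEq.zero, smul_eq_mul, Ideal.mul_top]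
    apply aam n
    exact (gsub n ⟨r.1, (hJ r.1).1 r.2 n⟩ ⟨r'.1, (hJ r'.1).1 r'.2 n⟩).1
      (fun w => LinearMap.congr_fun (congrFun hr n) w)
  have hrange : LinearMap.range Φ = LinearMap.range Ψ := by
    apply le_antisymm
    · rintro _ ⟨β, rfl⟩
      have h1 : ∀ l, ∃ r : GG x I l, ∀ w, β (κ l w) = w (g l r) := by
        intro l
        let M := LinearMap.range (g l)
        let ρ : (A →ₗ[R] E) →ₗ[R] (M →ₗ[R] E) := LinearMap.lcomp R E M.subtype
        obtain ⟨φ, hφ⟩ := inj_ext (R := R) ρ (β ∘ₗ κ l) (by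
          intro w hw
          rw [LinearMap.comp_apply, κ_kill l w, map_zero]
          apply vanish
          intro a ha
          obtain ⟨r, rfl⟩ := g_range l a ha
          exact LinearMap.congr_fun hw ⟨g l r, r, rfl⟩)
        have : Module.Finite R M := inferInstance
        obtain ⟨⟨z, r, hr⟩, hz⟩ := matlis e he hess φ
        refine ⟨r, fun w => ?_⟩
        have := hφ w
        rw [hz] at this
        rw [hr]
        exact this.symm
      choose r hr using h1
      have h2 : ∀ l n, l ≤ n → (r n).1 - (r l).1 ∈ aa x l := by
        intro l n hln
        refine (gsub l ⟨(r n).1, GG_anti x I hln (r n).2⟩ (r l)).1 fun w => ?_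
        rw [← hr l w, ← κ_compat l n hln w, hr n]
        exact (gP l n hln _ (r n).2 w).symm
      obtain ⟨s, hs⟩ := IsPrecomplete.prec (I := m) (M := R) inferInstance (f := fun n => (r n).1) (by
        intro l n hln
        rw [smul_eq_mul, Ideal.mul_top, SModEq.comm, SModEq.sub_mem]
        exact aam l (h2 l n hln))
      have h3 : ∀ l, s - (r l).1 ∈ aa x l := by
        intro l
        rw [← Ideal.Quotient.eq_zero_iff_mem]
        apply IsHausdorff.haus (I := m) (M := R ⧸ aa x l) inferInstance
        intro n
        rw [SModEq.zero]
        have h4 := hs (max l n)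
        rw [smul_eq_mul, Ideal.mul_top, SModEq.comm, SModEq.sub_mem] at h4
        have h5 := h2 l (max l n) (le_max_left _ _)
        have h6 : Ideal.Quotient.mk (aa x l) (s - (r l).1) = (s - (r (max l n)).1) • Ideal.Quotient.mk (aa x l) 1 := by
          rw [Algebra.smul_def, map_one, mul_one]
          refine Ideal.Quotient.eq.2 ?_
          have : s - (r l).1 - (s - (r (max l n)).1) = (r (max l n)).1 - (r l).1 := by ring
          rw [this]; exact h5
        rw [h6]
        exact Submodule.smul_mem_smul (Ideal.pow_le_pow_right (le_max_right l n) h4) trivial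
      have h4 : ∀ l, s ∈ GG x I l := by
        intro l
        have := (GG x I l).add_mem (aa_le_GG x I l (h3 l)) (r l).2
        rwa [sub_add_cancel] at this
      refine ⟨⟨s, (hJ s).2 h4⟩, ?_⟩
      funext l
      ext w
      exact ((gsub l ⟨s, h4 l⟩ (r l)).2 (h3 l) w).trans (hr l w).symm
    · rintro _ ⟨r, rfl⟩
      have hr := (hJ r.1).1 r.2
      have killβ : ∀ n w, w ∈ aa x n • (⊤ : Submodule R (A →ₗ[R] E)) → w (g n ⟨r.1, hr n⟩) = 0 := by
        intro n w hw
        refine Submodule.smul_induction_on hw ?_ ?_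
        · intro c hc w _
          rw [LinearMap.smul_apply, ← map_smul, ← map_smul, (g_ker n _).2, map_zero]
          exact Ideal.mul_mem_right _ _ hc
        · intro w w' h1 h2
          rw [LinearMap.add_apply, h1, h2, add_zero]
      obtain ⟨β, hβ⟩ := inj_ext (R := R) (Finsupp.lsum (M := A →ₗ[R] E) ℕ κ) (Finsupp.lsum ℕ (Ψ r)) (by
        intro p hp
        rw [Finsupp.lsum_apply, Finsupp.sum] at hp ⊢
        obtain ⟨N, hN⟩ : ∃ N, ∀ l ∈ p.support, l ≤ N := ⟨p.support.sup id, fun l hl => Finset.le_sup (f := id) hl⟩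
        have e1 : ∑ l ∈ p.support, κ l (p l) = κ N (∑ l ∈ p.support, PP x (N - l) • p l) := by
          rw [map_sum]
          exact Finset.sum_congr rfl fun l hl => (κ_compat l N (hN l hl) _).symm
        have e2 : ∑ l ∈ p.support, Ψ r l (p l) = Ψ r N (∑ l ∈ p.support, PP x (N - l) • p l) := by
          rw [map_sum]
          exact Finset.sum_congr rfl fun l hl => (gP l N (hN l hl) r.1 (hr N) _).symm
        rw [e1] at hp
        rw [e2]
        obtain ⟨n, hn, hk⟩ := κ_zero _ _ hp
        have h5 := killβ n _ hk
        rw [gP N n hn] at h5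
        exact h5)
      refine ⟨β, ?_⟩
      funext l
      ext w
      have := hβ (Finsupp.single l w)
      rw [Finsupp.lsum_single, Finsupp.lsum_single] at this
      exact this
  exact ⟨(LinearEquiv.ofInjective Φ hΦ).trans ((LinearEquiv.ofEq _ _ hrange).trans
    (LinearEquiv.ofInjective Ψ hΨ).symm)⟩

end Concl

section Fin
open CategoryTheory
variable {R : Type} [CommRing R] [IsNoetherianRing R] [IsLocalRing R]
    [IsAdicComplete (IsLocalRing.maximalIdeal R) R]
    {E : Type} [AddCommGroup E] [Module R E] [Module.Injective R E]

noncomputable abbrev Wm (I : Ideal R) (h : ℕ) (E : Type) [AddCommGroup E] [Module R E] : CC R :=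
  ModuleCat.of R (LH I h (RR R) →ₗ[R] E)

lemma fin1
    (e : IsLocalRing.ResidueField R →ₗ[R] E) (he : Function.Injective e)
    (hess : ∀ N : Submodule R E, N ≠ ⊥ → N ⊓ LinearMap.range e ≠ ⊥)
    (I : Ideal R) (h : ℕ) (x : Fin h → R) (hxI : ∀ i, x i ∈ I)
    (hxm : ∀ i, x i ∈ IsLocalRing.maximalIdeal R)
    (hR : ∀ l, Reg (px x l)) (J : Ideal R) (hJ : ∀ r, r ∈ J ↔ ∀ l, r ∈ GG x I l) :
    Nonempty ((LH (xR x) h (Wm I h E) →ₗ[R] E) ≃ₗ[R] J) := by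
  have k1 := kap_surj x hR (Wm I h E)
  have k2 := fun l n (hln : l ≤ n) w => kap_compat x hR (Wm I h E) hln w
  have k3 := kap_kill x hR (Wm I h E)
  have k4 := kap_zero x hR (Wm I h E)
  have g1 := fun l n (hln : l ≤ n) r hr hr' => gg_PP x hR I hln r hr hr'
  have g2 := fun l r => gg_ker x hR I l r hxI
  have g3 := gg_range x hR I hxI
  generalize kap x hR (Wm I h E) = κ at k1 k2 k3 k4
  generalize gg x hR I = g at g1 g2 g3
  generalize LH (xR x) h (Wm I h E) = B at *
  exact concl (A := LH I h (RR R)) (B := B) e he hess I h x hxm g g1 g2 g3 κ k1 k2 k3 k4 J hJ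

end Fin

end S12

/-- Let `(R, m)` be a noetherian local complete ring, `E` an injective
hull of the residue field `R/m` and `D(-) = Hom_R(-, E)` the Matlis dual functor.  Let
`I` be an ideal of `R`, `h ∈ ℕ`, and `x = x₁,…,x_h ∈ I` an `R`-regular sequence.  Then
the `R`-module `D(H^h_{xR}(D(H^h_I(R))))` is isomorphic to the ideal
`J_{x,I} = {r ∈ R | ∀ l ∃ s, r·Iˢ ⊆ (x₁ˡ,…,x_hˡ)R}` of `R`. -/
theorem stmt12 {R : Type} [CommRing R] [IsNoetherianRing R] [IsLocalRing R]
    [IsAdicComplete (IsLocalRing.maximalIdeal R) R]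
    (E : Type) [AddCommGroup E] [Module R E] [Module.Injective R E]
    (e : IsLocalRing.ResidueField R →ₗ[R] E) (he : Function.Injective e)
    (hess : ∀ N : Submodule R E, N ≠ ⊥ → N ⊓ LinearMap.range e ≠ ⊥)
    (I : Ideal R) (h : ℕ) (x : Fin h → R) (hxI : ∀ i, x i ∈ I)
    (hreg : RingTheory.Sequence.IsRegular R (List.ofFn x)) :
    Nonempty
      ((((localCohomology (Ideal.span (Set.range x)) h).obj
            (ModuleCat.of R
              ((((localCohomology I h).obj (ModuleCat.of R R)) →ₗ[R] E)))) →ₗ[R] E) ≃ₗ[R]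
        ↥(Jideal I x)) := by
  have hR : ∀ l, S12.Reg (S12.px x l) := S12.Reg_px x hreg
  have hJ : ∀ r, r ∈ Jideal I x ↔ ∀ l, r ∈ S12.GG x I l := by
    intro r
    refine forall_congr' fun l => exists_congr fun s => ?_
    rw [S12.aa_eq]
  exact S12.fin1 e he hess I h x hxI (S12.mem_max x hreg) hR (Jideal I x) hJ
end

section
/- Let (R,m) be a Noetherian local ring, I an ideal of R, h ∈ ℕ, and x = x_1,…,x_h ∈ I an R-regular sequence. Then there is an isomorphism of R-modules Hom_R(R/(x_1,…,x_h)R, H^h_I(R)) ≅ Γ_I(R/(x_1,…,x_h)R); in particular, Hom_R(R/(x_1,…,x_h)R, H^h_I(R)) is a finitely generated R-module. -/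
open CategoryTheory
open Opposite Limits

noncomputable section LCAux
variable {R : Type} [CommRing R]

lemma lcd_apply (P : ChainComplex (ModuleCat.{0} R) ℕ) (M : ModuleCat.{0} R) (i j : ℕ) (g : P.X i ⟶ M) :
    ((P.linearYonedaObj R M).d i j).hom g = P.d j i ≫ g := by
  rfl

def lcFst {P Q : ChainComplex (ModuleCat.{0} R) ℕ} (φ : P ⟶ Q) (M : ModuleCat.{0} R) :
    Q.linearYonedaObj R M ⟶ P.linearYonedaObj R M where
  f i := ModuleCat.ofHom (Linear.leftComp R M (φ.f i))
  comm' i j _ := by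
    apply ModuleCat.hom_ext
    refine LinearMap.ext fun (g : Q.X i ⟶ M) => ?_
    change P.d j i ≫ φ.f i ≫ g = φ.f j ≫ Q.d j i ≫ g
    simp

def lcSnd (P : ChainComplex (ModuleCat.{0} R) ℕ) {M N : ModuleCat.{0} R} (g : M ⟶ N) :
    P.linearYonedaObj R M ⟶ P.linearYonedaObj R N where
  f i := ModuleCat.ofHom (Linear.rightComp R (P.X i) g)
  comm' i j _ := by
    apply ModuleCat.hom_ext
    refine LinearMap.ext fun (h : P.X i ⟶ M) => ?_
    change P.d j i ≫ h ≫ g = (P.d j i ≫ h) ≫ g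
    simp

lemma lcFst_f_apply {P Q : ChainComplex (ModuleCat.{0} R) ℕ} (φ : P ⟶ Q) (M : ModuleCat.{0} R) (i : ℕ)
    (g : Q.X i ⟶ M) : ((lcFst φ M).f i).hom g = φ.f i ≫ g := rfl

lemma lcSnd_f_apply (P : ChainComplex (ModuleCat.{0} R) ℕ) {M N : ModuleCat.{0} R} (g : M ⟶ N) (i : ℕ)
    (h : P.X i ⟶ M) : ((lcSnd P g).f i).hom h = h ≫ g := rfl

lemma lcFst_lcSnd {P Q : ChainComplex (ModuleCat.{0} R) ℕ} (φ : P ⟶ Q) {M N : ModuleCat.{0} R} (g : M ⟶ N) :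
    lcSnd Q g ≫ lcFst φ N = lcFst φ M ≫ lcSnd P g := by
  ext i : 1
  apply ModuleCat.hom_ext
  refine LinearMap.ext fun (h : Q.X i ⟶ M) => ?_
  change φ.f i ≫ h ≫ g = (φ.f i ≫ h) ≫ g
  simp

lemma lcFst_smul (P : ChainComplex (ModuleCat.{0} R) ℕ) (M : ModuleCat.{0} R) (r : R) :
    lcFst (r • 𝟙 P) M = r • 𝟙 _ := by
  ext i : 1
  apply ModuleCat.hom_ext
  refine LinearMap.ext fun (h : P.X i ⟶ M) => ?_
  change (r • 𝟙 P : P ⟶ P).f i ≫ h = r • h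
  simp

lemma lcSnd_smul (P : ChainComplex (ModuleCat.{0} R) ℕ) (M : ModuleCat.{0} R) (r : R) :
    lcSnd P (r • 𝟙 M) = r • 𝟙 _ := by
  ext i : 1
  apply ModuleCat.hom_ext
  refine LinearMap.ext fun (h : P.X i ⟶ M) => ?_
  change h ≫ (r • 𝟙 M) = r • h
  simp

lemma lc_abs {C : Type*} [Category C] {EX EY BX BY HX HY : C} (a : EY ⟶ EX) (p : EX ⟶ BX) (q : EY ⟶ BY)
    (b : BY ⟶ BX) (m : HY ⟶ HX) (tX : HX ⟶ BX) (tX' : BX ⟶ HX) (tY : HY ⟶ BY) (tY' : BY ⟶ HY)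
    (h1 : a ≫ p = q ≫ b) (h2 : tY ≫ b = m ≫ tX) (h3 : tX ≫ tX' = 𝟙 _) (h4 : tY' ≫ tY = 𝟙 _) :
    a ≫ p ≫ tX' = (q ≫ tY') ≫ m := by
  have : tY' ≫ m = b ≫ tX' := by
    rw [← Category.comp_id m, ← h3, ← Category.assoc m, ← h2, Category.assoc, reassoc_of% h4]
  rw [reassoc_of% h1, Category.assoc, this]

lemma lcExt_nat {X Y : ModuleCat.{0} R} (f : X ⟶ Y) (P : ProjectiveResolution X)
    (Q : ProjectiveResolution Y) (φ : P.complex ⟶ Q.complex)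
    (comm : φ.f 0 ≫ Q.π.f 0 = P.π.f 0 ≫ f) (i : ℕ) (M : ModuleCat.{0} R) :
    ((Ext R (ModuleCat.{0} R) i).map f.op).app M ≫ (P.isoExt (R := R) i M).hom =
      (Q.isoExt (R := R) i M).hom ≫ HomologicalComplex.homologyMap (lcFst φ M) i := by
  have h1 := congrArg Quiver.Hom.unop (ProjectiveResolution.isoLeftDerivedObj_inv_naturality f P Q φ comm
    ((linearYoneda R _).obj M).rightOp i)
  have h2 := congrArg Quiver.Hom.unop (HomologicalComplex.homologyOp_hom_naturality (lcFst φ M) i)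
  exact lc_abs (((Ext R (ModuleCat.{0} R) i).map f.op).app M)
    (P.isoLeftDerivedObj ((linearYoneda R _).obj M).rightOp i).inv.unop
    (Q.isoLeftDerivedObj ((linearYoneda R _).obj M).rightOp i).inv.unop
    (HomologicalComplex.homologyMap ((HomologicalComplex.opFunctor _ _).map (lcFst φ M).op) i).unop
    (HomologicalComplex.homologyMap (lcFst φ M) i)
    ((P.complex.linearYonedaObj R M).homologyOp i).hom.unop
    ((P.complex.linearYonedaObj R M).homologyOp i).inv.unop
    ((Q.complex.linearYonedaObj R M).homologyOp i).hom.unop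
    ((Q.complex.linearYonedaObj R M).homologyOp i).inv.unop h1 h2
    (congrArg Quiver.Hom.unop ((P.complex.linearYonedaObj R M).homologyOp i).inv_hom_id)
    (congrArg Quiver.Hom.unop ((Q.complex.linearYonedaObj R M).homologyOp i).hom_inv_id)

lemma lc_homologyMap_smul {K L : CochainComplex (ModuleCat.{0} R) ℕ} (f : K ⟶ L) (r : R) (i : ℕ) :
    HomologicalComplex.homologyMap (r • f) i = r • HomologicalComplex.homologyMap f i :=
  ShortComplex.homologyMap_smul (φ := (HomologicalComplex.shortComplexFunctor _ _ i).map f) r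

def lcS (P : ChainComplex (ModuleCat.{0} R) ℕ) (S : ShortComplex (ModuleCat.{0} R)) :
    ShortComplex (CochainComplex (ModuleCat.{0} R) ℕ) :=
  ShortComplex.mk (lcSnd P S.f) (lcSnd P S.g) (by
    ext i : 1
    apply ModuleCat.hom_ext
    refine LinearMap.ext fun (h : P.X i ⟶ S.X₁) => ?_
    change (h ≫ S.f) ≫ S.g = 0
    simp)

lemma lcS_shortExact (P : ChainComplex (ModuleCat.{0} R) ℕ) (hP : ∀ i, Projective (P.X i))
    {S : ShortComplex (ModuleCat.{0} R)} (hS : S.ShortExact) : (lcS P S).ShortExact := by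
  have := hS.mono_f
  have := hS.epi_g
  apply HomologicalComplex.shortExact_of_degreewise_shortExact
  intro i
  have := hP i
  refine ShortComplex.ShortExact.mk' ?_ ?_ ?_
  · rw [ShortComplex.moduleCat_exact_iff]
    intro (h : P.X i ⟶ S.X₂) (hh : h ≫ S.g = 0)
    exact ⟨(hS.exact.lift h hh : P.X i ⟶ S.X₁), hS.exact.lift_f h hh⟩
  · rw [ModuleCat.mono_iff_injective]
    intro (a : P.X i ⟶ S.X₁) (b : P.X i ⟶ S.X₁) (hab : a ≫ S.f = b ≫ S.f)
    exact (cancel_mono S.f).1 hab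
  · rw [ModuleCat.epi_iff_surjective]
    intro (a : P.X i ⟶ S.X₃)
    exact ⟨(Projective.factorThru a S.g : P.X i ⟶ S.X₂), Projective.factorThru_comp a S.g⟩

abbrev lcE (i : ℕ) (X M : ModuleCat.{0} R) : ModuleCat.{0} R :=
  ((Ext R (ModuleCat.{0} R) i).obj (op X)).obj M

abbrev lcEmap (i : ℕ) {X Y : ModuleCat.{0} R} (f : X ⟶ Y) (M : ModuleCat.{0} R) :
    lcE i Y M ⟶ lcE i X M :=
  ((Ext R (ModuleCat.{0} R) i).map f.op).app M

def lcIso (i : ℕ) (X M : ModuleCat.{0} R) :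
    lcE i X M ≅ ((projectiveResolution X).complex.linearYonedaObj R M).homology i :=
  (projectiveResolution X).isoExt i M

def lcLift {X Y : ModuleCat.{0} R} (f : X ⟶ Y) :
    (projectiveResolution X).complex ⟶ (projectiveResolution Y).complex :=
  ProjectiveResolution.lift f _ _

lemma lcIso_nat (i : ℕ) {X Y : ModuleCat.{0} R} (f : X ⟶ Y) (M : ModuleCat.{0} R) :
    lcEmap i f M ≫ (lcIso i X M).hom =
      (lcIso i Y M).hom ≫ HomologicalComplex.homologyMap (lcFst (lcLift f) M) i :=
  lcExt_nat f _ _ _ (ProjectiveResolution.lift_commutes_zero f _ _) i M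

lemma lcEmap_smul (i : ℕ) (X M : ModuleCat.{0} R) (r : R) :
    lcEmap i (r • 𝟙 X) M = r • 𝟙 _ := by
  have h := lcExt_nat (r • 𝟙 X) (projectiveResolution X) (projectiveResolution X) (r • 𝟙 _)
    ((Linear.smul_comp _ _ _ _ _ _).trans (Eq.trans (by
      rw [HomologicalComplex.id_f, Category.id_comp]
      exact congrArg (r • ·) (Category.comp_id _).symm) (Linear.comp_smul _ _ _ _ _ _).symm)) i M
  rw [lcFst_smul, lc_homologyMap_smul, HomologicalComplex.homologyMap_id,
    Linear.comp_smul, Category.comp_id] at h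
  rw [← cancel_mono ((projectiveResolution X).isoExt (R := R) i M).hom, h,
    Linear.smul_comp, Category.id_comp]

/-- the functoriality in the second variable -/
def lcPush (i : ℕ) (X : ModuleCat.{0} R) {M N : ModuleCat.{0} R} (g : M ⟶ N) :
    lcE i X M ⟶ lcE i X N :=
  (lcIso i X M).hom ≫ HomologicalComplex.homologyMap (lcSnd _ g) i ≫ (lcIso i X N).inv

lemma lcPush_nat (i : ℕ) {X Y : ModuleCat.{0} R} (f : X ⟶ Y) {M N : ModuleCat.{0} R} (g : M ⟶ N) :
    lcPush i Y g ≫ lcEmap i f N = lcEmap i f M ≫ lcPush i X g := by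
  rw [← cancel_mono (lcIso i X N).hom]
  simp only [lcPush, Category.assoc, Iso.inv_hom_id, Category.comp_id, lcIso_nat,
    Iso.inv_hom_id_assoc]
  rw [← Category.assoc (lcEmap i f M), lcIso_nat, Category.assoc,
    ← HomologicalComplex.homologyMap_comp, ← HomologicalComplex.homologyMap_comp, lcFst_lcSnd]

lemma lcPush_smul (i : ℕ) (X M : ModuleCat.{0} R) (r : R) :
    lcPush i X (r • 𝟙 M) = r • 𝟙 _ := by
  rw [lcPush, lcSnd_smul, lc_homologyMap_smul, HomologicalComplex.homologyMap_id]
  simp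

def lcδ' (i : ℕ) (X : ModuleCat.{0} R) {S : ShortComplex (ModuleCat.{0} R)} (hS : S.ShortExact) :
    ((projectiveResolution X).complex.linearYonedaObj R S.X₃).homology i ⟶
      ((projectiveResolution X).complex.linearYonedaObj R S.X₁).homology (i + 1) :=
  (lcS_shortExact (projectiveResolution X).complex (fun _ => inferInstance) hS).δ i (i + 1) rfl

def lcδ (i : ℕ) (X : ModuleCat.{0} R) {S : ShortComplex (ModuleCat.{0} R)} (hS : S.ShortExact) :
    lcE i X S.X₃ ⟶ lcE (i + 1) X S.X₁ :=
  (lcIso i X S.X₃).hom ≫ lcδ' i X hS ≫ (lcIso (i + 1) X S.X₁).inv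

lemma lcδ_nat (i : ℕ) {X Y : ModuleCat.{0} R} (f : X ⟶ Y)
    {S : ShortComplex (ModuleCat.{0} R)} (hS : S.ShortExact) :
    lcδ i Y hS ≫ lcEmap (i + 1) f S.X₁ = lcEmap i f S.X₃ ≫ lcδ i X hS := by
  have key : lcδ' i Y hS ≫ HomologicalComplex.homologyMap (lcFst (lcLift f) S.X₁) (i + 1) =
      HomologicalComplex.homologyMap (lcFst (lcLift f) S.X₃) i ≫ lcδ' i X hS := HomologicalComplex.HomologySequence.δ_naturality
    (S₁ := lcS (projectiveResolution Y).complex S) (S₂ := lcS (projectiveResolution X).complex S)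
    { τ₁ := lcFst (lcLift f) S.X₁, τ₂ := lcFst (lcLift f) S.X₂, τ₃ := lcFst (lcLift f) S.X₃
      comm₁₂ := (lcFst_lcSnd _ _).symm, comm₂₃ := (lcFst_lcSnd _ _).symm }
    (lcS_shortExact (projectiveResolution Y).complex (fun _ => inferInstance) hS)
    (lcS_shortExact (projectiveResolution X).complex (fun _ => inferInstance) hS) i (i + 1) rfl
  rw [← cancel_mono (lcIso (i + 1) X S.X₁).hom]
  simp only [lcδ, Category.assoc, Iso.inv_hom_id, Category.comp_id, lcIso_nat,
    Iso.inv_hom_id_assoc]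
  rw [← Category.assoc (lcEmap i f S.X₃), lcIso_nat, Category.assoc]
  rw [key]

lemma lc_exact_conj {A B C A' B' C' : ModuleCat.{0} R} (eA : A ≅ A') (eB : B ≅ B') (eC : C ≅ C')
    (f : A' ⟶ B') (g : B' ⟶ C') (w : f ≫ g = 0) (h : (ShortComplex.mk f g w).Exact) (b : B) :
    (eB.hom ≫ g ≫ eC.inv).hom b = 0 ↔ ∃ a, (eA.hom ≫ f ≫ eB.inv).hom a = b := by
  have w' : (eA.hom ≫ f ≫ eB.inv) ≫ (eB.hom ≫ g ≫ eC.inv) = 0 := by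
    simp [reassoc_of% w]
  have h' : (ShortComplex.mk (eA.hom ≫ f ≫ eB.inv) (eB.hom ≫ g ≫ eC.inv) w').Exact := by
    refine ShortComplex.exact_of_iso (ShortComplex.isoMk eA.symm eB.symm eC.symm ?_ ?_) h
    · simp
    · simp
  rw [ShortComplex.moduleCat_exact_iff] at h'
  constructor
  · exact h' b
  · rintro ⟨a, rfl⟩
    exact LinearMap.congr_fun (congrArg ModuleCat.Hom.hom w') a

lemma lc_exact3 (i : ℕ) (X : ModuleCat.{0} R) {S : ShortComplex (ModuleCat.{0} R)} (hS : S.ShortExact)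
    (b : lcE i X S.X₃) :
    (lcδ i X hS).hom b = 0 ↔ ∃ a, (lcPush i X S.g).hom a = b :=
  lc_exact_conj _ _ _ _ _ _
    ((lcS_shortExact (projectiveResolution X).complex (fun _ => inferInstance) hS).homology_exact₃ i (i + 1) rfl) b

lemma lc_exact1 (i : ℕ) (X : ModuleCat.{0} R) {S : ShortComplex (ModuleCat.{0} R)} (hS : S.ShortExact)
    (b : lcE (i + 1) X S.X₁) :
    (lcPush (i + 1) X S.f).hom b = 0 ↔ ∃ a, (lcδ i X hS).hom a = b :=
  lc_exact_conj _ _ _ _ _ _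
    ((lcS_shortExact (projectiveResolution X).complex (fun _ => inferInstance) hS).homology_exact₁ i (i + 1) rfl) b

instance lc_preserves (M : ModuleCat.{0} R) :
    PreservesFiniteColimits ((linearYoneda R (ModuleCat.{0} R)).obj M).rightOp := by
  have : PreservesLimitsOfSize.{0,0} ((linearYoneda R (ModuleCat.{0} R)).obj M ⋙ forget _) :=
    inferInstanceAs (PreservesLimitsOfSize.{0,0} (yoneda.obj M))
  have : PreservesLimitsOfSize.{0,0} ((linearYoneda R (ModuleCat.{0} R)).obj M) :=
    preservesLimits_of_reflects_of_preserves _ (forget _)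
  have : PreservesFiniteLimits ((linearYoneda R (ModuleCat.{0} R)).obj M) :=
    PreservesLimitsOfSize.preservesFiniteLimits _
  exact preservesFiniteColimits_rightOp _

def lcZero (X M : ModuleCat.{0} R) : ModuleCat.of R (X ⟶ M) ≅ lcE 0 X M :=
  (((linearYoneda R (ModuleCat.{0} R)).obj M).rightOp.leftDerivedZeroIsoSelf.app X).unop

lemma lcZero_nat {X Y : ModuleCat.{0} R} (f : X ⟶ Y) (M : ModuleCat.{0} R) :
    (lcZero Y M).hom ≫ lcEmap 0 f M = ModuleCat.ofHom (Linear.leftComp R M f) ≫ (lcZero X M).hom :=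
  congrArg Quiver.Hom.unop
    (((linearYoneda R (ModuleCat.{0} R)).obj M).rightOp.leftDerivedZeroIsoSelf.hom.naturality f)

open localCohomology

variable (I : Ideal R)

abbrev lcX (n : ℕ) : ModuleCat.{0} R := ModuleCat.of R (R ⧸ I ^ n)

abbrev lcTr {n m : ℕ} (h : n ≤ m) : lcX I m ⟶ lcX I n :=
  (ringModIdeals (idealPowersDiagram I)).map (homOfLE h).op

lemma lcTr_one {n m : ℕ} (h : n ≤ m) : (lcTr I h).hom (Ideal.Quotient.mk _ 1) = Ideal.Quotient.mk _ 1 := rfl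

abbrev lcH (i : ℕ) (M : ModuleCat.{0} R) : ModuleCat.{0} R := (localCohomology I i).obj M

def lcDiag (i : ℕ) (M : ModuleCat.{0} R) : ℕᵒᵖᵒᵖ ⥤ ModuleCat.{0} R :=
  diagram (idealPowersDiagram I) i ⋙ (evaluation _ _).obj M

def lcCocone (i : ℕ) (M : ModuleCat.{0} R) : Cocone (lcDiag I i M) :=
  ((evaluation _ _).obj M).mapCocone (colimit.cocone (diagram (idealPowersDiagram I) i))

def lcIsColimit (i : ℕ) (M : ModuleCat.{0} R) : IsColimit (lcCocone I i M) :=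
  isColimitOfPreserves ((evaluation _ _).obj M) (colimit.isColimit (diagram (idealPowersDiagram I) i))

def lcι (i n : ℕ) (M : ModuleCat.{0} R) : lcE i (lcX I n) M ⟶ lcH I i M :=
  (lcCocone I i M).ι.app (op (op n))

lemma lcι_tr (i : ℕ) {n m : ℕ} (h : n ≤ m) (M : ModuleCat.{0} R) :
    lcEmap i (lcTr I h) M ≫ lcι I i m M = lcι I i n M :=
  (lcCocone I i M).w (homOfLE h).op.op

lemma lcι_tr_apply (i : ℕ) {n m : ℕ} (h : n ≤ m) (M : ModuleCat.{0} R) (e : lcE i (lcX I n) M) :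
    (lcι I i m M).hom ((lcEmap i (lcTr I h) M).hom e) = (lcι I i n M).hom e :=
  LinearMap.congr_fun (congrArg ModuleCat.Hom.hom (lcι_tr I i h M)) e

lemma lcι_surj (i : ℕ) (M : ModuleCat.{0} R) (y : lcH I i M) :
    ∃ n e, (lcι I i n M).hom e = y := by
  obtain ⟨j, e, h⟩ := Concrete.isColimit_exists_rep _ (lcIsColimit I i M) y
  exact ⟨j.unop.unop, e, h⟩

lemma lcι_zero (i n : ℕ) (M : ModuleCat.{0} R) (e : lcE i (lcX I n) M)
    (he : (lcι I i n M).hom e = 0) :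
    ∃ m, ∃ h : n ≤ m, (lcEmap i (lcTr I h) M).hom e = 0 := by
  obtain ⟨k, f, g, h⟩ := Concrete.isColimit_exists_of_rep_eq (lcDiag I i M) (lcIsColimit I i M)
    (i := op (op n)) (j := op (op n)) e 0
    (he.trans (map_zero _).symm)
  refine ⟨k.unop.unop, leOfHom f.unop.unop, ?_⟩
  exact h.trans (map_zero ((lcDiag I i M).map g).hom)

def lcDesc (i : ℕ) (M N : ModuleCat.{0} R) (g : ∀ n, lcE i (lcX I n) M ⟶ N)
    (hg : ∀ n m (h : n ≤ m), lcEmap i (lcTr I h) M ≫ g m = g n) : lcH I i M ⟶ N :=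
  (lcIsColimit I i M).desc ⟨N, ⟨fun j => g j.unop.unop, fun j k f => by
    refine Eq.trans (hg j.unop.unop k.unop.unop (leOfHom f.unop.unop)) ?_
    exact (Category.comp_id _).symm⟩⟩

lemma lcDesc_apply (i : ℕ) (M N : ModuleCat.{0} R) (g : ∀ n, lcE i (lcX I n) M ⟶ N)
    (hg : ∀ n m (h : n ≤ m), lcEmap i (lcTr I h) M ≫ g m = g n) (n : ℕ) (e : lcE i (lcX I n) M) :
    (lcDesc I i M N g hg).hom ((lcι I i n M).hom e) = (g n).hom e :=
  LinearMap.congr_fun (congrArg ModuleCat.Hom.hom ((lcIsColimit I i M).fac _ (op (op n)))) e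

lemma lc_torsion (i : ℕ) (M : ModuleCat.{0} R) (y : lcH I i M) :
    ∃ n, ∀ r ∈ I ^ n, r • y = 0 := by
  obtain ⟨n, e, rfl⟩ := lcι_surj I i M y
  refine ⟨n, fun r hr => ?_⟩
  have h0 : (r • 𝟙 (lcX I n)) = (0 : R) • 𝟙 (lcX I n) := by
    apply ModuleCat.hom_ext
    refine LinearMap.ext fun z => ?_
    obtain ⟨z, rfl⟩ := Ideal.Quotient.mk_surjective z
    change r • (Ideal.Quotient.mk (I ^ n) z) = (0 : R) • (Ideal.Quotient.mk (I ^ n) z)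
    rw [zero_smul, ← Ideal.Quotient.mkₐ_eq_mk R, ← map_smul, Ideal.Quotient.mkₐ_eq_mk,
      Ideal.Quotient.eq_zero_iff_mem]
    exact Ideal.mul_mem_right _ _ hr
  have h1 := lcEmap_smul i (lcX I n) M r
  rw [h0, lcEmap_smul] at h1
  have h2 : (0 : R) • e = r • e := LinearMap.congr_fun (congrArg ModuleCat.Hom.hom h1) e
  rw [← map_smul, ← h2, zero_smul, map_zero]

def lcδH (i : ℕ) {S : ShortComplex (ModuleCat.{0} R)} (hS : S.ShortExact) :
    lcH I i S.X₃ ⟶ lcH I (i + 1) S.X₁ :=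
  lcDesc I i _ _ (fun n => lcδ i (lcX I n) hS ≫ lcι I (i + 1) n S.X₁) (fun n m h => by
    rw [← Category.assoc, ← lcδ_nat, Category.assoc, lcι_tr])

lemma lcδH_apply (i : ℕ) {S : ShortComplex (ModuleCat.{0} R)} (hS : S.ShortExact) (n : ℕ)
    (e : lcE i (lcX I n) S.X₃) :
    (lcδH I i hS).hom ((lcι I i n S.X₃).hom e) =
      (lcι I (i + 1) n S.X₁).hom ((lcδ i (lcX I n) hS).hom e) :=
  lcDesc_apply I i _ _ _ _ n e

lemma lcδ_nat_apply (i : ℕ) {X Y : ModuleCat.{0} R} (f : X ⟶ Y)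
    {S : ShortComplex (ModuleCat.{0} R)} (hS : S.ShortExact) (e : lcE i Y S.X₃) :
    (lcEmap (i + 1) f S.X₁).hom ((lcδ i Y hS).hom e) =
      (lcδ i X hS).hom ((lcEmap i f S.X₃).hom e) :=
  LinearMap.congr_fun (congrArg ModuleCat.Hom.hom (lcδ_nat i f hS)) e

lemma lcPush_nat_apply (i : ℕ) {X Y : ModuleCat.{0} R} (f : X ⟶ Y) {M N : ModuleCat.{0} R}
    (g : M ⟶ N) (e : lcE i Y M) :
    (lcEmap i f N).hom ((lcPush i Y g).hom e) = (lcPush i X g).hom ((lcEmap i f M).hom e) :=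
  LinearMap.congr_fun (congrArg ModuleCat.Hom.hom (lcPush_nat i f g)) e

lemma lcδH_injective (i : ℕ) {S : ShortComplex (ModuleCat.{0} R)} (hS : S.ShortExact)
    [Subsingleton (lcH I i S.X₂)] : Function.Injective (lcδH I i hS).hom := by
  rw [injective_iff_map_eq_zero]
  intro y hy
  obtain ⟨n, e, rfl⟩ := lcι_surj I i _ y
  rw [lcδH_apply] at hy
  obtain ⟨m, h, hm⟩ := lcι_zero I _ _ _ _ hy
  rw [lcδ_nat_apply, lc_exact3] at hm
  obtain ⟨a, ha⟩ := hm
  obtain ⟨k, hk, hak⟩ := lcι_zero I i m S.X₂ a (Subsingleton.elim _ _)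
  rw [← lcι_tr_apply I i h, ← lcι_tr_apply I i hk, ← ha, lcPush_nat_apply, hak]
  simp

lemma lcPush_eq (i : ℕ) (X : ModuleCat.{0} R) {M N : ModuleCat.{0} R} (r : R) (h : M = N)
    (g : M ⟶ N) (hg : g = r • eqToHom h) (e : lcE i X M) :
    (lcPush i X g).hom e = 0 ↔ r • e = 0 := by
  subst h
  subst hg
  rw [eqToHom_refl, lcPush_smul]
  rfl

lemma lcδH_range (i : ℕ) {S : ShortComplex (ModuleCat.{0} R)} (hS : S.ShortExact) (r : R)
    (e12 : S.X₁ = S.X₂) (hr : S.f = r • eqToHom e12) (y : lcH I (i + 1) S.X₁) :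
    r • y = 0 ↔ ∃ z, (lcδH I i hS).hom z = y := by
  have hp : ∀ n (e : lcE (i + 1) (lcX I n) S.X₁),
      (lcPush (i + 1) (lcX I n) S.f).hom e = 0 ↔ r • e = 0 := by
    exact fun n e => lcPush_eq _ _ r e12 _ hr e
  constructor
  · intro h
    obtain ⟨n, e, rfl⟩ := lcι_surj I _ _ y
    rw [← map_smul] at h
    obtain ⟨m, hm, h⟩ := lcι_zero I _ _ _ _ h
    rw [map_smul, ← hp, lc_exact1 i _ hS] at h
    obtain ⟨a, ha⟩ := h
    refine ⟨(lcι I i m _).hom a, ?_⟩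
    rw [lcδH_apply, ha, lcι_tr_apply]
  · rintro ⟨z, rfl⟩
    obtain ⟨n, e, rfl⟩ := lcι_surj I _ _ z
    rw [lcδH_apply, ← map_smul, (hp n _).1 ((lc_exact1 i _ hS _).2 ⟨e, rfl⟩), map_zero]

open Pointwise

def lcSeq (M : ModuleCat.{0} R) (r : R) : ShortComplex (ModuleCat.{0} R) :=
  ShortComplex.mk (X₁ := M) (X₂ := M) (X₃ := ModuleCat.of R (QuotSMulTop r M))
    (r • 𝟙 M) (ModuleCat.ofHom (Submodule.mkQ _)) (by
      apply ModuleCat.hom_ext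
      refine LinearMap.ext fun z => ?_
      change Submodule.mkQ (r • (⊤ : Submodule R M)) (r • z) = 0
      rw [Submodule.mkQ_apply, Submodule.Quotient.mk_eq_zero]
      exact Submodule.smul_mem_pointwise_smul _ _ _ trivial)

lemma lcSeq_shortExact (M : ModuleCat.{0} R) (r : R) (h : IsSMulRegular M r) :
    (lcSeq M r).ShortExact := by
  refine ShortComplex.ShortExact.mk' ?_ ?_ ?_
  · rw [ShortComplex.moduleCat_exact_iff]
    intro (x : M) (hx : Submodule.mkQ (r • (⊤ : Submodule R M)) x = 0)
    rw [Submodule.mkQ_apply, Submodule.Quotient.mk_eq_zero] at hx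
    obtain ⟨z, -, hz⟩ := hx
    exact ⟨z, hz⟩
  · rw [ModuleCat.mono_iff_injective]
    exact h
  · rw [ModuleCat.epi_iff_surjective]
    exact Submodule.mkQ_surjective _

abbrev lcΓ (M : Type) [AddCommGroup M] [Module R M] : Submodule R M :=
  ⨆ n : ℕ, Submodule.torsionBySet R M ((I ^ n : Ideal R) : Set R)

lemma mem_lcΓ {M : Type} [AddCommGroup M] [Module R M] (y : M) :
    y ∈ lcΓ I M ↔ ∃ n : ℕ, ∀ r ∈ I ^ n, r • y = 0 := by
  rw [lcΓ, Submodule.mem_iSup_of_directed]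
  · simp [Submodule.mem_torsionBySet_iff]
  · apply Monotone.directed_le
    intro a b hab y hy
    rw [Submodule.mem_torsionBySet_iff] at hy ⊢
    exact fun r => hy ⟨r.1, Ideal.pow_le_pow_right hab r.2⟩

def lcΓEquiv {M N : Type} [AddCommGroup M] [Module R M] [AddCommGroup N] [Module R N]
    (e : M ≃ₗ[R] N) : lcΓ I M ≃ₗ[R] lcΓ I N :=
  e.ofSubmodules _ _ (by
    ext y
    simp only [Submodule.mem_map, mem_lcΓ]
    constructor
    · rintro ⟨z, ⟨n, hn⟩, rfl⟩
      refine ⟨n, fun r hr => ?_⟩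
      have := congrArg e (hn r hr)
      simpa using this
    · rintro ⟨n, hn⟩
      refine ⟨e.symm y, ⟨n, fun r hr => ?_⟩, by simp⟩
      rw [← map_smul, hn r hr, map_zero])

/-- evaluation at one -/
def lcEv (n : ℕ) (M : ModuleCat.{0} R) : ModuleCat.of R (lcX I n ⟶ M) ⟶ M :=
  ModuleCat.ofHom
    { toFun := fun f => f.hom (Ideal.Quotient.mk _ 1)
      map_add' := fun _ _ => rfl
      map_smul' := fun _ _ => rfl }

lemma lcEv_injective (n : ℕ) (M : ModuleCat.{0} R) (f g : lcX I n ⟶ M)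
    (h : f.hom (Ideal.Quotient.mk _ 1) = g.hom (Ideal.Quotient.mk _ 1)) : f = g := by
  apply ModuleCat.hom_ext
  refine LinearMap.ext fun z => ?_
  obtain ⟨z, rfl⟩ := Ideal.Quotient.mk_surjective z
  have : (Ideal.Quotient.mk (I ^ n) z) = z • Ideal.Quotient.mk (I ^ n) 1 := by
    rw [← Ideal.Quotient.mkₐ_eq_mk R, ← map_smul, smul_eq_mul, mul_one]
  rw [this, map_smul, map_smul, h]

def lcBase (M : ModuleCat.{0} R) : lcH I 0 M ⟶ M :=
  lcDesc I 0 M M (fun n => (lcZero (lcX I n) M).inv ≫ lcEv I n M) (fun n m h => by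
    rw [← cancel_epi (lcZero (lcX I n) M).hom, ← Category.assoc, lcZero_nat]
    simp only [Category.assoc, Iso.hom_inv_id_assoc]
    rfl)

lemma lcBase_apply (M : ModuleCat.{0} R) (n : ℕ) (f : lcX I n ⟶ M) :
    (lcBase I M).hom ((lcι I 0 n M).hom ((lcZero (lcX I n) M).hom f)) =
      f.hom (Ideal.Quotient.mk _ 1) := by
  refine (lcDesc_apply I 0 _ _ _ _ n _).trans ?_
  have : (lcZero (lcX I n) M).hom ≫ (lcZero (lcX I n) M).inv ≫ lcEv I n M = lcEv I n M := by simp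
  exact LinearMap.congr_fun (congrArg ModuleCat.Hom.hom this) f

lemma lcι_surj0 (M : ModuleCat.{0} R) (y : lcH I 0 M) :
    ∃ n, ∃ f : lcX I n ⟶ M, (lcι I 0 n M).hom ((lcZero (lcX I n) M).hom f) = y := by
  obtain ⟨n, e, rfl⟩ := lcι_surj I 0 M y
  refine ⟨n, (lcZero (lcX I n) M).inv.hom e, ?_⟩
  exact congrArg _ (LinearMap.congr_fun (congrArg ModuleCat.Hom.hom (lcZero (lcX I n) M).inv_hom_id) e)

lemma lcBase_injective (M : ModuleCat.{0} R) : Function.Injective (lcBase I M).hom := by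
  rw [injective_iff_map_eq_zero]
  intro y hy
  obtain ⟨n, f, rfl⟩ := lcι_surj0 I M y
  rw [lcBase_apply] at hy
  obtain rfl : f = 0 := lcEv_injective I n M f 0 hy
  exact (congrArg _ (map_zero (lcZero (lcX I n) M).hom.hom)).trans (map_zero _)

lemma lcBase_range (M : ModuleCat.{0} R) : LinearMap.range (lcBase I M).hom = lcΓ I M := by
  ext y
  rw [mem_lcΓ]
  constructor
  · rintro ⟨z, rfl⟩
    obtain ⟨n, hn⟩ := lc_torsion I 0 M z
    exact ⟨n, fun r hr => by rw [← map_smul, hn r hr, map_zero]⟩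
  · rintro ⟨n, hn⟩
    refine ⟨(lcι I 0 n M).hom ((lcZero (lcX I n) M).hom
      (ModuleCat.ofHom (Submodule.liftQ (I ^ n) (LinearMap.toSpanSingleton R M y) hn))), ?_⟩
    rw [lcBase_apply]
    exact one_smul R y

/-- transport of torsion along an injection onto a torsion submodule -/
lemma lc_tors {A B : Type} [AddCommGroup A] [Module R A] [AddCommGroup B] [Module R B]
    (D : A →ₗ[R] B) (hD : Function.Injective D) (a : R) (rs : List R)
    (hr : ∀ y, a • y = 0 ↔ ∃ z, D z = y) :
    Nonempty (Submodule.torsionBySet R B {r | r ∈ a :: rs} ≃ₗ[R]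
      Submodule.torsionBySet R A {r | r ∈ rs}) := by
  have hmem : ∀ z : A, z ∈ Submodule.torsionBySet R A {r | r ∈ rs} ↔
      D z ∈ Submodule.torsionBySet R B {r | r ∈ a :: rs} := by
    intro z
    simp only [Submodule.mem_torsionBySet_iff, Subtype.forall, Set.mem_ofPred_eq,
      List.mem_cons, forall_eq_or_imp]
    constructor
    · intro h
      exact ⟨(hr _).2 ⟨z, rfl⟩, fun r hr => by rw [← map_smul, h r hr, map_zero]⟩
    · rintro ⟨-, h⟩ r hr
      apply hD
      rw [map_smul, h r hr, map_zero]
  refine ⟨(LinearEquiv.ofBijective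
    ((D.domRestrict _).codRestrict _ (fun z => (hmem z.1).1 z.2)) ⟨?_, ?_⟩).symm⟩
  · intro z w hzw
    exact Subtype.ext (hD (congrArg Subtype.val hzw))
  · rintro ⟨y, hy⟩
    have h1 : a • y = 0 := by
      rw [Submodule.mem_torsionBySet_iff] at hy
      exact hy ⟨a, List.mem_cons_self⟩
    obtain ⟨z, rfl⟩ := (hr y).1 h1
    exact ⟨⟨z, (hmem z).2 hy⟩, rfl⟩

lemma lcMain (rs : List R) (hI : ∀ r ∈ rs, r ∈ I) : ∀ (k : ℕ) (_ : rs.length = k)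
    (M : ModuleCat.{0} R) (_ : RingTheory.Sequence.IsWeaklyRegular M rs),
    (∀ j < k, Subsingleton (lcH I j M)) ∧
    Nonempty (Submodule.torsionBySet R (lcH I k M) {r | r ∈ rs} ≃ₗ[R]
      lcΓ I (M ⧸ (Ideal.ofList rs • ⊤ : Submodule R M))) := by
  induction rs with
  | nil =>
    rintro _ rfl M -
    refine ⟨fun j hj => absurd hj (Nat.not_lt_zero j), ⟨?_⟩⟩
    have h1 : Submodule.torsionBySet R (lcH I 0 M) {r | r ∈ ([] : List R)} = ⊤ := by
      rw [eq_top_iff]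
      intro y _
      rw [Submodule.mem_torsionBySet_iff]
      rintro ⟨r, hr⟩
      exact absurd hr List.not_mem_nil
    have h2 : (Ideal.ofList ([] : List R) • ⊤ : Submodule R M) = ⊥ := by simp
    exact (LinearEquiv.ofTop _ h1) ≪≫ₗ (LinearEquiv.ofInjective _ (lcBase_injective I M)) ≪≫ₗ
      (LinearEquiv.ofEq _ _ (lcBase_range I M)) ≪≫ₗ
      lcΓEquiv I (Submodule.quotEquivOfEqBot _ h2).symm
  | cons a rs ih =>
    rintro _ rfl M hM
    rw [RingTheory.Sequence.isWeaklyRegular_cons_iff] at hM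
    obtain ⟨ha, hM⟩ := hM
    obtain ⟨ih1, ⟨ih2⟩⟩ := ih (fun r hr => hI r (List.mem_cons_of_mem _ hr)) _ rfl
      (ModuleCat.of R (QuotSMulTop a M)) hM
    have haI : a ∈ I := hI a List.mem_cons_self
    have hS := lcSeq_shortExact M a ha
    have hreg : ∀ j < rs.length + 1, ∀ y : lcH I j M, a • y = 0 → y = 0 := by
      intro j hj y hy
      rcases j with _ | j
      · apply lcBase_injective I M
        apply ha
        change a • _ = a • _
        rw [← map_smul, hy, map_zero, smul_zero]
      · have := ih1 j (by omega)
        obtain ⟨z, rfl⟩ := (lcδH_range I j hS a rfl rfl y).1 hy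
        have hz : z = 0 := this.elim z 0
        rw [hz, map_zero]
        rfl
    have hsub : ∀ j < rs.length + 1, Subsingleton (lcH I j M) := by
      intro j hj
      refine subsingleton_of_forall_eq 0 fun y => ?_
      obtain ⟨n, hn⟩ := lc_torsion I j M y
      have hp := hn (a ^ n) (Ideal.pow_mem_pow haI n)
      clear hn
      induction n with
      | zero => simpa using hp
      | succ n ihn =>
        apply ihn
        apply hreg j hj
        rw [smul_smul, ← pow_succ', hp]
    refine ⟨hsub, ?_⟩
    have := hsub rs.length (by omega)
    have : Subsingleton (lcH I rs.length (lcSeq M a).X₂) := this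
    obtain ⟨e⟩ := lc_tors (lcδH I rs.length hS).hom (lcδH_injective I _ hS) a rs
      (fun y => lcδH_range I rs.length hS a rfl rfl y)
    exact ⟨e ≪≫ₗ ih2 ≪≫ₗ
      lcΓEquiv I (Submodule.quotOfListConsSMulTopEquivQuotSMulTopInner M a rs).symm⟩

lemma lcHom (J : Ideal R) (s : Set R) (hJ : J = Ideal.span s) (N : Type) [AddCommGroup N] [Module R N] :
    Nonempty (((R ⧸ J) →ₗ[R] N) ≃ₗ[R] Submodule.torsionBySet R N s) := by
  subst hJ
  have key : ∀ φ : (R ⧸ Ideal.span s) →ₗ[R] N,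
      φ (Submodule.Quotient.mk 1) ∈ Submodule.torsionBySet R N s := by
    intro φ
    rw [Submodule.mem_torsionBySet_iff]
    rintro ⟨r, hr⟩
    change r • _ = _
    rw [← map_smul, ← Submodule.Quotient.mk_smul, smul_eq_mul, mul_one,
      (Submodule.Quotient.mk_eq_zero _).2 (Ideal.subset_span hr), map_zero]
  refine ⟨LinearEquiv.ofBijective
    { toFun := fun φ => ⟨φ (Submodule.Quotient.mk 1), key φ⟩
      map_add' := fun _ _ => rfl
      map_smul' := fun _ _ => rfl } ⟨?_, ?_⟩⟩
  · intro φ ψ h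
    apply Submodule.linearMap_qext
    apply LinearMap.ext_ring
    exact congrArg Subtype.val h
  · rintro ⟨y, hy⟩
    refine ⟨Submodule.liftQ _ (LinearMap.toSpanSingleton R N y) ?_, ?_⟩
    · rw [Ideal.span, Submodule.span_le]
      intro r hr
      rw [Submodule.mem_torsionBySet_iff] at hy
      exact hy ⟨r, hr⟩
    · exact Subtype.ext (one_smul R y)

end LCAux

/-- Let `(R, m)` be a noetherian local ring, `I` an ideal of `R`,
`h ∈ ℕ`, and `x = x₁,…,x_h ∈ I` an `R`-regular sequence.  Then there is an isomorphism
of `R`-modules `Hom_R(R/(x₁,…,x_h)R, H^h_I(R)) ≅ Γ_I(R/(x₁,…,x_h)R)`; in particular,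
`Hom_R(R/(x₁,…,x_h)R, H^h_I(R))` is a finitely generated `R`-module.  Here
`Γ_I(M) = ⨆ n (0 :_M Iⁿ)` is the `I`-torsion functor. -/
theorem stmt16 {R : Type} [CommRing R] [IsNoetherianRing R] [IsLocalRing R]
    (I : Ideal R) (h : ℕ) (x : Fin h → R) (hxI : ∀ i, x i ∈ I)
    (hreg : RingTheory.Sequence.IsRegular R (List.ofFn x)) :
    Nonempty
        (((R ⧸ Ideal.span (Set.range x)) →ₗ[R]
            ((localCohomology I h).obj (ModuleCat.of R R))) ≃ₗ[R]
          ↥(⨆ n : ℕ,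
            Submodule.torsionBySet R (R ⧸ Ideal.span (Set.range x))
              ((I ^ n : Ideal R) : Set R))) ∧
      Module.Finite R
        ((R ⧸ Ideal.span (Set.range x)) →ₗ[R]
          ((localCohomology I h).obj (ModuleCat.of R R))) := by

  have hset : {r | r ∈ List.ofFn x} = Set.range x := by
    ext r
    simp [List.mem_ofFn]
  have hJ : (Ideal.ofList (List.ofFn x) • ⊤ : Submodule R R) = Ideal.span (Set.range x) := by
    rw [Ideal.ofList, hset, smul_eq_mul, Ideal.mul_top]
  obtain ⟨-, ⟨e⟩⟩ := lcMain I (List.ofFn x) (by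
    intro r hr
    obtain ⟨i, rfl⟩ := (List.mem_ofFn ..).1 hr
    exact hxI i) h (by simp) (ModuleCat.of R R) hreg.toIsWeaklyRegular
  obtain ⟨e'⟩ := lcHom (Ideal.span (Set.range x)) {r | r ∈ List.ofFn x} (by rw [hset])
    ((localCohomology I h).obj (ModuleCat.of R R))
  have e'' := e' ≪≫ₗ e ≪≫ₗ lcΓEquiv I (Submodule.quotEquivOfEq _ _ hJ)
  exact ⟨⟨e''⟩, Module.Finite.equiv e''.symm⟩
end

section
/- Let (R,m) be a Noetherian local complete ring and I an ideal of R such that H^l_I(R) = 0 for every l > h := height(I) ≥ 1; let x = x_1,…,x_h ∈ I be an R-regular sequence and set D := D(H^h_I(R)). Then √I = √((x_1,…,x_h)R) if and only if x is a D-regular sequence. -/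
open CategoryTheory

/-- The height of an ideal `I`: the infimum of the heights of the prime ideals
containing `I`. -/
noncomputable def idealHeight {R : Type} [CommRing R] (I : Ideal R) : ℕ∞ :=
  ⨅ p ∈ {p : PrimeSpectrum R | I ≤ p.asIdeal}, Order.height p

open scoped Pointwise

namespace LC

section compare

theorem sq_aux {C : Type*} [Category C] {A B D A' B' D' : C} (b : A ⟶ B) (a : B ⟶ D) (m : D ⟶ D')
    (b' : A' ⟶ B') (a' : B' ⟶ D') (u : A ⟶ A') (v : B ⟶ B') (h1 : a ≫ m = v ≫ a')
    (h2 : b ≫ v = u ≫ b') : (b ≫ a) ≫ m = u ≫ b' ≫ a' := by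
  rw [Category.assoc, h1, ← Category.assoc, h2, Category.assoc]

variable {R : Type} [CommRing R]

noncomputable def yonMap {X X' : ModuleCat.{0} R} {P : ProjectiveResolution X}
    {P' : ProjectiveResolution X'} (φ : P'.complex ⟶ P.complex) (Y : ModuleCat.{0} R) :
    P.complex.linearYonedaObj R Y ⟶ P'.complex.linearYonedaObj R Y :=
  (HomologicalComplex.unopFunctor _ _).map
    ((((linearYoneda R (ModuleCat.{0} R)).obj Y).rightOp.mapHomologicalComplex _).map φ).op

theorem isoExt_nat {X X' : ModuleCat.{0} R} (P : ProjectiveResolution X)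
    (P' : ProjectiveResolution X') (f : X' ⟶ X) (φ : P'.complex ⟶ P.complex)
    (comm : φ.f 0 ≫ P.π.f 0 = P'.π.f 0 ≫ f) (Y : ModuleCat.{0} R) (n : ℕ) :
    (P.isoExt n Y).inv ≫ ((Ext R (ModuleCat.{0} R) n).map f.op).app Y =
      HomologicalComplex.homologyMap (yonMap φ Y) n ≫ (P'.isoExt (R := R) n Y).inv := by
  have h1 := ProjectiveResolution.isoLeftDerivedObj_hom_naturality f P' P φ comm
    ((linearYoneda R (ModuleCat.{0} R)).obj Y).rightOp n
  have h2 := HomologicalComplex.homologyOp_hom_naturality (yonMap φ Y) n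
  let aP := (P.isoLeftDerivedObj ((linearYoneda R (ModuleCat.{0} R)).obj Y).rightOp n).hom
  let aP' := (P'.isoLeftDerivedObj ((linearYoneda R (ModuleCat.{0} R)).obj Y).rightOp n).hom
  let bP := ((P.complex.linearYonedaObj R Y).homologyOp n).hom
  let bP' := ((P'.complex.linearYonedaObj R Y).homologyOp n).hom
  have e1 : (P.isoExt (R := R) n Y).inv = bP.unop ≫ aP.unop := rfl
  have e1' : (P'.isoExt (R := R) n Y).inv = bP'.unop ≫ aP'.unop := rfl
  have e2 : ((Ext R (ModuleCat.{0} R) n).map f.op).app Y =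
    ((((linearYoneda R (ModuleCat.{0} R)).obj Y).rightOp.leftDerived n).map f).unop := rfl
  have h1' : aP.unop ≫ ((((linearYoneda R (ModuleCat.{0} R)).obj Y).rightOp.leftDerived n).map f).unop
    = (HomologicalComplex.homologyMap
      ((((linearYoneda R (ModuleCat.{0} R)).obj Y).rightOp.mapHomologicalComplex _).map φ) n).unop ≫
      aP'.unop := congrArg Quiver.Hom.unop h1
  have h2' : bP.unop ≫ (HomologicalComplex.homologyMap
      ((((linearYoneda R (ModuleCat.{0} R)).obj Y).rightOp.mapHomologicalComplex _).map φ) n).unop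
    = HomologicalComplex.homologyMap (yonMap φ Y) n ≫ bP'.unop := congrArg Quiver.Hom.unop h2
  exact sq_aux _ _ _ _ _ _ _ h1' h2'

variable {X : ModuleCat.{0} R} (P : ProjectiveResolution X) (Y : ModuleCat.{0} R) (n : ℕ)

/-- underlying morphism of a cycle -/
noncomputable def cyc (z : (P.complex.linearYonedaObj R Y).cycles n) : P.complex.X n ⟶ Y :=
  ((P.complex.linearYonedaObj R Y).iCycles n).hom z

theorem cyc_d (z : (P.complex.linearYonedaObj R Y).cycles n) :
    P.complex.d (n+1) n ≫ cyc P Y n z = 0 := by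
  have h := (P.complex.linearYonedaObj R Y).iCycles_d n (n+1)
  have h' := congrArg (fun f => f.hom z) h
  exact h'

theorem cyc_inj (z w : (P.complex.linearYonedaObj R Y).cycles n) (h : cyc P Y n z = cyc P Y n w) :
    z = w :=
  (ModuleCat.mono_iff_injective ((P.complex.linearYonedaObj R Y).iCycles n)).1 inferInstance h

theorem cyc_surj (f : P.complex.X n ⟶ Y) (hf : P.complex.d (n+1) n ≫ f = 0) :
    ∃ z, cyc P Y n z = f := by
  let K := P.complex.linearYonedaObj R Y
  let S := ShortComplex.mk (K.iCycles n) (K.d n (n+1)) (K.iCycles_d n (n+1))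
  have hS : S.Exact := S.exact_of_f_is_kernel (K.cyclesIsKernel n (n+1) (by simp))
  exact (ShortComplex.moduleCat_exact_iff S).1 hS f hf

theorem hpi_surj : Function.Surjective ((P.complex.linearYonedaObj R Y).homologyπ n).hom :=
  (ModuleCat.epi_iff_surjective _).1 inferInstance

noncomputable def piNew : (P.complex.linearYonedaObj R Y).cycles n →ₗ[R] Abelian.Ext X Y n where
  toFun z := P.extMk (cyc P Y n z) (n+1) rfl (cyc_d P Y n z)
  map_add' z w := by
    rw [P.add_extMk]
    congr 1
    exact map_add ((P.complex.linearYonedaObj R Y).iCycles n).hom z w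
  map_smul' r z := by
    rw [Abelian.Ext.smul_eq_comp_mk₀]
    simp only [RingHom.id_apply]
    rw [P.extMk_comp_mk₀]
    congr 1
    have h2 : cyc P Y n z ≫ (r • 𝟙 Y) = r • cyc P Y n z := by
      rw [Linear.comp_smul, Category.comp_id]
    rw [h2]
    exact map_smul ((P.complex.linearYonedaObj R Y).iCycles n).hom r z

noncomputable def piOld : (P.complex.linearYonedaObj R Y).cycles n →ₗ[R]
    ((Ext R (ModuleCat.{0} R) n).obj (Opposite.op X)).obj Y :=
  ((P.complex.linearYonedaObj R Y).homologyπ n ≫ (P.isoExt n Y).inv).hom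

theorem piNew_surj : Function.Surjective (piNew P Y n) := by
  intro a
  obtain ⟨f, hf, rfl⟩ := P.extMk_surjective a (n+1) rfl
  obtain ⟨z, rfl⟩ := cyc_surj P Y n f hf
  exact ⟨z, rfl⟩

theorem piOld_surj : Function.Surjective (piOld P Y n) := by
  have : Epi ((P.complex.linearYonedaObj R Y).homologyπ n ≫ (P.isoExt (R := R) n Y).inv) := inferInstance
  exact (ModuleCat.epi_iff_surjective _).1 this

theorem piOld_eq_zero (z) : piOld P Y n z = 0 ↔ ((P.complex.linearYonedaObj R Y).homologyπ n).hom z = 0 := by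
  have := (ModuleCat.mono_iff_injective (P.isoExt (R := R) n Y).inv).1 inferInstance
  exact (map_eq_zero_iff (P.isoExt (R := R) n Y).inv.hom this)

theorem hpi_eq_zero_succ (z) : ((P.complex.linearYonedaObj R Y).homologyπ (n+1)).hom z = 0 ↔
    ∃ g : P.complex.X n ⟶ Y, P.complex.d (n+1) n ≫ g = cyc P Y (n+1) z := by
  let K := P.complex.linearYonedaObj R Y
  let S := ShortComplex.mk (K.toCycles n (n+1)) (K.homologyπ (n+1)) (K.toCycles_comp_homologyπ _ _)
  have hS : S.Exact := S.exact_of_g_is_cokernel (K.homologyIsCokernel n (n+1) (by simp))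
  constructor
  · intro h
    obtain ⟨g, hg⟩ := (ShortComplex.moduleCat_exact_iff S).1 hS z h
    refine ⟨g, ?_⟩
    rw [← hg]
    exact congrArg (fun f => f.hom g) (K.toCycles_i n (n+1)).symm
  · rintro ⟨g, hg⟩
    have : z = (K.toCycles n (n+1)).hom g := by
      apply cyc_inj
      rw [← hg]
      exact congrArg (fun f => f.hom g) (K.toCycles_i n (n+1)).symm
    rw [this]
    exact congrArg (fun f => f.hom g) (K.toCycles_comp_homologyπ n (n+1))

theorem hpi_eq_zero_zero (z) : ((P.complex.linearYonedaObj R Y).homologyπ 0).hom z = 0 ↔ z = 0 := by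
  let K := P.complex.linearYonedaObj R Y
  have : IsIso (K.homologyπ 0) := K.isIso_homologyπ (0-1) 0 (by simp) (by
      apply K.shape; simp)
  exact (map_eq_zero_iff (K.homologyπ 0).hom ((ModuleCat.mono_iff_injective _).1 inferInstance))

theorem extMk_zero_deg (f : P.complex.X 0 ⟶ Y) (hf : P.complex.d 1 0 ≫ f = 0)
    (h : P.extMk f 1 rfl hf = 0) : f = 0 := by
  simp only [← P.extEquivCohomologyClass.apply_eq_iff_eq,
    ProjectiveResolution.extEquivCohomologyClass_extMk, ProjectiveResolution.extEquivCohomologyClass_zero,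
    CochainComplex.HomComplex.CohomologyClass.mk_eq_zero_iff] at h
  rw [CochainComplex.HomComplex.Cocycle.toSingleMk_mem_coboundaries_iff _ _ _ _ _ 1 (by simp)] at h
  obtain ⟨g, hg⟩ := h
  have hz : Limits.IsZero (P.cochainComplex.X 1) := by
    apply CochainComplex.isZero_of_isStrictlyLE _ 0 1
  rw [hz.eq_of_src g 0, Limits.comp_zero] at hg
  rw [← cancel_epi (P.cochainComplexXIso (-(0:ℕ)) 0 rfl).hom, ← hg, Limits.comp_zero]

theorem ker_eq : LinearMap.ker (piNew P Y n) = LinearMap.ker (piOld P Y n) := by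
  ext z
  rw [LinearMap.mem_ker, LinearMap.mem_ker, piOld_eq_zero]
  cases n with
  | zero =>
    rw [hpi_eq_zero_zero]
    constructor
    · intro h
      have := extMk_zero_deg P Y _ (cyc_d P Y 0 z) h
      apply cyc_inj
      rw [this]
      exact (map_zero ((P.complex.linearYonedaObj R Y).iCycles 0).hom).symm
    · rintro rfl
      simp
  | succ n =>
    rw [hpi_eq_zero_succ]
    exact P.extMk_eq_zero_iff (cyc P Y (n+1) z) (n+1+1) rfl (cyc_d P Y (n+1) z) n rfl

/-- comparison -/
noncomputable def cmp : Abelian.Ext X Y n ≃ₗ[R] ((Ext R (ModuleCat.{0} R) n).obj (Opposite.op X)).obj Y :=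
  ((piNew P Y n).quotKerEquivOfSurjective (piNew_surj P Y n)).symm ≪≫ₗ
    Submodule.quotEquivOfEq _ _ (ker_eq P Y n) ≪≫ₗ
    ((piOld P Y n).quotKerEquivOfSurjective (piOld_surj P Y n))

theorem cmp_piNew (z) : cmp P Y n (piNew P Y n z) = piOld P Y n z := by
  have : ((piNew P Y n).quotKerEquivOfSurjective (piNew_surj P Y n)).symm (piNew P Y n z) =
    Submodule.Quotient.mk z := by
    rw [LinearEquiv.symm_apply_eq]; rfl
  simp only [cmp, LinearEquiv.trans_apply]
  rw [this]
  rfl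

theorem cmp_nat {X' : ModuleCat.{0} R} (P' : ProjectiveResolution X') (f : X' ⟶ X)
    (a : Abelian.Ext X Y n) :
    cmp P' Y n ((Abelian.Ext.mk₀ f).comp a (zero_add n)) =
      (((Ext R (ModuleCat.{0} R) n).map f.op).app Y).hom (cmp P Y n a) := by
  obtain ⟨z, rfl⟩ := piNew_surj P Y n a
  let φ := ProjectiveResolution.lift f P' P
  have comm : φ.f 0 ≫ P.π.f 0 = P'.π.f 0 ≫ f := ProjectiveResolution.lift_commutes_zero f P' P
  let Φ : ProjectiveResolution.Hom P' P f := ⟨φ, by simpa using comm⟩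
  let ψ := yonMap (P := P) (P' := P') φ Y
  have e1 : cyc P' Y n ((HomologicalComplex.cyclesMap ψ n).hom z) = φ.f n ≫ cyc P Y n z :=
    congrArg (fun f => f.hom z) (HomologicalComplex.cyclesMap_i ψ n)
  have e2 : (Abelian.Ext.mk₀ f).comp (piNew P Y n z) (zero_add n) =
      piNew P' Y n ((HomologicalComplex.cyclesMap ψ n).hom z) := by
    refine (ProjectiveResolution.mk₀_comp_extMk (R := P) (R' := P') (cyc P Y n z) (n+1) rfl (cyc_d P Y n z) Φ).trans ?_
    simp only [piNew, LinearMap.coe_mk, AddHom.coe_mk, e1, Φ]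
  rw [e2, cmp_piNew, cmp_piNew]
  have h := isoExt_nat P P' f φ comm Y n
  have h3 := HomologicalComplex.homologyπ_naturality ψ n
  have h4 : HomologicalComplex.cyclesMap ψ n ≫ ((P'.complex.linearYonedaObj R Y).homologyπ n ≫ (P'.isoExt n Y).inv)
    = ((P.complex.linearYonedaObj R Y).homologyπ n ≫ (P.isoExt n Y).inv) ≫ ((Ext R (ModuleCat.{0} R) n).map f.op).app Y := by
    rw [Category.assoc, h, ← Category.assoc, ← h3, Category.assoc]
  exact congrArg (fun f => f.hom z) h4

end compare

section L

variable {R : Type} [CommRing R] (I : Ideal R)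

open Opposite

/-- `R/I^t` as an object -/
noncomputable abbrev XX (t : ℕ) : ModuleCat.{0} R :=
  (localCohomology.ringModIdeals (localCohomology.idealPowersDiagram I)).obj (op t)

noncomputable abbrev xx {s t : ℕ} (h : s ≤ t) : XX I t ⟶ XX I s :=
  (localCohomology.ringModIdeals (localCohomology.idealPowersDiagram I)).map (homOfLE h).op

variable (n : ℕ) (M : Type) [AddCommGroup M] [Module R M]

abbrev GG (t : ℕ) : Type := Abelian.Ext (XX I t) (ModuleCat.of R M) n

noncomputable def gg (s t : ℕ) (h : s ≤ t) : GG I n M s →ₗ[R] GG I n M t :=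
  Abelian.Ext.bilinearCompOfLinear R _ _ _ 0 n n (zero_add n) (Abelian.Ext.mk₀ (xx I h))

theorem gg_apply (s t : ℕ) (h : s ≤ t) (a) :
  gg I n M s t h a = (Abelian.Ext.mk₀ (xx I h)).comp a (zero_add n) := rfl

instance : DirectedSystem (GG I n M) (gg I n M · · ·) where
  map_self i x := by
    rw [gg_apply]
    have : xx I (le_refl i) = 𝟙 _ := by
      simp [xx]
    rw [this, Abelian.Ext.mk₀_id_comp]
  map_map k j i hij hjk x := by
    simp only [gg_apply]
    rw [Abelian.Ext.mk₀_comp_mk₀_assoc]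
    congr 2
    simp only [xx, ← Functor.map_comp]
    rfl

/-- local cohomology via the new Ext -/
abbrev LL : Type := Module.DirectLimit (GG I n M) (gg I n M)

noncomputable abbrev ofL (t : ℕ) : GG I n M t →ₗ[R] LL I n M := Module.DirectLimit.of R ℕ _ _ t

noncomputable def coneH (t : ℕ) : GG I n M t →ₗ[R] (localCohomology I n).obj (ModuleCat.of R M) :=
  ((Limits.colimit.ι (localCohomology.diagram (localCohomology.idealPowersDiagram I) n) (op (op t))).app
    (ModuleCat.of R M)).hom ∘ₗ (cmp (projectiveResolution (XX I t)) (ModuleCat.of R M) n).toLinearMap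

theorem coneH_comp (s t : ℕ) (h : s ≤ t) (a) : coneH I n M t (gg I n M s t h a) = coneH I n M s a := by
  have := cmp_nat (projectiveResolution (XX I s)) (ModuleCat.of R M) n (projectiveResolution (XX I t)) (xx I h) a
  have h2 := Limits.colimit.w (localCohomology.diagram (localCohomology.idealPowersDiagram I) n) (homOfLE h).op.op
  have h3 := congrArg (fun f => (f.app (ModuleCat.of R M)).hom (cmp (projectiveResolution (XX I s)) (ModuleCat.of R M) n a)) h2
  exact (congrArg (fun b => ((Limits.colimit.ι (localCohomology.diagram (localCohomology.idealPowersDiagram I) n)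
    (op (op t))).app (ModuleCat.of R M)).hom b) this).trans h3

theorem exists_equiv : Nonempty (LL I n M ≃ₗ[R] (localCohomology I n).obj (ModuleCat.of R M)) := by
  let Φ : LL I n M →ₗ[R] (localCohomology I n).obj (ModuleCat.of R M) :=
    Module.DirectLimit.lift R ℕ _ _ (coneH I n M) (coneH_comp I n M)
  let D := localCohomology.diagram (localCohomology.idealPowersDiagram I) n
  let ev := (evaluation (ModuleCat.{0} R) (ModuleCat.{0} R)).obj (ModuleCat.of R M)
  let c := ev.mapCocone (Limits.colimit.cocone D)
  have hc : Limits.IsColimit c := Limits.isColimitOfPreserves ev (Limits.colimit.isColimit D)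
  refine ⟨LinearEquiv.ofBijective Φ ⟨?_, ?_⟩⟩
  · rw [injective_iff_map_eq_zero]
    intro a ha
    obtain ⟨t, a, rfl⟩ := Module.DirectLimit.exists_of a
    rw [Module.DirectLimit.lift_of] at ha
    set b := cmp (projectiveResolution (XX I t)) (ModuleCat.of R M) n a with hb
    have hb0 : (c.ι.app (op (op t))) b = (c.ι.app (op (op t))) 0 := by
      rw [map_zero]; exact ha
    obtain ⟨k, f, g, hfg⟩ := Limits.Concrete.isColimit_exists_of_rep_eq (D ⋙ ev) hc b 0 hb0
    obtain ⟨⟨k⟩⟩ := k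
    have hle : t ≤ k := leOfHom f.unop.unop
    have hf : f = (homOfLE hle).op.op := rfl
    rw [map_zero, hf] at hfg
    have := cmp_nat (projectiveResolution (XX I t)) (ModuleCat.of R M) n (projectiveResolution (XX I k)) (xx I hle) a
    have h0 : cmp (projectiveResolution (XX I k)) (ModuleCat.of R M) n (gg I n M t k hle a) = 0 := this.trans hfg
    rw [LinearEquiv.map_eq_zero_iff] at h0
    rw [← Module.DirectLimit.of_f (hij := hle), h0, map_zero]
  · intro y
    obtain ⟨⟨⟨t⟩⟩, b, hb⟩ := Limits.Concrete.isColimit_exists_rep (D ⋙ ev) hc y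
    refine ⟨ofL I n M t ((cmp (projectiveResolution (XX I t)) (ModuleCat.of R M) n).symm b), ?_⟩
    rw [Module.DirectLimit.lift_of]
    exact (congrArg (fun b => ((Limits.colimit.ι D (op (op t))).app (ModuleCat.of R M)).hom b)
      (LinearEquiv.apply_symm_apply
        (cmp (projectiveResolution (XX I t)) (ModuleCat.of R M) n) b)).trans hb

end L

end LC

namespace LC

section les

variable {R : Type} [CommRing R] (I : Ideal R)
variable {A B C : Type} [AddCommGroup A] [Module R A] [AddCommGroup B] [Module R B]
  [AddCommGroup C] [Module R C]

noncomputable def post {n p m : ℕ} (h : n + p = m)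
    (α : Abelian.Ext (ModuleCat.of R A) (ModuleCat.of R B) p) : LL I n A →ₗ[R] LL I m B :=
  Module.DirectLimit.map
    (fun t => (Abelian.Ext.bilinearCompOfLinear R (XX I t) (ModuleCat.of R A) (ModuleCat.of R B) n p m h).flip α)
    (by
      intro i j hij
      ext a
      change ((Abelian.Ext.mk₀ (xx I hij)).comp a (zero_add n)).comp α h =
        (Abelian.Ext.mk₀ (xx I hij)).comp (a.comp α h) (zero_add m)
      exact Abelian.Ext.comp_assoc _ _ _ _ _ (by omega))

theorem post_of {n p m : ℕ} (h : n + p = m)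
    (α : Abelian.Ext (ModuleCat.of R A) (ModuleCat.of R B) p) (t : ℕ) (a : GG I n A t) :
    post I h α (ofL I n A t a) = ofL I m B t (a.comp α h) :=
  Module.DirectLimit.map_apply_of _ _ _

theorem post_exact {A₁ A₂ A₃ : Type} [AddCommGroup A₁] [Module R A₁] [AddCommGroup A₂] [Module R A₂]
    [AddCommGroup A₃] [Module R A₃] {n₁ n₂ n₃ p q : ℕ} (h : n₁ + p = n₂) (h' : n₂ + q = n₃)
    (α : Abelian.Ext (ModuleCat.of R A₁) (ModuleCat.of R A₂) p)
    (β : Abelian.Ext (ModuleCat.of R A₂) (ModuleCat.of R A₃) q)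
    (h0 : α.comp β rfl = 0)
    (hex : ∀ (t : ℕ) (x : GG I n₂ A₂ t), x.comp β h' = 0 → ∃ y : GG I n₁ A₁ t, y.comp α h = x) :
    Function.Exact (post I h α) (post I h' β) := by
  intro y
  constructor
  · intro hy
    obtain ⟨t, a, rfl⟩ := Module.DirectLimit.exists_of y
    rw [post_of] at hy
    obtain ⟨j, hij, hj⟩ := Module.DirectLimit.of.zero_exact hy
    have : (gg I n₂ A₂ t j hij a).comp β h' = 0 := by
      rw [gg_apply, Abelian.Ext.comp_assoc _ _ _ _ h' (by omega)]
      exact hj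
    obtain ⟨y, hy⟩ := hex j _ this
    refine ⟨ofL I n₁ A₁ j y, ?_⟩
    rw [post_of, hy]
    exact Module.DirectLimit.of_f
  · rintro ⟨x, rfl⟩
    obtain ⟨t, a, rfl⟩ := Module.DirectLimit.exists_of x
    rw [post_of, post_of, Abelian.Ext.comp_assoc _ _ _ _ rfl (by omega), h0, Abelian.Ext.comp_zero, map_zero]

noncomputable def Lmap (n : ℕ) (f : A →ₗ[R] B) : LL I n A →ₗ[R] LL I n B :=
  post I (add_zero n) (Abelian.Ext.mk₀ (ModuleCat.ofHom f))

theorem Lmap_smul (n : ℕ) (r : R) (x : LL I n A) : Lmap I n (r • LinearMap.id) x = r • x := by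
  obtain ⟨t, a, rfl⟩ := Module.DirectLimit.exists_of x
  rw [Lmap, post_of, ← map_smul, Abelian.Ext.smul_eq_comp_mk₀]
  rfl

variable {f : A →ₗ[R] B} {g : B →ₗ[R] C}

theorem shortExact (hf : Function.Injective f) (hg : Function.Surjective g)
    (hfg : Function.Exact f g) : (ShortComplex.mk (ModuleCat.ofHom f) (ModuleCat.ofHom g) (by
    ext x; exact hfg.apply_apply_eq_zero x)).ShortExact := by
  apply ModuleCat.shortComplex_shortExact
  · exact hfg
  · exact hf
  · exact hg

theorem les_mid (hf : Function.Injective f) (hg : Function.Surjective g)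
    (hfg : Function.Exact f g) (n : ℕ) : Function.Exact (Lmap I n f) (Lmap I n g) := by
  have hS := shortExact hf hg hfg
  apply post_exact
  · rw [Abelian.Ext.mk₀_comp_mk₀, ← Abelian.Ext.mk₀_zero]
    congr 1
    ext x; exact hfg.apply_apply_eq_zero x
  · intro t x hx
    exact Abelian.Ext.covariant_sequence_exact₂ _ hS x hx

theorem les_conn (hf : Function.Injective f) (hg : Function.Surjective g)
    (hfg : Function.Exact f g) (n : ℕ) : ∃ δ : LL I n C →ₗ[R] LL I (n+1) A,
    Function.Exact (Lmap I n g) δ ∧ Function.Exact δ (Lmap I (n+1) f) := by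
  have hS := shortExact hf hg hfg
  refine ⟨post I rfl hS.extClass, ?_, ?_⟩
  · apply post_exact
    · exact hS.comp_extClass
    · intro t x hx
      exact Abelian.Ext.covariant_sequence_exact₃ _ hS x rfl hx
  · apply post_exact
    · exact hS.extClass_comp
    · intro t x hx
      exact Abelian.Ext.covariant_sequence_exact₁ _ hS x hx rfl

theorem les_zero (hf : Function.Injective f) : Function.Injective (Lmap I 0 f) := by
  rw [injective_iff_map_eq_zero]
  intro y hy
  obtain ⟨t, a, rfl⟩ := Module.DirectLimit.exists_of y
  rw [Lmap, post_of] at hy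
  obtain ⟨j, hij, hj⟩ := Module.DirectLimit.of.zero_exact hy
  have h2 : (gg I 0 A t j hij a).comp (Abelian.Ext.mk₀ (ModuleCat.ofHom f)) (add_zero 0) = 0 := by
    rw [gg_apply, Abelian.Ext.comp_assoc _ _ _ _ (add_zero 0) (by omega)]
    exact hj
  have : Mono (ModuleCat.ofHom f) := (ModuleCat.mono_iff_injective _).2 hf
  have h3 := Abelian.Ext.postcomp_mk₀_injective_of_mono (XX I j) (ModuleCat.ofHom f)
  have h4 : gg I 0 A t j hij a = 0 := by
    apply h3
    rw [map_zero]
    exact h2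
  rw [← Module.DirectLimit.of_f (hij := hij), h4, map_zero]

end les

section basic

variable {R : Type} [CommRing R] (I : Ideal R) (n : ℕ) (M : Type) [AddCommGroup M] [Module R M]

theorem quot_smul {J : Ideal R} (y : R ⧸ J) (r : R) (hr : r ∈ J) : r • y = 0 := by
  obtain ⟨y, rfl⟩ := Submodule.Quotient.mk_surjective _ y
  rw [← Submodule.Quotient.mk_smul, Submodule.Quotient.mk_eq_zero]
  exact Ideal.mul_mem_right _ _ hr

theorem XX_smul (t : ℕ) (y : XX I t) (r : R) (hr : r ∈ I ^ t) : r • y = 0 :=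
  quot_smul (J := I ^ t) y r hr

theorem LL_torsion (x : LL I n M) : ∃ t : ℕ, ∀ r ∈ I ^ t, r • x = 0 := by
  obtain ⟨t, a, rfl⟩ := Module.DirectLimit.exists_of x
  refine ⟨t, fun r hr => ?_⟩
  rw [← map_smul]
  have : r • a = (Abelian.Ext.mk₀ (r • 𝟙 (XX I t))).comp a (zero_add n) := by
    rw [Abelian.Ext.mk₀_smul, Abelian.Ext.smul_comp, Abelian.Ext.mk₀_id_comp]
  rw [this]
  have h0 : r • 𝟙 (XX I t) = 0 := by
    ext y
    exact XX_smul I t y r hr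
  rw [h0, Abelian.Ext.mk₀_zero, Abelian.Ext.zero_comp, map_zero]

theorem LL_injective [Module.Injective R M] : Subsingleton (LL I (n+1) M) := by
  refine ⟨fun x y => ?_⟩
  have key : ∀ x : LL I (n+1) M, x = 0 := by
    intro x
    obtain ⟨t, a, rfl⟩ := Module.DirectLimit.exists_of x
    have : Injective (ModuleCat.of R M) := Module.injective_object_of_injective_module R M
    rw [Abelian.Ext.eq_zero_of_injective a, map_zero]
  rw [key x, key y]

variable {M}

/-- torsion in degree zero -/
theorem eq_zero_of_LL_zero [Subsingleton (LL I 0 M)] (m : M) (t : ℕ) (hm : ∀ r ∈ I ^ t, r • m = 0) :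
    m = 0 := by
  let φ : XX I t ⟶ ModuleCat.of R M := ModuleCat.ofHom ((I ^ t).liftQ (LinearMap.toSpanSingleton R M m)
    (by intro r hr; simpa using hm r hr))
  have h : ofL I 0 M t (Abelian.Ext.mk₀ φ) = 0 := Subsingleton.elim _ _
  obtain ⟨j, hij, hj⟩ := Module.DirectLimit.of.zero_exact h
  rw [gg_apply, Abelian.Ext.mk₀_comp_mk₀] at hj
  have h2 : xx I hij ≫ φ = 0 := by
    rw [← Abelian.Ext.homEquiv₀.symm.injective.eq_iff]
    simpa using hj
  have h3 := congrArg (fun f => f.hom (Submodule.Quotient.mk (1 : R))) h2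
  have h4 : (1:R) • m = 0 := h3
  simpa using h4

theorem exists_of_zero (x : LL I 0 M) : ∃ (t : ℕ) (φ : XX I t ⟶ ModuleCat.of R M),
    x = ofL I 0 M t (Abelian.Ext.mk₀ φ) := by
  obtain ⟨t, a, rfl⟩ := Module.DirectLimit.exists_of x
  obtain ⟨φ, rfl⟩ := Abelian.Ext.homEquiv₀.symm.surjective a
  exact ⟨t, φ, by simp⟩

theorem LL_zero_of_torsionfree (h : ∀ (m : M) (t : ℕ), (∀ r ∈ I ^ t, r • m = 0) → m = 0) :
    Subsingleton (LL I 0 M) := by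
  have key : ∀ x : LL I 0 M, x = 0 := by
    intro x
    obtain ⟨t, φ, rfl⟩ := exists_of_zero I x
    have : φ = 0 := by
      ext y
      apply h _ t
      intro r hr
      rw [← map_smul, XX_smul I t y r hr, map_zero]
    rw [this, Abelian.Ext.mk₀_zero, map_zero]
  exact ⟨fun x y => by rw [key x, key y]⟩

theorem Lmap_zero_surj {M' : Type} [AddCommGroup M'] [Module R M'] (f : M →ₗ[R] M')
    (hf : Function.Surjective f) (h : ∀ m : M, ∃ t : ℕ, ∀ r ∈ I ^ t, r • m = 0) :
    Function.Surjective (Lmap I 0 f) := by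
  intro x
  obtain ⟨t, φ, rfl⟩ := exists_of_zero I x
  obtain ⟨m, hm⟩ := hf (φ.hom (Submodule.Quotient.mk (1 : R)))
  obtain ⟨s, hs⟩ := h m
  have hst : ∀ r ∈ I ^ (max t s), r • m = 0 := fun r hr => hs r (Ideal.pow_le_pow_right (le_max_right _ _) hr)
  let ψ : XX I (max t s) ⟶ ModuleCat.of R M := ModuleCat.ofHom ((I ^ (max t s)).liftQ (LinearMap.toSpanSingleton R M m)
    (by intro r hr; simpa using hst r hr))
  refine ⟨ofL I 0 M _ (Abelian.Ext.mk₀ ψ), ?_⟩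
  rw [Lmap, post_of, Abelian.Ext.mk₀_comp_mk₀]
  refine Eq.trans ?_ (Module.DirectLimit.of_f (hij := le_max_left t s))
  rw [gg_apply, Abelian.Ext.mk₀_comp_mk₀]
  congr 2
  ext y
  obtain ⟨y, rfl⟩ := Submodule.Quotient.mk_surjective _ y
  change f (y • m) = φ.hom (Submodule.Quotient.mk y)
  rw [map_smul, hm]
  refine (map_smul φ.hom y _).symm.trans (congrArg φ.hom ?_)
  exact congrArg (Submodule.Quotient.mk (p := I ^ t)) (mul_one y)

end basic

end LC

namespace LC

section tors

variable {R : Type} [CommRing R] (I : Ideal R)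

def IsTors (M : Type) [AddCommGroup M] [Module R M] : Prop :=
  ∀ m : M, ∃ t : ℕ, ∀ r ∈ I ^ t, r • m = 0

variable (M : Type) [AddCommGroup M] [Module R M]

def gam : Submodule R M where
  carrier := {m | ∃ t : ℕ, ∀ r ∈ I ^ t, r • m = 0}
  zero_mem' := ⟨0, by simp⟩
  add_mem' := by
    rintro a b ⟨s, hs⟩ ⟨t, ht⟩
    refine ⟨max s t, fun r hr => ?_⟩
    rw [smul_add, hs r (Ideal.pow_le_pow_right (le_max_left _ _) hr),
      ht r (Ideal.pow_le_pow_right (le_max_right _ _) hr), add_zero]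
  smul_mem' := by
    rintro c a ⟨s, hs⟩
    refine ⟨s, fun r hr => ?_⟩
    rw [smul_comm, hs r hr, smul_zero]

theorem mem_gam {m : M} : m ∈ gam I M ↔ ∃ t : ℕ, ∀ r ∈ I ^ t, r • m = 0 := Iff.rfl

theorem gam_tors : IsTors I (gam I M) := by
  rintro ⟨m, t, ht⟩
  exact ⟨t, fun r hr => Subtype.ext (ht r hr)⟩

variable {M} in
theorem IsTors.quot (h : IsTors I M) (N : Submodule R M) : IsTors I (M ⧸ N) := by
  intro m
  obtain ⟨m, rfl⟩ := Submodule.Quotient.mk_surjective _ m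
  obtain ⟨t, ht⟩ := h m
  exact ⟨t, fun r hr => by rw [← Submodule.Quotient.mk_smul, ht r hr, Submodule.Quotient.mk_zero]⟩

theorem gam_injective [IsNoetherianRing R] [Module.Injective R M] : Module.Injective R (gam I M) := by
  apply Module.Baer.injective
  intro 𝔞 g
  -- uniform exponent
  let F : ℕ →o Submodule R 𝔞 :=
    { toFun := fun s =>
        { carrier := {a | ∀ r ∈ I ^ s, r • g a = 0}
          zero_mem' := by simp
          add_mem' := by
            intro a b ha hb r hr
            rw [map_add, smul_add, ha r hr, hb r hr, add_zero]
          smul_mem' := by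
            intro c a ha r hr
            rw [map_smul, smul_comm, ha r hr, smul_zero] }
      monotone' := by
        intro s t hst a ha r hr
        exact ha r (Ideal.pow_le_pow_right hst hr) }
  obtain ⟨s, hs⟩ := monotone_stabilizes_iff_noetherian.2 (inferInstance : IsNoetherian R 𝔞) F
  have hs' : ∀ a : 𝔞, ∀ r ∈ I ^ s, r • g a = 0 := by
    intro a
    obtain ⟨t, ht⟩ := gam_tors I M (g a)
    have h1 : a ∈ F (max s t) := fun r hr => ht r (Ideal.pow_le_pow_right (le_max_right _ _) hr)
    rw [← hs _ (le_max_left _ _)] at h1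
    exact h1
  obtain ⟨k, hk⟩ := Ideal.exists_pow_inf_eq_pow_smul I (M := R) 𝔞
  have hkill : ∀ a (ha : a ∈ 𝔞), a ∈ I ^ (s + k) → g ⟨a, ha⟩ = 0 := by
    intro a ha hI
    have h1 : a ∈ I ^ (s + k) • (⊤ : Ideal R) ⊓ 𝔞 := ⟨by simpa using hI, ha⟩
    rw [hk _ (by omega), Nat.add_sub_cancel] at h1
    have h2 : a ∈ I ^ s • 𝔞 := Submodule.smul_mono le_rfl inf_le_right h1
    have h3 : ∀ b ∈ I ^ s • 𝔞, ∃ hb : b ∈ 𝔞, g ⟨b, hb⟩ = 0 := by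
      intro b hb
      refine Submodule.smul_induction_on hb ?_ ?_
      · intro r hr n hn
        refine ⟨𝔞.smul_mem r hn, ?_⟩
        have : (⟨r • n, 𝔞.smul_mem r hn⟩ : 𝔞) = r • ⟨n, hn⟩ := rfl
        rw [this, map_smul, hs' _ r hr]
      · rintro x y ⟨hx, hx'⟩ ⟨hy, hy'⟩
        refine ⟨𝔞.add_mem hx hy, ?_⟩
        have : (⟨x + y, 𝔞.add_mem hx hy⟩ : 𝔞) = ⟨x, hx⟩ + ⟨y, hy⟩ := rfl
        rw [this, map_add, hx', hy', add_zero]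
    obtain ⟨_, h4⟩ := h3 a h2
    exact h4
  let q : 𝔞 →ₗ[R] R ⧸ I ^ (s + k) := (Submodule.mkQ _) ∘ₗ 𝔞.subtype
  have hq : LinearMap.ker q ≤ LinearMap.ker ((gam I M).subtype ∘ₗ g) := by
    rintro ⟨a, ha⟩ h
    have h1 : a ∈ I ^ (s + k) := (Submodule.Quotient.mk_eq_zero _).1 h
    have := hkill a ha h1
    simp [this]
  obtain ⟨H, hH⟩ := Module.Injective.out ((LinearMap.ker q).liftQ q le_rfl)
    (LinearMap.ker_eq_bot.1 (Submodule.ker_liftQ_eq_bot _ _ _ le_rfl))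
    ((LinearMap.ker q).liftQ ((gam I M).subtype ∘ₗ g) hq)
  let e : gam I M := ⟨H (Submodule.Quotient.mk 1), s + k, fun r hr => by
    rw [← map_smul, quot_smul _ r hr, map_zero]⟩
  refine ⟨LinearMap.toSpanSingleton R _ e, fun x hx => ?_⟩
  have h1 := hH (Submodule.Quotient.mk ⟨x, hx⟩)
  apply Subtype.ext
  refine Eq.trans ?_ h1
  change x • H (Submodule.Quotient.mk 1) = H (Submodule.Quotient.mk x)
  rw [← map_smul, ← Submodule.Quotient.mk_smul, smul_eq_mul, mul_one]

theorem exists_inj : ∃ (E : Type) (_ : AddCommGroup E) (_ : Module R E) (_ : Module.Injective R E)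
    (f : M →ₗ[R] E), Function.Injective f := by
  let E := Injective.under (ModuleCat.of R M)
  have : Injective (ModuleCat.of R E) := inferInstanceAs (Injective (Injective.under (ModuleCat.of R M)))
  exact ⟨E, inferInstance, inferInstance, Module.injective_module_of_injective_object R E,
    (Injective.ι (ModuleCat.of R M)).hom, (ModuleCat.mono_iff_injective _).1 inferInstance⟩

theorem LL_of_tors [IsNoetherianRing R] (n : ℕ) : ∀ (M : Type) [AddCommGroup M] [Module R M],
    IsTors I M → Subsingleton (LL I (n+1) M) := by
  induction n with
  | zero =>
    intro M _ _ hM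
    obtain ⟨E, _, _, _, f, hf⟩ := exists_inj (R := R) M
    let f' : M →ₗ[R] gam I E := f.codRestrict _ (fun m => by
      obtain ⟨t, ht⟩ := hM m
      exact ⟨t, fun r hr => by rw [← map_smul, ht r hr, map_zero]⟩)
    have hf' : Function.Injective f' := fun a b h => hf (congrArg Subtype.val h)
    have hex : Function.Exact f' (LinearMap.range f').mkQ := LinearMap.exact_map_mkQ_range f'
    obtain ⟨δ, h1, h2⟩ := les_conn I hf' (Submodule.mkQ_surjective _) hex 0
    have h3 := Lmap_zero_surj I (LinearMap.range f').mkQ (Submodule.mkQ_surjective _) (gam_tors I E)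
    have := gam_injective I E
    have := LL_injective I 0 (gam I E)
    refine ⟨fun x y => ?_⟩
    have key : ∀ x : LL I 1 M, x = 0 := by
      intro x
      obtain ⟨y, rfl⟩ := (h2 x).1 (Subsingleton.elim _ _)
      exact (h1 y).2 (h3 y)
    rw [key x, key y]
  | succ n ih =>
    intro M _ _ hM
    obtain ⟨E, _, _, _, f, hf⟩ := exists_inj (R := R) M
    let f' : M →ₗ[R] gam I E := f.codRestrict _ (fun m => by
      obtain ⟨t, ht⟩ := hM m
      exact ⟨t, fun r hr => by rw [← map_smul, ht r hr, map_zero]⟩)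
    have hf' : Function.Injective f' := fun a b h => hf (congrArg Subtype.val h)
    have hex : Function.Exact f' (LinearMap.range f').mkQ := LinearMap.exact_map_mkQ_range f'
    obtain ⟨δ, h1, h2⟩ := les_conn I hf' (Submodule.mkQ_surjective _) hex (n+1)
    have := ih (_ ⧸ LinearMap.range f') (IsTors.quot I (gam_tors I E) _)
    have := gam_injective I E
    have := LL_injective I (n+1) (gam I E)
    refine ⟨fun x y => ?_⟩
    have key : ∀ x : LL I (n+1+1) M, x = 0 := by
      intro x
      obtain ⟨y, rfl⟩ := (h2 x).1 (Subsingleton.elim _ _)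
      rw [Subsingleton.elim y 0, map_zero]
    rw [key x, key y]

end tors

section reg

variable {R : Type} [CommRing R] (I : Ideal R) {M : Type} [AddCommGroup M] [Module R M] {r : R}

theorem reg_mid (hr : IsSMulRegular M r) (n : ℕ) : Function.Exact (fun x : LL I n M => r • x)
    (Lmap I n (r • (⊤ : Submodule R M)).mkQ) := by
  have := les_mid I (f := r • (LinearMap.id : M →ₗ[R] M)) (g := (r • (⊤ : Submodule R M)).mkQ) hr
    (Submodule.mkQ_surjective _) (LinearMap.exact_lsmul_mkQ_smul_top M r) n
  convert this using 1
  ext x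
  exact (Lmap_smul I n r x).symm

theorem reg_conn (hr : IsSMulRegular M r) (n : ℕ) : ∃ δ : LL I n (QuotSMulTop r M) →ₗ[R] LL I (n+1) M,
    Function.Exact (Lmap I n (r • (⊤ : Submodule R M)).mkQ) δ ∧
    Function.Exact δ (fun x : LL I (n+1) M => r • x) := by
  obtain ⟨δ, h1, h2⟩ := les_conn I (f := r • (LinearMap.id : M →ₗ[R] M)) (g := (r • (⊤ : Submodule R M)).mkQ) hr
    (Submodule.mkQ_surjective _) (LinearMap.exact_lsmul_mkQ_smul_top M r) n
  refine ⟨δ, h1, ?_⟩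
  convert h2 using 1
  ext x
  exact (Lmap_smul I (n+1) r x).symm

theorem reg_zero (hr : IsSMulRegular M r) : ∀ x : LL I 0 M, r • x = 0 → x = 0 := by
  intro x hx
  have := les_zero I (f := r • (LinearMap.id : M →ₗ[R] M)) hr
  apply this
  rw [Lmap_smul, hx, map_zero]

end reg

section vanish

variable {R : Type} [CommRing R] (I : Ideal R)

theorem tors_inj {H : Type} [AddCommGroup H] [Module R H] (hH : IsTors I H) {r : R} (hrI : r ∈ I)
    (h : ∀ x : H, r • x = 0 → x = 0) : Subsingleton H := by
  have key : ∀ x : H, x = 0 := by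
    intro x
    obtain ⟨t, ht⟩ := hH x
    have h1 : r ^ t • x = 0 := ht _ (Ideal.pow_mem_pow hrI t)
    clear ht
    induction t with
    | zero => simpa using h1
    | succ t ih =>
      apply ih
      apply h
      rwa [← mul_smul, ← pow_succ']
  exact ⟨fun x y => by rw [key x, key y]⟩

variable {M : Type} [AddCommGroup M] [Module R M] {r : R}

theorem quot_vanish (hr : IsSMulRegular M r) (n : ℕ) (h0 : Subsingleton (LL I n M))
    (h1 : ∀ x : LL I (n+1) M, r • x = 0 → x = 0) : Subsingleton (LL I n (QuotSMulTop r M)) := by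
  obtain ⟨δ, h2, h3⟩ := reg_conn I hr n
  have key : ∀ x : LL I n (QuotSMulTop r M), x = 0 := by
    intro x
    have : δ x = 0 := h1 _ ((h3 _).2 ⟨x, rfl⟩)
    obtain ⟨y, rfl⟩ := (h2 x).1 this
    rw [Subsingleton.elim y 0, map_zero]
  exact ⟨fun x y => by rw [key x, key y]⟩

theorem inj_of_quot_vanish (hr : IsSMulRegular M r) (n : ℕ) (h0 : Subsingleton (LL I n (QuotSMulTop r M))) :
    ∀ x : LL I (n+1) M, r • x = 0 → x = 0 := by
  obtain ⟨δ, h2, h3⟩ := reg_conn I hr n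
  intro x hx
  obtain ⟨y, rfl⟩ := (h3 x).1 hx
  rw [Subsingleton.elim y 0, map_zero]

theorem surj_of_quot_vanish (hr : IsSMulRegular M r) (n : ℕ) (h0 : Subsingleton (LL I n (QuotSMulTop r M))) :
    Function.Surjective (fun x : LL I n M => r • x) := by
  intro x
  exact (reg_mid I hr n x).1 (Subsingleton.elim _ _)

/-- `LL n (M/r) ≃ ker r` -/
theorem ker_equiv (hr : IsSMulRegular M r) (n : ℕ) (h0 : Subsingleton (LL I n M)) :
    Nonempty (LL I n (QuotSMulTop r M) ≃ₗ[R] LinearMap.ker (LinearMap.lsmul R (LL I (n+1) M) r)) := by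
  obtain ⟨δ, h2, h3⟩ := reg_conn I hr n
  have hinj : Function.Injective δ := by
    rw [injective_iff_map_eq_zero]
    intro x hx
    obtain ⟨y, rfl⟩ := (h2 x).1 hx
    rw [Subsingleton.elim y 0, map_zero]
  refine ⟨LinearEquiv.ofInjective δ hinj ≪≫ₗ LinearEquiv.ofEq _ _ ?_⟩
  ext x
  exact (h3 x).symm

theorem lower_vanish (rs : List R) : ∀ (M : Type) [AddCommGroup M] [Module R M],
    (∀ r ∈ rs, r ∈ I) → RingTheory.Sequence.IsWeaklyRegular M rs → ∀ l < rs.length,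
    Subsingleton (LL I l M) := by
  induction rs with
  | nil => intro M _ _ _ _ l hl; simp at hl
  | cons r rs ih =>
    intro M _ _ hI hreg l hl
    rw [RingTheory.Sequence.isWeaklyRegular_cons_iff] at hreg
    apply tors_inj I (LL_torsion I l M) (hI r (by simp))
    cases l with
    | zero => exact reg_zero I hreg.1
    | succ l =>
      apply inj_of_quot_vanish I hreg.1
      exact ih _ (fun r hr => hI r (by simp [hr])) hreg.2 l (by simpa using hl)

theorem claimC [IsNoetherianRing R] [IsLocalRing R] (hI : I ≤ IsLocalRing.maximalIdeal R) (N : Ideal R) :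
    ∀ (M : Type) [AddCommGroup M] [Module R M] (f : R →ₗ[R] M), Function.Surjective f →
    LinearMap.ker f = N → (∀ l, Subsingleton (LL I l M)) → Subsingleton M := by
  induction N using WellFoundedGT.induction with
  | ind N ih =>
    intro M _ _ f hf hN hL
    have : Module.Finite R M := Module.Finite.of_surjective f hf
    have h0 : Subsingleton ((R ⧸ I) →ₗ[R] M) := by
      have key : ∀ φ : (R ⧸ I) →ₗ[R] M, φ = 0 := by
        intro φ
        refine LinearMap.ext fun y => ?_
        have := hL 0
        apply eq_zero_of_LL_zero I _ 1
        intro r hr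
        rw [pow_one] at hr
        rw [← map_smul, quot_smul _ r hr, map_zero]
      exact ⟨fun x y => by rw [key x, key y]⟩
    obtain ⟨b, hb, hreg⟩ := IsSMulRegular.subsingleton_linearMap_iff.1 h0
    rw [Ideal.annihilator_quotient] at hb
    have hb1 : f b = b • f 1 := by rw [← map_smul, smul_eq_mul, mul_one]
    by_cases hfb : f b = 0
    · have h1 : f 1 = 0 := by
        apply hreg
        change b • f 1 = b • 0
        rw [← hb1, hfb, smul_zero]
      have key : ∀ x : M, x = 0 := by
        intro x
        obtain ⟨y, rfl⟩ := hf x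
        rw [← mul_one y, ← smul_eq_mul, map_smul, h1, smul_zero]
      exact ⟨fun x y => by rw [key x, key y]⟩
    · have h2 : Subsingleton (QuotSMulTop b M) := by
        let f' : R →ₗ[R] QuotSMulTop b M := (b • (⊤ : Submodule R M)).mkQ ∘ₗ f
        refine ih (LinearMap.ker f') ?_ _ f' ((Submodule.mkQ_surjective _).comp hf) rfl ?_
        · subst hN
          refine lt_of_le_of_ne (fun y hy => ?_) ?_
          · have : f y = 0 := hy
            simp [f', this]
          · intro h
            apply hfb
            have : b ∈ LinearMap.ker f' := by
              change Submodule.Quotient.mk (f b) = 0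
              rw [Submodule.Quotient.mk_eq_zero, hb1]
              exact Submodule.smul_mem_pointwise_smul _ _ _ trivial
            rw [← h] at this
            exact this
        · intro l
          apply quot_vanish I hreg l (hL l)
          intro x _
          have := hL (l+1)
          exact Subsingleton.elim _ _
      have h3 : (⊤ : Submodule R M) = ⊥ := by
        refine Submodule.eq_bot_of_le_smul_of_le_jacobson_bot (IsLocalRing.maximalIdeal R) ⊤
          Module.Finite.fg_top ?_ (IsLocalRing.maximalIdeal_le_jacobson _)
        rw [Submodule.Quotient.subsingleton_iff] at h2
        conv_lhs => rw [← h2]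
        intro x hx
        obtain ⟨y, _, rfl⟩ := hx
        exact Submodule.smul_mem_smul (hI hb) trivial
      exact (Submodule.subsingleton_iff R).1 (subsingleton_of_bot_eq_top h3.symm)

end vanish

end LC

namespace LC

section dual

variable {R : Type} [CommRing R] (E : Type) [AddCommGroup E] [Module R E] [Module.Injective R E]
  {H : Type} [AddCommGroup H] [Module R H]

theorem dual_sep [IsLocalRing R] (e : IsLocalRing.ResidueField R →ₗ[R] E) (he : Function.Injective e)
    (h : H) (hh : h ≠ 0) : ∃ f : H →ₗ[R] E, f h ≠ 0 := by
  let T := LinearMap.toSpanSingleton R H h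
  have hk : LinearMap.ker T ≤ LinearMap.ker (Algebra.linearMap R (IsLocalRing.ResidueField R)) := by
    intro r hr
    have h1 : r • h = 0 := hr
    have : r ∈ IsLocalRing.maximalIdeal R := by
      rw [IsLocalRing.mem_maximalIdeal, mem_nonunits_iff]
      intro hu
      exact hh ((hu.smul_eq_zero).1 h1)
    exact (IsLocalRing.residue_eq_zero_iff r).2 this
  obtain ⟨f, hf⟩ := Module.Injective.out ((LinearMap.ker T).liftQ T le_rfl)
    (LinearMap.ker_eq_bot.1 (Submodule.ker_liftQ_eq_bot _ _ _ le_rfl))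
    (e ∘ₗ (LinearMap.ker T).liftQ _ hk)
  refine ⟨f, fun h0 => ?_⟩
  have h1 := hf (Submodule.Quotient.mk 1)
  have h2 : f ((1 : R) • h) = e (algebraMap R (IsLocalRing.ResidueField R) 1) := h1
  rw [one_smul, h0, map_one] at h2
  exact one_ne_zero (he ((map_zero e).trans h2)).symm

variable {E} in
theorem reg_dual (hsep : ∀ (H : Type) [AddCommGroup H] [Module R H] (h : H), h ≠ 0 → ∃ f : H →ₗ[R] E, f h ≠ 0)
    (r : R) : IsSMulRegular (H →ₗ[R] E) r ↔ Function.Surjective (fun x : H => r • x) := by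
  constructor
  · intro hr
    by_contra hns
    have hne : (r • (⊤ : Submodule R H)) ≠ ⊤ := by
      intro h
      apply hns
      intro x
      have : x ∈ r • (⊤ : Submodule R H) := by rw [h]; trivial
      obtain ⟨y, _, hy⟩ := this
      exact ⟨y, hy⟩
    obtain ⟨x, hx⟩ : ∃ x, x ∉ r • (⊤ : Submodule R H) := by
      by_contra! h
      exact hne (eq_top_iff.2 fun x _ => h x)
    obtain ⟨f, hf⟩ := hsep (H ⧸ r • (⊤ : Submodule R H)) (Submodule.Quotient.mk x)
      (by rwa [Ne, Submodule.Quotient.mk_eq_zero])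
    have h0 : f ∘ₗ (r • (⊤ : Submodule R H)).mkQ = 0 := by
      apply hr
      change r • (f ∘ₗ (r • (⊤ : Submodule R H)).mkQ) = r • 0
      ext y
      have : (Submodule.Quotient.mk (r • y) : H ⧸ r • (⊤ : Submodule R H)) = 0 := by
        rw [Submodule.Quotient.mk_eq_zero]
        exact Submodule.smul_mem_pointwise_smul _ _ _ trivial
      simp only [LinearMap.smul_apply, LinearMap.comp_apply, Submodule.mkQ_apply, smul_zero, LinearMap.zero_apply]
      rw [← map_smul, ← Submodule.Quotient.mk_smul, this, map_zero]
    exact hf (congrArg (fun g => g x) h0)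
  · intro hs f g hfg
    ext x
    obtain ⟨y, rfl⟩ := hs x
    have := congrArg (fun g => g y) hfg
    simpa using this

theorem quotD (r : R) : Nonempty (QuotSMulTop r (H →ₗ[R] E) ≃ₗ[R]
    (LinearMap.ker (LinearMap.lsmul R H r) →ₗ[R] E)) := by
  let K := LinearMap.ker (LinearMap.lsmul R H r)
  let ρ : (H →ₗ[R] E) →ₗ[R] (K →ₗ[R] E) := LinearMap.lcomp R E K.subtype
  have hs : Function.Surjective ρ := by
    intro g
    obtain ⟨f, hf⟩ := Module.Injective.out K.subtype K.injective_subtype g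
    exact ⟨f, LinearMap.ext hf⟩
  have hk : r • (⊤ : Submodule R (H →ₗ[R] E)) = LinearMap.ker ρ := by
    ext f
    constructor
    · rintro ⟨g, _, rfl⟩
      ext ⟨x, hx⟩
      have hx' : r • x = 0 := hx
      change r • g x = 0
      rw [← map_smul, hx', map_zero]
    · intro hf
      have hle : K ≤ LinearMap.ker f := by
        intro x hx
        exact congrArg (fun g => g ⟨x, hx⟩) (LinearMap.mem_ker.1 hf)
      obtain ⟨g, hg⟩ := Module.Injective.out (K.liftQ (LinearMap.lsmul R H r) le_rfl)
        (LinearMap.ker_eq_bot.1 (Submodule.ker_liftQ_eq_bot _ _ _ le_rfl)) (K.liftQ f hle)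
      refine ⟨g, trivial, ?_⟩
      ext x
      have h1 : g (r • x) = f x := hg (Submodule.Quotient.mk x)
      change r • g x = f x
      rw [← map_smul, h1]
  exact ⟨Submodule.quotEquivOfEq _ _ hk ≪≫ₗ ρ.quotKerEquivOfSurjective hs⟩

theorem wr_iff (r : R) (rs : List R) {K : Type} [AddCommGroup K] [Module R K]
    (e2 : K ≃ₗ[R] LinearMap.ker (LinearMap.lsmul R H r)) :
    RingTheory.Sequence.IsWeaklyRegular (QuotSMulTop r (H →ₗ[R] E)) rs ↔
      RingTheory.Sequence.IsWeaklyRegular (K →ₗ[R] E) rs := by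
  obtain ⟨e3⟩ := quotD E (H := H) r
  exact LinearEquiv.isWeaklyRegular_congr (e3 ≪≫ₗ LinearEquiv.congrLeft E R e2.symm) rs

end dual

section main

variable {R : Type} [CommRing R] (I : Ideal R)

theorem Lmap_equiv {A B : Type} [AddCommGroup A] [Module R A] [AddCommGroup B] [Module R B]
    (e : A ≃ₗ[R] B) (n : ℕ) (h : Subsingleton (LL I n A)) : Subsingleton (LL I n B) := by
  have key : ∀ x : LL I n B, x = 0 := by
    intro x
    have h1 : Lmap I n e.toLinearMap (Lmap I n e.symm.toLinearMap x) = x := by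
      obtain ⟨t, a, rfl⟩ := Module.DirectLimit.exists_of x
      rw [Lmap, Lmap, post_of, post_of, Abelian.Ext.comp_assoc_of_second_deg_zero,
        Abelian.Ext.mk₀_comp_mk₀]
      have : ModuleCat.ofHom e.symm.toLinearMap ≫ ModuleCat.ofHom e.toLinearMap = 𝟙 _ := by
        ext x; exact e.apply_symm_apply x
      rw [this, Abelian.Ext.comp_mk₀_id]
    rw [← h1, Subsingleton.elim (Lmap I n e.symm.toLinearMap x) 0, map_zero]
  exact ⟨fun x y => by rw [key x, key y]⟩

theorem IsTors.equiv {A B : Type} [AddCommGroup A] [Module R A] [AddCommGroup B] [Module R B]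
    (e : A ≃ₗ[R] B) (h : IsTors I A) : IsTors I B := by
  intro b
  obtain ⟨t, ht⟩ := h (e.symm b)
  refine ⟨t, fun r hr => ?_⟩
  apply e.symm.injective
  rw [map_smul, ht r hr, map_zero]

theorem quot_vanish_of_surj {M : Type} [AddCommGroup M] [Module R M] {r : R} (hr : IsSMulRegular M r) (n : ℕ)
    (h0 : Function.Surjective (fun x : LL I n M => r • x))
    (h1 : Subsingleton (LL I (n+1) M)) : Subsingleton (LL I n (QuotSMulTop r M)) := by
  obtain ⟨δ, h2, h3⟩ := reg_conn I hr n
  have key : ∀ x : LL I n (QuotSMulTop r M), x = 0 := by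
    intro x
    obtain ⟨y, rfl⟩ := (h2 x).1 (Subsingleton.elim _ _)
    exact (reg_mid I hr n y).2 (h0 y)
  exact ⟨fun x y => by rw [key x, key y]⟩

variable {E : Type} [AddCommGroup E] [Module R E] [Module.Injective R E]

theorem backward
    (hsep : ∀ (H : Type) [AddCommGroup H] [Module R H] (h : H), h ≠ 0 → ∃ f : H →ₗ[R] E, f h ≠ 0)
    (rs : List R) : ∀ (M : Type) [AddCommGroup M] [Module R M],
    (∀ r ∈ rs, r ∈ I) → RingTheory.Sequence.IsWeaklyRegular M rs →
    (∀ l, l ≠ rs.length → Subsingleton (LL I l M)) →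
    RingTheory.Sequence.IsWeaklyRegular (LL I rs.length M →ₗ[R] E) rs →
    ∀ l, l ≠ 0 → Subsingleton (LL I l (M ⧸ Ideal.ofList rs • (⊤ : Submodule R M))) := by
  induction rs with
  | nil =>
    intro M _ _ _ _ h _ l hl
    refine Lmap_equiv I (Submodule.quotEquivOfEqBot _ ?_).symm l (h l hl)
    simp
  | cons r rs ih =>
    intro M _ _ hI hreg hL hD l hl
    rw [List.length_cons] at hD
    rw [RingTheory.Sequence.isWeaklyRegular_cons_iff] at hreg hD
    obtain ⟨hr, hreg⟩ := hreg
    obtain ⟨hrD, hD⟩ := hD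
    rw [reg_dual hsep] at hrD
    have e1 := Submodule.quotOfListConsSMulTopEquivQuotSMulTopInner M r rs
    refine Lmap_equiv I e1.symm l ?_
    refine ih (QuotSMulTop r M) (fun r hr => hI r (by simp [hr])) hreg ?_ ?_ l hl
    · intro k hk
      by_cases hk2 : k = rs.length + 1
      · subst hk2
        exact quot_vanish_of_surj I hr _ hrD (hL _ (by simp))
      · have := hL (k+1) (by simpa using hk)
        exact quot_vanish I hr k (hL k (by simpa using hk2)) (fun x _ => Subsingleton.elim _ _)
    · obtain ⟨e2⟩ := ker_equiv I hr rs.length (hL rs.length (by simp))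
      exact (wr_iff E r rs e2).1 hD

theorem forward [IsNoetherianRing R]
    (hsep : ∀ (H : Type) [AddCommGroup H] [Module R H] (h : H), h ≠ 0 → ∃ f : H →ₗ[R] E, f h ≠ 0)
    (rs : List R) : ∀ (M : Type) [AddCommGroup M] [Module R M],
    (∀ r ∈ rs, r ∈ I) → RingTheory.Sequence.IsWeaklyRegular M rs →
    IsTors I (M ⧸ Ideal.ofList rs • (⊤ : Submodule R M)) →
    (∀ l, rs.length < l → Subsingleton (LL I l M)) ∧
    RingTheory.Sequence.IsWeaklyRegular (LL I rs.length M →ₗ[R] E) rs := by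
  induction rs with
  | nil =>
    intro M _ _ _ _ h
    refine ⟨?_, RingTheory.Sequence.IsWeaklyRegular.nil _ _⟩
    intro l hl
    obtain ⟨l, rfl⟩ := Nat.exists_eq_succ_of_ne_zero (show l ≠ 0 by simp at hl; omega)
    exact LL_of_tors I l M (IsTors.equiv I (Submodule.quotEquivOfEqBot _ (by simp)) h)
  | cons r rs ih =>
    intro M _ _ hI hreg hT
    have hlow := lower_vanish I (r :: rs) M hI hreg
    rw [List.length_cons]
    rw [RingTheory.Sequence.isWeaklyRegular_cons_iff] at hreg ⊢
    obtain ⟨hr, hreg⟩ := hreg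
    have e1 := Submodule.quotOfListConsSMulTopEquivQuotSMulTopInner M r rs
    obtain ⟨h1, h2⟩ := ih (QuotSMulTop r M) (fun r hr => hI r (by simp [hr])) hreg (IsTors.equiv I e1 hT)
    refine ⟨?_, ?_, ?_⟩
    · intro l hl
      obtain ⟨l, rfl⟩ := Nat.exists_eq_succ_of_ne_zero (show l ≠ 0 by omega)
      apply tors_inj I (LL_torsion I _ M) (hI r (by simp))
      exact inj_of_quot_vanish I hr l (h1 l (by simpa using hl))
    · rw [reg_dual hsep]
      exact surj_of_quot_vanish I hr _ (h1 _ (by simp))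
    · obtain ⟨e2⟩ := ker_equiv I hr rs.length (hlow rs.length (by simp))
      exact (wr_iff E r rs e2).2 h2

theorem unif {N : Type} [AddCommGroup N] [Module R N] [IsNoetherian R N] (h : IsTors I N) :
    ∃ s : ℕ, ∀ a : N, ∀ r ∈ I ^ s, r • a = 0 := by
  let F : ℕ →o Submodule R N :=
    { toFun := fun s =>
        { carrier := {a | ∀ r ∈ I ^ s, r • a = 0}
          zero_mem' := by simp
          add_mem' := by
            intro a b ha hb r hr
            rw [smul_add, ha r hr, hb r hr, add_zero]
          smul_mem' := by
            intro c a ha r hr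
            rw [smul_comm, ha r hr, smul_zero] }
      monotone' := by
        intro s t hst a ha r hr
        exact ha r (Ideal.pow_le_pow_right hst hr) }
  obtain ⟨s, hs⟩ := monotone_stabilizes_iff_noetherian.2 (inferInstance : IsNoetherian R N) F
  refine ⟨s, fun a => ?_⟩
  obtain ⟨t, ht⟩ := h a
  have h1 : a ∈ F (max s t) := fun r hr => ht r (Ideal.pow_le_pow_right (le_max_right _ _) hr)
  rw [← hs _ (le_max_left _ _)] at h1
  exact h1

theorem all_tors [IsNoetherianRing R] [IsLocalRing R] (hI : I ≤ IsLocalRing.maximalIdeal R)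
    (Q : Type) [AddCommGroup Q] [Module R Q] (f : R →ₗ[R] Q) (hf : Function.Surjective f)
    (h : ∀ l, l ≠ 0 → Subsingleton (LL I l Q)) : IsTors I Q := by
  have : Module.Finite R Q := Module.Finite.of_surjective f hf
  let G := gam I Q
  have hG : IsTors I G := gam_tors I Q
  obtain ⟨s, hs⟩ := unif I hG
  have hsub : Subsingleton (Q ⧸ G) := by
    refine claimC I hI _ (Q ⧸ G) (G.mkQ ∘ₗ f) ((Submodule.mkQ_surjective _).comp hf) rfl ?_
    intro l
    cases l with
    | zero =>
      apply LL_zero_of_torsionfree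
      intro m t hm
      obtain ⟨m, rfl⟩ := Submodule.Quotient.mk_surjective _ m
      rw [Submodule.Quotient.mk_eq_zero]
      refine ⟨s + t, fun r hr => ?_⟩
      rw [pow_add] at hr
      refine Submodule.mul_induction_on hr ?_ ?_
      · intro a ha b hb
        have hb1 := hm b hb
        rw [← Submodule.Quotient.mk_smul, Submodule.Quotient.mk_eq_zero] at hb1
        have := congrArg Subtype.val (hs ⟨_, hb1⟩ a ha)
        rw [mul_smul]
        exact this
      · intro x y hx hy
        rw [add_smul, hx, hy, add_zero]
    | succ l =>
      obtain ⟨δ, h1, h2⟩ := les_conn I G.injective_subtype G.mkQ_surjective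
        (LinearMap.exact_subtype_mkQ G) (l+1)
      have := LL_of_tors I (l+1) G hG
      have := h (l+1) (by simp)
      have key : ∀ x : LL I (l+1) (Q ⧸ G), x = 0 := by
        intro x
        obtain ⟨y, rfl⟩ := (h1 x).1 (Subsingleton.elim _ _)
        rw [Subsingleton.elim y 0, map_zero]
      exact ⟨fun x y => by rw [key x, key y]⟩
  rw [Submodule.Quotient.subsingleton_iff] at hsub
  intro q
  have : q ∈ G := by rw [hsub]; trivial
  exact this

end main

end LC

namespace LC

theorem le_max {R : Type} [CommRing R] [IsLocalRing R] (I : Ideal R) (h : ℕ)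
    (hht : idealHeight I = (h : ℕ∞)) : I ≤ IsLocalRing.maximalIdeal R := by
  apply IsLocalRing.le_maximalIdeal
  rintro rfl
  have : idealHeight (⊤ : Ideal R) = ⊤ := by
    unfold idealHeight
    rw [iInf₂_eq_top]
    intro p hp
    exact absurd (top_le_iff.1 hp) p.isPrime.ne_top
  rw [this] at hht
  exact ENat.top_ne_natCast _ hht

theorem core {R : Type} [CommRing R] [IsNoetherianRing R] [IsLocalRing R]
    (E : Type) [AddCommGroup E] [Module R E] [Module.Injective R E]
    (hsep : ∀ (H : Type) [AddCommGroup H] [Module R H] (h : H), h ≠ 0 → ∃ f : H →ₗ[R] E, f h ≠ 0)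
    (I : Ideal R) (hI : I ≤ IsLocalRing.maximalIdeal R) (rs : List R)
    (hvan : ∀ l : ℕ, rs.length < l → Subsingleton (LL I l R))
    (hrs : ∀ r ∈ rs, r ∈ I) (hreg : RingTheory.Sequence.IsWeaklyRegular R rs) :
    I.radical = (Ideal.ofList rs).radical ↔
      RingTheory.Sequence.IsRegular (LL I rs.length R →ₗ[R] E) rs := by
  have hlow := lower_vanish I rs R hrs hreg
  have hJ : Ideal.ofList rs ≤ I := Ideal.span_le.2 hrs
  constructor
  · intro hrad
    obtain ⟨t, ht⟩ := Ideal.exists_pow_le_of_le_radical_of_fg (I := I) (J := Ideal.ofList rs)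
      (Ideal.le_radical.trans hrad.le) (IsNoetherian.noetherian I)
    have hT : IsTors I (R ⧸ Ideal.ofList rs • (⊤ : Submodule R R)) := by
      intro q
      obtain ⟨q, rfl⟩ := Submodule.Quotient.mk_surjective _ q
      refine ⟨t, fun r hr => ?_⟩
      rw [← Submodule.Quotient.mk_smul, Submodule.Quotient.mk_eq_zero]
      exact Submodule.smul_mem_smul (ht hr) trivial
    refine ⟨(forward I hsep rs R hrs hreg hT).2, ?_⟩
    have hne : ¬ Subsingleton (LL I rs.length R) := by
      intro h0
      have : Subsingleton R := claimC I hI _ R LinearMap.id Function.surjective_id rfl (fun l => by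
        rcases lt_trichotomy l rs.length with h | h | h
        · exact hlow l h
        · subst h; exact h0
        · exact hvan l h)
      exact zero_ne_one (Subsingleton.elim (0 : R) 1)
    -- a nonzero socle-type element
    obtain ⟨a, ha0, ha⟩ : ∃ a : LL I rs.length R, a ≠ 0 ∧ ∀ r ∈ I, r • a = 0 := by
      have hT := LL_torsion I rs.length R
      by_contra! hcon
      apply hne
      have key : ∀ t : ℕ, ∀ x : LL I rs.length R, (∀ r ∈ I ^ t, r • x = 0) → x = 0 := by
        intro t
        induction t with
        | zero => intro x hx; simpa using hx 1 (by simp)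
        | succ t ih =>
          intro x hx
          apply ih
          intro r hr
          by_contra hne0
          obtain ⟨b, hb, hb0⟩ := hcon _ hne0
          apply hb0
          rw [← mul_smul]
          apply hx
          rw [pow_succ']
          exact Ideal.mul_mem_mul hb hr
      have key2 : ∀ x : LL I rs.length R, x = 0 := fun x => by
        obtain ⟨t, ht⟩ := hT x
        exact key t x ht
      exact ⟨fun x y => by rw [key2 x, key2 y]⟩
    obtain ⟨f, hf⟩ := hsep _ a ha0
    intro htop
    have hfm : f ∈ Ideal.ofList rs • (⊤ : Submodule R (LL I rs.length R →ₗ[R] E)) := by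
      rw [← htop]; trivial
    apply hf
    refine Submodule.smul_induction_on (p := fun g : LL I rs.length R →ₗ[R] E => g a = 0) hfm ?_ ?_
    · intro r hr g _
      rw [LinearMap.smul_apply, ← map_smul, ha r (hJ hr), map_zero]
    · intro g g' hg hg'
      rw [LinearMap.add_apply, hg, hg', add_zero]
  · intro hD
    have hb := backward I hsep rs R hrs hreg (fun l hl => by
        rcases lt_or_gt_of_ne hl with h | h
        · exact hlow l h
        · exact hvan l h) hD.toIsWeaklyRegular
    have hT := all_tors I hI _ (Submodule.mkQ _) (Submodule.mkQ_surjective _) hb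
    obtain ⟨t, ht⟩ := hT (Submodule.Quotient.mk 1)
    apply le_antisymm
    · have h1 : I ^ t ≤ Ideal.ofList rs := by
        intro r hr
        have := ht r hr
        rw [← Submodule.Quotient.mk_smul, Submodule.Quotient.mk_eq_zero] at this
        simpa using this
      intro a ha
      obtain ⟨k, hk⟩ := ha
      exact ⟨k * t, by rw [pow_mul]; exact h1 (Ideal.pow_mem_pow hk t)⟩
    · exact Ideal.radical_mono hJ

end LC

/-- Let `(R, m)` be a noetherian local complete ring, `E` an injective
hull of the residue field `R/m` and `D(-) = Hom_R(-, E)` the Matlis dual functor.  Let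
`I` be an ideal of `R` such that `H^l_I(R) = 0` for every `l > h := height I ≥ 1`, and
let `x = x₁,…,x_h ∈ I` be an `R`-regular sequence.  Set `D := D(H^h_I(R))`.  Then
`√I = √((x₁,…,x_h)R)` if and only if `x` is a `D`-regular sequence. -/
theorem stmt17 {R : Type} [CommRing R] [IsNoetherianRing R] [IsLocalRing R]
    [IsAdicComplete (IsLocalRing.maximalIdeal R) R]
    (E : Type) [AddCommGroup E] [Module R E] [Module.Injective R E]
    (e : IsLocalRing.ResidueField R →ₗ[R] E) (he : Function.Injective e)
    (hess : ∀ N : Submodule R E, N ≠ ⊥ → N ⊓ LinearMap.range e ≠ ⊥)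
    (I : Ideal R) (h : ℕ) (hh : 1 ≤ h) (hht : idealHeight I = (h : ℕ∞))
    (hvan : ∀ l : ℕ, h < l → Subsingleton ((localCohomology I l).obj (ModuleCat.of R R)))
    (x : Fin h → R) (hxI : ∀ i, x i ∈ I)
    (hreg : RingTheory.Sequence.IsRegular R (List.ofFn x)) :
    I.radical = (Ideal.span (Set.range x)).radical ↔
      RingTheory.Sequence.IsRegular
        ((((localCohomology I h).obj (ModuleCat.of R R)) →ₗ[R] E)) (List.ofFn x) := by
  have hlen : (List.ofFn x).length = h := List.length_ofFn
  have hspan : Ideal.span (Set.range x) = Ideal.ofList (List.ofFn x) := by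
    rw [Ideal.ofList]
    congr 1
    ext r
    simp [List.mem_ofFn]
  have hc := LC.core E (fun H _ _ a ha => LC.dual_sep E e he a ha) I (LC.le_max I h hht) (List.ofFn x)
    (fun l hl => by
      obtain ⟨q⟩ := LC.exists_equiv I l R
      have := hvan l (hlen ▸ hl)
      exact q.toEquiv.subsingleton)
    (fun r hr => by
      obtain ⟨i, rfl⟩ := (List.mem_ofFn' x r).1 hr
      exact hxI i) hreg.toIsWeaklyRegular
  rw [hlen] at hc
  obtain ⟨q⟩ := LC.exists_equiv I h R
  rw [hspan, hc]
  exact LinearEquiv.isRegular_congr (LinearEquiv.congrLeft E R q) (List.ofFn x)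
end
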